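/- If the Riemann Hypothesis is true, then for all real x ≥ 23.8, |e^C · log x · ∏_{p ≤ x} (1 - 1/p) - 1| ≤ 3 log x / (8π√x), where C is the Euler–Mascheroni constant. -/

import Mathlib

open Real Finset

namespace MT

lemma extract_one (f : ℂ → ℂ) (hf : Differentiable ℂ f) (w : ℂ) (h : analyticOrderAt f w ≠ ⊤) :
    ∃ g : ℂ → ℂ, Differentiable ℂ g ∧ (∀ z, f z = (z - w) ^ (analyticOrderNatAt f w) * g z) ∧
      g w ≠ 0 := by
  set n := analyticOrderNatAt f w with hn
  have hfa : AnalyticAt ℂ f w := hf.analyticAt w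
  have hn' : analyticOrderAt f w = (n : ℕ∞) := (Nat.cast_analyticOrderNatAt h).symm
  obtain ⟨g, hga, hgw, hg⟩ := (hfa.analyticOrderAt_eq_natCast).1 hn'
  classical
  refine ⟨fun z => if z = w then g w else f z / (z - w) ^ n, ?_, ?_, ?_⟩
  · intro z
    by_cases hz : z = w
    · subst hz
      have : (fun x => if x = z then g z else f x / (x - z) ^ n) =ᶠ[nhds z] g := by
        filter_upwards [hg] with x hx
        by_cases hxz : x = z
        · simp [hxz]
        · have : (x - z) ^ n ≠ 0 := pow_ne_zero _ (sub_ne_zero.2 hxz)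
          simp only [hxz, if_false, hx, smul_eq_mul]
          field_simp
      exact hga.differentiableAt.congr_of_eventuallyEq this
    · have : (fun x => if x = w then g w else f x / (x - w) ^ n) =ᶠ[nhds z]
          fun x => f x / (x - w) ^ n := by
        filter_upwards [isOpen_ne.mem_nhds hz] with x hx
        have hx' : x ≠ w := hx
        simp [hx']
      refine DifferentiableAt.congr_of_eventuallyEq ?_ this
      exact (hf z).div (by fun_prop) (pow_ne_zero _ (sub_ne_zero.2 hz))
  · intro z
    by_cases hz : z = w
    · subst hz
      have := hg.self_of_nhds
      simpa using this
    · have : (z - w) ^ n ≠ 0 := pow_ne_zero _ (sub_ne_zero.2 hz)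
      simp only [hz, if_false]
      field_simp
  · simpa using hgw

lemma order_ne_top (f : ℂ → ℂ) (hf : Differentiable ℂ f) (c : ℂ) (hc : f c ≠ 0) (w : ℂ) :
    analyticOrderAt f w ≠ ⊤ := by
  intro h
  have hA : AnalyticOnNhd ℂ f Set.univ := fun z _ => hf.analyticAt z
  have := hA.eqOn_zero_of_preconnected_of_eventuallyEq_zero isPreconnected_univ (Set.mem_univ w)
    (analyticOrderAt_eq_top.1 h)
  exact hc (this (Set.mem_univ c))

lemma extract_finset (f : ℂ → ℂ) (hf : Differentiable ℂ f) (c : ℂ) (hc : f c ≠ 0) (S : Finset ℂ) :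
    ∃ g : ℂ → ℂ, Differentiable ℂ g ∧
      (∀ z, f z = (∏ w ∈ S, (z - w) ^ (analyticOrderNatAt f w)) * g z) ∧
      ∀ w ∈ S, g w ≠ 0 := by
  classical
  induction S using Finset.induction_on with
  | empty => exact ⟨f, hf, by simp, by simp⟩
  | insert w S hw ih =>
    obtain ⟨g, hg, hfg, hgS⟩ := ih
    have hPd : Differentiable ℂ (fun z => ∏ w ∈ S, (z - w) ^ (analyticOrderNatAt f w)) := by
      fun_prop
    have hord : analyticOrderAt f w = analyticOrderAt g w := by
      have e : f = (fun z => ∏ w ∈ S, (z - w) ^ (analyticOrderNatAt f w)) * g := by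
        ext z; simpa using hfg z
      conv_lhs => rw [e]
      rw [analyticOrderAt_mul (hPd.analyticAt w) (hg.analyticAt w)]
      have : analyticOrderAt (fun z => ∏ w ∈ S, (z - w) ^ (analyticOrderNatAt f w)) w = 0 := by
        rw [(hPd.analyticAt w).analyticOrderAt_eq_zero]
        refine Finset.prod_ne_zero_iff.2 fun v hv => pow_ne_zero _ (sub_ne_zero.2 ?_)
        rintro rfl; exact hw hv
      rw [this, zero_add]
    have htop := order_ne_top f hf c hc w
    obtain ⟨k, hk, hgk, hkw⟩ := extract_one g hg w (hord ▸ htop)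
    have hN : analyticOrderNatAt g w = analyticOrderNatAt f w := by
      simp only [analyticOrderNatAt, hord]
    rw [hN] at hgk
    refine ⟨k, hk, ?_, ?_⟩
    · intro z
      rw [Finset.prod_insert hw, hfg z, hgk z]; ring
    · intro v hv
      rcases Finset.mem_insert.1 hv with rfl | hv
      · exact hkw
      · intro h0
        apply hgS v hv
        rw [hgk v, h0, mul_zero]

lemma logDeriv_lip0 (G : ℂ → ℂ) (hG : Differentiable ℂ G) (ρ M : ℝ) (hρ : 0 < ρ) (hM : 0 < M)
    (hnz : ∀ z ∈ Metric.ball (0:ℂ) ρ, G z ≠ 0)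
    (hb : ∀ z ∈ Metric.ball (0:ℂ) ρ, ‖G z‖ ≤ Real.exp M * ‖G 0‖) (z₁ z₂ : ℂ)
    (h₁ : ‖z₁‖ < ρ / 8) (h₂ : ‖z₂‖ < ρ / 8) :
    ‖logDeriv G z₁ - logDeriv G z₂‖ ≤ 64 * M / ρ ^ 2 * ‖z₁ - z₂‖ := by
  have hD : DifferentiableOn ℂ (fun z => deriv G z / G z) (Metric.ball 0 ρ) := by
    intro z hz
    have : DifferentiableAt ℂ (deriv G) z := (hG.analyticAt z).deriv.differentiableAt
    exact (this.div (hG z) (hnz z hz)).differentiableWithinAt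
  obtain ⟨φ, hφ0, hφ⟩ := (hD.isExactOn_ball).with_val_at 0 0
  have h0 : (0:ℂ) ∈ Metric.ball (0:ℂ) ρ := by simpa using hρ
  have hconst : ∀ z ∈ Metric.ball (0:ℂ) ρ, G z = G 0 * Complex.exp (φ z) := by
    intro z hz
    have hd : ∀ x ∈ Metric.ball (0:ℂ) ρ,
        HasDerivAt (fun y => G y * Complex.exp (- φ y)) 0 x := by
      intro x hx
      have h1 := (hG x).hasDerivAt.mul ((hφ x hx).neg.cexp)
      have h2 := hnz x hx
      have h3 : G x * (deriv G x / G x) = deriv G x := by field_simp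
      refine h1.congr_deriv ?_
      linear_combination (-Complex.exp (-φ x)) * h3
    have := (convex_ball (0:ℂ) ρ).is_const_of_fderivWithin_eq_zero (𝕜 := ℂ)
      (f := fun y => G y * Complex.exp (- φ y))
      (fun x hx => (hd x hx).differentiableAt.differentiableWithinAt)
      (fun x hx => by
        rw [fderivWithin_of_isOpen Metric.isOpen_ball hx]
        have := (hd x hx).hasFDerivAt.fderiv
        rw [this]; simp) hz h0
    simp only [hφ0, neg_zero, Complex.exp_zero, mul_one] at this
    rw [← this, mul_assoc, ← Complex.exp_add]; simp
  have hφd : DifferentiableOn ℂ φ (Metric.ball 0 ρ) :=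
    fun z hz => (hφ z hz).differentiableAt.differentiableWithinAt
  have hre : ∀ z ∈ Metric.ball (0:ℂ) ρ, (φ z).re ≤ M := by
    intro z hz
    have h1 := hb z hz
    rw [hconst z hz, norm_mul, Complex.norm_exp, mul_comm] at h1
    have h2 : 0 < ‖G 0‖ := norm_pos_iff.2 (hnz 0 h0)
    exact Real.exp_le_exp.1 (le_of_mul_le_mul_right h1 h2)
  have hφb : ∀ z, ‖z‖ ≤ ρ / 2 → ‖φ z‖ ≤ 2 * M := by
    intro z hz
    have hz' : z ∈ Metric.ball (0:ℂ) ρ := by simp; linarith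
    have h1 := Complex.borelCaratheodory_zero hM hφd hre hρ hz' hφ0
    refine h1.trans ?_
    rw [div_le_iff₀ (by linarith)]
    nlinarith
  have hDb : ∀ z, ‖z‖ ≤ ρ / 4 → ‖deriv G z / G z‖ ≤ 8 * M / ρ := by
    intro z hz
    have hz' : z ∈ Metric.ball (0:ℂ) ρ := by simp; linarith
    rw [← (hφ z hz').deriv]
    have hsub : Metric.closedBall z (ρ/4) ⊆ Metric.ball (0:ℂ) ρ := by
      intro x hx
      have : ‖x - z‖ ≤ ρ / 4 := by simpa [dist_eq_norm] using hx
      have h3 : ‖x‖ ≤ ‖x - z‖ + ‖z‖ := by simpa using norm_add_le (x - z) z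
      simp; linarith
    have := Complex.norm_deriv_le_of_forall_mem_sphere_norm_le (c := z) (R := ρ/4) (C := 2*M) (f := φ)
      (by positivity) (hφd.diffContOnCl_ball hsub) (by
        intro x hx
        apply hφb
        have : ‖x - z‖ = ρ / 4 := by simpa [dist_eq_norm] using hx
        have h3 : ‖x‖ ≤ ‖x - z‖ + ‖z‖ := by simpa using norm_add_le (x - z) z
        linarith)
    refine this.trans (le_of_eq ?_)
    field_simp; ring
  have hDDb : ∀ z, ‖z‖ < ρ / 8 → ‖deriv (fun z => deriv G z / G z) z‖ ≤ 64 * M / ρ ^ 2 := by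
    intro z hz
    have hsub : Metric.closedBall z (ρ/8) ⊆ Metric.ball (0:ℂ) ρ := by
      intro x hx
      have : ‖x - z‖ ≤ ρ / 8 := by simpa [dist_eq_norm] using hx
      have h3 : ‖x‖ ≤ ‖x - z‖ + ‖z‖ := by simpa using norm_add_le (x - z) z
      simp; linarith
    have := Complex.norm_deriv_le_of_forall_mem_sphere_norm_le (c := z) (R := ρ/8) (C := 8*M/ρ)
      (f := fun z => deriv G z / G z)
      (by positivity) (hD.diffContOnCl_ball hsub) (by
        intro x hx
        apply hDb
        have : ‖x - z‖ = ρ / 8 := by simpa [dist_eq_norm] using hx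
        have h3 : ‖x‖ ≤ ‖x - z‖ + ‖z‖ := by simpa using norm_add_le (x - z) z
        linarith)
    refine this.trans (le_of_eq ?_)
    field_simp; ring
  have := (convex_ball (0:ℂ) (ρ/8)).norm_image_sub_le_of_norm_deriv_le (𝕜 := ℂ)
    (f := fun z => deriv G z / G z) (C := 64 * M / ρ^2) (x := z₂) (y := z₁)
    (fun x hx => (hD.differentiableAt (Metric.isOpen_ball.mem_nhds (by
      simp at hx ⊢; linarith))))
    (fun x hx => hDDb x (by simpa using hx)) (by simpa using h₂) (by simpa using h₁)
  simpa [logDeriv_apply] using this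

lemma logDeriv_lip (g : ℂ → ℂ) (c : ℂ) (hg : Differentiable ℂ g) (ρ M : ℝ) (hρ : 0 < ρ) (hM : 0 < M)
    (hnz : ∀ z ∈ Metric.ball c ρ, g z ≠ 0)
    (hb : ∀ z ∈ Metric.ball c ρ, ‖g z‖ ≤ Real.exp M * ‖g c‖) (z₁ z₂ : ℂ)
    (h₁ : ‖z₁ - c‖ < ρ / 8) (h₂ : ‖z₂ - c‖ < ρ / 8) :
    ‖logDeriv g z₁ - logDeriv g z₂‖ ≤ 64 * M / ρ ^ 2 * ‖z₁ - z₂‖ := by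
  have key := logDeriv_lip0 (fun z => g (z + c)) (by fun_prop) ρ M hρ hM
    (fun z hz => hnz _ (by simpa [dist_eq_norm] using hz))
    (fun z hz => by simpa using hb (z + c) (by simpa [dist_eq_norm] using hz))
    (z₁ - c) (z₂ - c) h₁ h₂
  simpa [logDeriv_apply, deriv_comp_add_const] using key

lemma had_n (X : ℂ → ℂ) (hX : Differentiable ℂ X) 
    (C : ℝ) (hC : 0 < C) (hgr : ∀ z, ‖X z‖ ≤ Real.exp (C * (1 + ‖z‖) ^ (3/2 : ℝ)))
    (h12 : X (1/2) ≠ 0) (hzero : ∀ z, X z = 0 → z.re = 0)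
    (hodd : ∀ z, logDeriv X (-z) = - logDeriv X z) (S : Finset ℂ) (N : ℝ) (hN : 1 ≤ N)
    (hS : ∀ w, w ∈ S ↔ X w = 0 ∧ ‖w‖ ≤ N) (b : ℝ) (hb : 0 < b) (hbN : b + 1 / 2 < N / 16) :
    ‖(logDeriv X b).re - ∑ w ∈ S, (analyticOrderNatAt X w : ℝ) * (b / (b ^ 2 + w.im ^ 2))‖ ≤
      256 * (C * (6 * N) ^ (3/2 : ℝ) + (1 + |Real.log ‖X (1/2)‖|)) / N ^ 2 * b := by
  obtain ⟨g, hg, hXg, hgS⟩ := extract_finset X hX (1/2) h12 S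
  set K := 1 + |Real.log ‖X (1/2)‖| with hK
  set M := C * (6 * N) ^ (3/2 : ℝ) + K with hM
  have hKpos : 0 < K := by positivity
  have hMpos : 0 < M := by positivity
  have hXb : ∀ b : ℝ, b ≠ 0 → X b ≠ 0 := by
    intro b hb h
    exact hb (by simpa using hzero b h)
  have hgX : ∀ z, g z = 0 → X z = 0 := fun z h => by rw [hXg, h, mul_zero]
  have hnz : ∀ z ∈ Metric.ball (1/2:ℂ) (N/2), g z ≠ 0 := by
    intro z hz h
    refine hgS z ((hS z).2 ⟨hgX z h, ?_⟩) h
    have h1 : ‖z - 1/2‖ < N / 2 := by simpa [dist_eq_norm] using hz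
    have h2 : ‖z‖ ≤ ‖z - 1/2‖ + ‖(1/2:ℂ)‖ := by simpa using norm_add_le (z - 1/2) (1/2)
    have h3 : ‖(1/2:ℂ)‖ = 1/2 := by norm_num
    linarith
  have hXc : Real.exp (-K) ≤ ‖X (1/2)‖ := by
    have hp : 0 < ‖X (1/2)‖ := norm_pos_iff.2 h12
    rw [← Real.le_log_iff_exp_le hp]
    have := neg_abs_le (Real.log ‖X (1/2)‖)
    linarith
  have hsph : ∀ z ∈ Metric.sphere (1/2:ℂ) (4*N), ‖g z‖ ≤ Real.exp M * ‖g (1/2)‖ := by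
    intro z hz
    have h1 : ‖z - 1/2‖ = 4 * N := by simpa [dist_eq_norm] using hz
    have h3 : ‖(1/2:ℂ)‖ = 1/2 := by norm_num
    have hP : ‖∏ w ∈ S, ((1/2:ℂ) - w) ^ (analyticOrderNatAt X w)‖ ≤
        ‖∏ w ∈ S, (z - w) ^ (analyticOrderNatAt X w)‖ := by
      rw [norm_prod, norm_prod]
      refine Finset.prod_le_prod (fun _ _ => norm_nonneg _) fun w hw => ?_
      rw [norm_pow, norm_pow]
      refine pow_le_pow_left₀ (norm_nonneg _) ?_ _
      have hw' := ((hS w).1 hw).2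
      have h4 : ‖(1/2:ℂ) - w‖ ≤ ‖(1/2:ℂ)‖ + ‖w‖ := norm_sub_le _ _
      have h5 : ‖z - 1/2‖ ≤ ‖z - w‖ + ‖(1/2:ℂ) - w‖ := by
        have := norm_sub_le (z - w) ((1/2:ℂ) - w)
        simpa using this
      linarith
    have hPc : 0 < ‖∏ w ∈ S, ((1/2:ℂ) - w) ^ (analyticOrderNatAt X w)‖ := by
      rw [norm_pos_iff]
      intro h
      exact h12 (by rw [hXg, h, zero_mul])
    have e1 := congrArg norm (hXg z)
    have e2 := congrArg norm (hXg (1/2))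
    rw [norm_mul] at e1 e2
    have hXz : ‖X z‖ ≤ Real.exp (C * (6 * N) ^ (3/2 : ℝ)) := by
      refine (hgr z).trans (Real.exp_le_exp.2 ?_)
      refine mul_le_mul_of_nonneg_left ?_ hC.le
      refine Real.rpow_le_rpow (by positivity) ?_ (by norm_num)
      have h2 : ‖z‖ ≤ ‖z - 1/2‖ + ‖(1/2:ℂ)‖ := by simpa using norm_add_le (z - 1/2) (1/2)
      linarith
    have hfin : ‖X z‖ ≤ Real.exp M * ‖X (1/2)‖ := by
      refine hXz.trans ?_
      calc Real.exp (C * (6 * N) ^ (3/2 : ℝ)) = Real.exp M * Real.exp (-K) := by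
            rw [← Real.exp_add]; congr 1; rw [hM]; ring
        _ ≤ _ := by gcongr
    rw [e1, e2] at hfin
    have : ‖∏ w ∈ S, ((1/2:ℂ) - w) ^ (analyticOrderNatAt X w)‖ * ‖g z‖ ≤
      ‖∏ w ∈ S, ((1/2:ℂ) - w) ^ (analyticOrderNatAt X w)‖ * (Real.exp M * ‖g (1/2)‖) := by
      calc _ ≤ ‖∏ w ∈ S, (z - w) ^ (analyticOrderNatAt X w)‖ * ‖g z‖ := by gcongr
        _ ≤ _ := hfin
        _ = _ := by ring
    exact le_of_mul_le_mul_left this hPc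
  have hball : ∀ z ∈ Metric.ball (1/2:ℂ) (N/2), ‖g z‖ ≤ Real.exp M * ‖g (1/2)‖ := by
    intro z hz
    refine Complex.norm_le_of_forall_mem_frontier_norm_le (U := Metric.ball (1/2:ℂ) (4*N))
      Metric.isBounded_ball hg.diffContOnCl (fun z hz => hsph z ?_) (subset_closure ?_)
    · rwa [frontier_ball _ (by linarith)] at hz
    · exact Metric.ball_subset_ball (by linarith) hz
  have hlip := logDeriv_lip g (1/2) hg (N/2) M (by linarith) hMpos hnz hball (b:ℂ) (-(b:ℂ)) ?_ ?_
  rotate_left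
  · have := norm_sub_le (b:ℂ) (1/2)
    have h3 : ‖(1/2:ℂ)‖ = 1/2 := by norm_num
    rw [Complex.norm_real, Real.norm_of_nonneg hb.le] at this
    linarith
  · have := norm_sub_le (-(b:ℂ)) (1/2)
    have h3 : ‖(1/2:ℂ)‖ = 1/2 := by norm_num
    rw [norm_neg, Complex.norm_real, Real.norm_of_nonneg hb.le] at this
    linarith
  have hld : ∀ z, X z ≠ 0 → logDeriv X z =
      (∑ w ∈ S, (analyticOrderNatAt X w : ℂ) / (z - w)) + logDeriv g z := by
    intro z hz
    have e : X = fun z => (∏ w ∈ S, (z - w) ^ (analyticOrderNatAt X w)) * g z := funext hXg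
    have hne : ∀ w ∈ S, z - w ≠ 0 := by
      intro w hw h
      rw [sub_eq_zero.1 h] at hz
      exact hz ((hS w).1 hw).1
    conv_lhs => rw [e]
    rw [logDeriv_mul z (Finset.prod_ne_zero_iff.2 fun w hw => pow_ne_zero _ (hne w hw))
      (fun h => hz (hgX z h)) (by fun_prop) (hg z)]
    congr 1
    rw [logDeriv_prod]
    · refine Finset.sum_congr rfl fun w hw => ?_
      have : logDeriv (fun z => (z - w) ^ (analyticOrderNatAt X w)) z = (analyticOrderNatAt X w) *
          logDeriv (fun z => z - w) z := by
        rw [← logDeriv_fun_pow (by fun_prop)]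
      rw [this, logDeriv_apply]
      simp [div_eq_mul_inv]
    · intro w hw; exact pow_ne_zero _ (hne w hw)
    · intro w hw; fun_prop
  have hb1 := hld b (hXb b hb.ne')
  have hb2 := hld (-(b:ℂ)) (by have := hXb (-b) (by linarith); simpa using this)
  rw [hodd] at hb2
  have hsum : (∑ w ∈ S, (analyticOrderNatAt X w : ℂ) / (b - w)) -
      (∑ w ∈ S, (analyticOrderNatAt X w : ℂ) / (-b - w)) =
      ((2 * ∑ w ∈ S, (analyticOrderNatAt X w : ℝ) * (b / (b ^ 2 + w.im ^ 2)) : ℝ) : ℂ) := by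
    rw [← Finset.sum_sub_distrib]
    push_cast
    rw [Finset.mul_sum]
    refine Finset.sum_congr rfl fun w hw => ?_
    have hw0 : w.re = 0 := hzero w ((hS w).1 hw).1
    have hwi : w = w.im * Complex.I := by
      apply Complex.ext <;> simp [hw0]
    have n1 : (b:ℂ) - w ≠ 0 := by
      intro h
      have := congrArg Complex.re h
      simp [hw0] at this
      exact hb.ne' this
    have n2 : -(b:ℂ) - w ≠ 0 := by
      intro h
      have := congrArg Complex.re h
      simp [hw0] at this
      exact hb.ne' this
    have n3 : ((b:ℂ)^2 + (w.im:ℂ)^2) = - ((b - w) * (-b - w)) := by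
      conv_rhs => rw [hwi]
      ring_nf
      simp
    rw [n3]
    field_simp
    ring
  have hfinal : (2:ℂ) * logDeriv X b -
      ((2 * ∑ w ∈ S, (analyticOrderNatAt X w : ℝ) * (b / (b ^ 2 + w.im ^ 2)) : ℝ) : ℂ) =
      logDeriv g b - logDeriv g (-b) := by
    rw [← hsum]; linear_combination hb1 - hb2
  rw [← hfinal] at hlip
  have hre := (Complex.abs_re_le_norm _).trans hlip
  have e3 : ((b:ℂ) - -b) = ((2*b:ℝ):ℂ) := by push_cast; ring
  rw [e3, Complex.norm_real, Real.norm_of_nonneg (by positivity : (0:ℝ) ≤ 2*b), Complex.sub_re,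
    Complex.ofReal_re] at hre
  have e4 : ((2:ℂ) * logDeriv X b).re = 2 * (logDeriv X b).re := by
    simp
  rw [e4, ← mul_sub, abs_mul, abs_of_pos (by norm_num : (0:ℝ) < 2)] at hre
  rw [Real.norm_eq_abs]
  have : 64 * M / (N/2)^2 * (2*b) = 2 * (256 * M / N^2 * b) := by field_simp; ring
  rw [this] at hre
  linarith

/-- Hadamard-type partial fractions for an even entire function of order `< 2` with imaginary
zeros. -/
theorem hadamard (X : ℂ → ℂ) (hX : Differentiable ℂ X) (heven : ∀ z, X (-z) = X z)
    (C : ℝ) (hC : 0 < C) (hgr : ∀ z, ‖X z‖ ≤ Real.exp (C * (1 + ‖z‖) ^ (3/2 : ℝ)))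
    (h12 : X (1/2) ≠ 0) (hzero : ∀ z, X z = 0 → z.re = 0) :
    ∃ (ι : Type) (_ : Countable ι) (γ m : ι → ℝ), (∀ i, 0 ≤ m i) ∧
      ∀ b : ℝ, 0 < b → HasSum (fun i => m i * (b / (b ^ 2 + γ i ^ 2))) (logDeriv X b).re := by
  classical
  set mm : ℂ → ℕ := fun w => analyticOrderNatAt X w with hmm
  have hfin : ∀ R : ℝ, {w : ℂ | X w = 0 ∧ ‖w‖ ≤ R}.Finite := by
    intro R
    have hA : AnalyticOnNhd ℂ X Set.univ := fun z _ => hX.analyticAt z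
    have h1 : X ⁻¹' {0}ᶜ ∈ Filter.codiscrete ℂ :=
      hA.preimage_zero_mem_codiscrete (x := 1/2) h12
    have h2 : (X ⁻¹' {0}) = (X ⁻¹' {0}ᶜ)ᶜ := by ext; simp
    have h3 := mem_codiscrete'.1 h1
    have hcl : IsClosed (X ⁻¹' {0}) := isClosed_singleton.preimage hX.continuous
    have hdis : IsDiscrete (X ⁻¹' {0}) := by rw [h2]; exact h3.2
    have := ((isCompact_closedBall (0:ℂ) R).inter_right hcl).finite
      (hdis.mono Set.inter_subset_right)
    refine this.subset ?_
    rintro w ⟨hw, hR⟩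
    exact ⟨by simpa using hR, hw⟩
  set S : ℕ → Finset ℂ := fun n => (hfin (n+1)).toFinset with hS
  have hSmem : ∀ n w, w ∈ S n ↔ X w = 0 ∧ ‖w‖ ≤ n + 1 := by intro n w; simp [hS]
  -- odd logarithmic derivative
  have hodd : ∀ z, logDeriv X (-z) = - logDeriv X z := by
    intro z
    have h1 : deriv X (-z) = - deriv X z := by
      have h2 : (fun y => X (-y)) = X := funext heven
      have h3 := deriv_comp_neg (f := X) (x := z)
      rw [h2] at h3
      rw [h3, neg_neg]
    rw [logDeriv_apply, logDeriv_apply, h1, heven, neg_div]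
  have hXne : ∀ b : ℝ, b ≠ 0 → X b ≠ 0 := by
    intro b hb h
    exact hb (by simpa using hzero b h)
  -- main limit
  have hmain : ∀ b : ℝ, 0 < b → Filter.Tendsto
      (fun n : ℕ => ∑ w ∈ S n, (mm w : ℝ) * (b / (b ^ 2 + w.im ^ 2))) Filter.atTop
      (nhds (logDeriv X b).re) := by
    intro b hb
    rw [tendsto_iff_norm_sub_tendsto_zero]
    have hN : Filter.Tendsto (fun n : ℕ => (n:ℝ) + 1) Filter.atTop Filter.atTop :=
      Filter.tendsto_atTop_add_const_right _ _ tendsto_natCast_atTop_atTop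
    have hz : Filter.Tendsto (fun N : ℝ => 256 * (C * (6 * N) ^ (3/2 : ℝ) +
        (1 + |Real.log ‖X (1/2)‖|)) / N ^ 2 * b) Filter.atTop (nhds 0) := by
      have h1 : Filter.Tendsto (fun N : ℝ => 256 * C * 6 ^ (3/2:ℝ) * b * N ^ (-(1/2) : ℝ) +
          256 * (1 + |Real.log ‖X (1/2)‖|) * b * N ^ (-(2:ℝ))) Filter.atTop
          (nhds (256 * C * 6 ^ (3/2:ℝ) * b * 0 + 256 * (1 + |Real.log ‖X (1/2)‖|) * b * 0)) :=
        ((tendsto_rpow_neg_atTop (by norm_num)).const_mul _).add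
          ((tendsto_rpow_neg_atTop (by norm_num)).const_mul _)
      rw [mul_zero, mul_zero, add_zero] at h1
      refine h1.congr' ?_
      filter_upwards [Filter.eventually_gt_atTop (0:ℝ)] with N hN
      have e1 : N ^ (-(1/2):ℝ) = N ^ (3/2:ℝ) / N^2 := by
        rw [← Real.rpow_natCast N 2, ← Real.rpow_sub hN]; norm_num
      have e2 : N ^ (-(2:ℝ)) = 1 / N^2 := by
        rw [Real.rpow_neg hN.le]; norm_num
      rw [e1, e2, Real.mul_rpow (by norm_num) hN.le]
      field_simp
    refine squeeze_zero' (Filter.Eventually.of_forall fun _ => norm_nonneg _) ?_ (hz.comp hN)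
    have hev : ∀ᶠ n : ℕ in Filter.atTop, 16 * (b + 1/2) < (n:ℝ) + 1 :=
      hN.eventually (Filter.eventually_gt_atTop _)
    filter_upwards [hev] with n hn
    rw [norm_sub_rev]
    exact had_n X hX C hC hgr h12 hzero hodd (S n) (n+1) (by
      have : (0:ℝ) ≤ n := by positivity
      linarith) (hSmem n) b hb (by linarith)
  have hcount : Countable {w : ℂ // X w = 0} := by
    have h1 : (⋃ n : ℕ, {w : ℂ | X w = 0 ∧ ‖w‖ ≤ n}).Countable :=
      Set.countable_iUnion fun n => (hfin n).countable
    refine (h1.mono ?_ : {w : ℂ | X w = 0}.Countable).to_subtype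
    intro w hw
    obtain ⟨n, hn⟩ := exists_nat_ge ‖w‖
    exact Set.mem_iUnion.2 ⟨n, hw, hn⟩
  refine ⟨{w : ℂ // X w = 0}, hcount, fun w => w.1.im, fun w => mm w.1, fun _ => by positivity, ?_⟩
  intro b hb
  set a : {w : ℂ // X w = 0} → ℝ := fun i => (mm i.1 : ℝ) * (b / (b ^ 2 + i.1.im ^ 2)) with ha
  have ha0 : ∀ i, 0 ≤ a i := fun i => by positivity
  set T : ℕ → Finset {w : ℂ // X w = 0} := fun n => (S n).subtype _ with hT
  have hTm : Monotone T := by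
    intro n k hnk i hi
    simp only [hT, Finset.mem_subtype, hSmem] at hi ⊢
    refine ⟨hi.1, hi.2.trans ?_⟩
    have : (n:ℝ) ≤ k := by exact_mod_cast hnk
    linarith
  have hTt : Filter.Tendsto T Filter.atTop Filter.atTop := by
    refine Filter.tendsto_atTop_finset_of_monotone hTm ?_
    intro i
    obtain ⟨n, hn⟩ := exists_nat_ge ‖i.1‖
    exact ⟨n, by simp only [hT, Finset.mem_subtype, hSmem]; exact ⟨i.2, by linarith⟩⟩
  have hTs : ∀ n, ∑ i ∈ T n, a i = ∑ w ∈ S n, (mm w : ℝ) * (b / (b ^ 2 + w.im ^ 2)) := by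
    intro n
    simp only [hT, ha]
    exact Finset.sum_subtype_of_mem (fun w : ℂ => (mm w : ℝ) * (b / (b ^ 2 + w.im ^ 2)))
      (fun w hw => ((hSmem n w).1 hw).1)
  have hlim : Filter.Tendsto (fun n => ∑ i ∈ T n, a i) Filter.atTop (nhds (logDeriv X b).re) := by
    simp only [hTs]; exact hmain b hb
  have hmono : Monotone (fun n => ∑ i ∈ T n, a i) := fun n k hnk =>
    Finset.sum_le_sum_of_subset_of_nonneg (hTm hnk) (fun i _ _ => ha0 i)
  have hsum : Summable a := by
    refine summable_of_sum_le ha0 (c := (logDeriv X b).re) fun u => ?_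
    obtain ⟨n, hn⟩ := (hTt.eventually (Filter.eventually_ge_atTop u)).exists
    exact (Finset.sum_le_sum_of_subset_of_nonneg hn (fun i _ _ => ha0 i)).trans
      (hmono.ge_of_tendsto hlim n)
  have h1 := hsum.hasSum.comp hTt
  have : ∑' i, a i = (logDeriv X b).re := tendsto_nhds_unique h1 hlim
  rw [← this]; exact hsum.hasSum

end MT


namespace MT

lemma norm_Gamma_le (s : ℂ) (hs : 0 < s.re) : ‖Complex.Gamma s‖ ≤ Real.Gamma s.re := by
  rw [Complex.Gamma_eq_integral hs, Real.Gamma_eq_integral hs, Complex.GammaIntegral]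
  refine (MeasureTheory.norm_integral_le_integral_norm _).trans (le_of_eq ?_)
  refine MeasureTheory.setIntegral_congr_fun measurableSet_Ioi fun x hx => ?_
  have hx' : (0:ℝ) < x := hx
  simp only [norm_mul]
  rw [Complex.norm_cpow_eq_rpow_re_of_pos hx', Complex.norm_real,
    Real.norm_of_nonneg (Real.exp_pos _).le]
  simp

lemma Gamma_le_rpow (x : ℝ) (hx : 1 ≤ x) : Real.Gamma x ≤ Real.exp (2 * (1 + x) ^ (3/2 : ℝ)) := by
  set n := ⌊x⌋₊ with hn
  have hn1 : 1 ≤ n := Nat.one_le_floor_iff _ |>.2 hx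
  have hnx : (n:ℝ) ≤ x := Nat.floor_le (by linarith)
  have hxn : x < n + 1 := Nat.lt_floor_add_one x
  have hfac : Real.Gamma x ≤ (n.factorial : ℝ) := by
    have h := Real.convexOn_Gamma.le_max_of_mem_Icc (x := (n:ℝ)) (y := n+1) (z := x)
      (by simp; omega) (by simp; positivity) ⟨hnx, hxn.le⟩
    refine h.trans (max_le ?_ ?_)
    · obtain ⟨k, hk⟩ : ∃ k, n = k + 1 := ⟨n - 1, by omega⟩
      rw [hk]
      push_cast
      rw [Real.Gamma_nat_eq_factorial]
      exact_mod_cast Nat.factorial_le (Nat.le_succ k)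
    · rw [Real.Gamma_nat_eq_factorial]
  have h2 : (n.factorial : ℝ) ≤ x ^ x := by
    calc (n.factorial : ℝ) ≤ (n:ℝ)^n := by exact_mod_cast Nat.factorial_le_pow n
      _ ≤ x ^ n := by gcongr
      _ = x ^ (n:ℝ) := (Real.rpow_natCast _ _).symm
      _ ≤ x ^ x := Real.rpow_le_rpow_of_exponent_le hx hnx
  refine (hfac.trans h2).trans ?_
  rw [Real.rpow_def_of_pos (by linarith)]
  refine Real.exp_le_exp.2 ?_
  have h3 : Real.log x ≤ x ^ (1/2:ℝ) / (1/2) := Real.log_le_rpow_div (by linarith) (by norm_num)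
  have h4 : x ^ (1/2:ℝ) * x = x ^ (3/2:ℝ) := by
    rw [← Real.rpow_add_one (by linarith)]; norm_num
  have h5 : x ^ (3/2:ℝ) ≤ (1+x) ^ (3/2:ℝ) := Real.rpow_le_rpow (by linarith) (by linarith) (by norm_num)
  nlinarith

lemma Lambda0_strip : ∃ B : ℝ, 0 ≤ B ∧ ∀ s : ℂ, 0 ≤ s.re → s.re ≤ 2 → ‖completedRiemannZeta₀ s‖ ≤ B := by
  set P := HurwitzZeta.hurwitzEvenFEPair 0 with hP
  have hconv : ∀ s : ℂ, MellinConvergent P.f_modif s := fun s =>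
    ((P.isStrongFEPair_toStrongFEPair).hasMellin s).1
  set h : ℝ → ℝ := fun t => ‖(t:ℂ) ^ ((0:ℂ) - 1) • P.f_modif t‖ + ‖(t:ℂ) ^ ((1:ℂ) - 1) • P.f_modif t‖ with hh
  have hint : MeasureTheory.IntegrableOn h (Set.Ioi 0) := (hconv 0).norm.add (hconv 1).norm
  refine ⟨∫ t in Set.Ioi (0:ℝ), h t, MeasureTheory.setIntegral_nonneg measurableSet_Ioi
    (fun t _ => by positivity), ?_⟩
  intro s hs0 hs2
  have e : completedRiemannZeta₀ s = mellin P.f_modif (s/2) / 2 := rfl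
  rw [e, norm_div]
  have h1 : ‖mellin P.f_modif (s/2)‖ ≤ ∫ t in Set.Ioi (0:ℝ), h t := by
    rw [mellin]
    refine MeasureTheory.norm_integral_le_of_norm_le hint ?_
    refine (MeasureTheory.ae_restrict_iff' measurableSet_Ioi).2 (Filter.Eventually.of_forall ?_)
    intro t ht
    have ht' : (0:ℝ) < t := ht
    simp only [hh, norm_smul]
    rw [Complex.norm_cpow_eq_rpow_re_of_pos ht', Complex.norm_cpow_eq_rpow_re_of_pos ht',
      Complex.norm_cpow_eq_rpow_re_of_pos ht', ← add_mul]
    refine mul_le_mul_of_nonneg_right ?_ (norm_nonneg _)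
    have e2 : (s/2 - 1).re = s.re / 2 - 1 := by simp
    rw [e2]
    simp only [Complex.sub_re, Complex.zero_re, Complex.one_re]
    rcases le_total 1 t with h1t | h1t
    · have := Real.rpow_le_rpow_of_exponent_le h1t (show s.re / 2 - 1 ≤ 1 - 1 by linarith)
      have h0 : (0:ℝ) ≤ t ^ ((0:ℝ)-1) := Real.rpow_nonneg ht'.le _
      exact le_add_of_nonneg_of_le h0 this
    · have := Real.rpow_le_rpow_of_exponent_ge ht' h1t (show 0 - 1 ≤ s.re / 2 - 1 by linarith)
      have h0 : (0:ℝ) ≤ t ^ ((1:ℝ)-1) := Real.rpow_nonneg ht'.le _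
      exact le_add_of_le_of_nonneg this h0
  have h0 := norm_nonneg (mellin P.f_modif (s/2))
  have : ‖(2:ℂ)‖ = 2 := by norm_num
  rw [this]; linarith

/-- the Riemann xi function (times 2) -/
noncomputable def xi (s : ℂ) : ℂ := s * (s - 1) * completedRiemannZeta₀ s + 1

lemma xi_diff : Differentiable ℂ xi := by
  have := differentiable_completedZeta₀
  unfold xi; fun_prop

lemma xi_one_sub (s : ℂ) : xi (1 - s) = xi s := by
  unfold xi; rw [completedRiemannZeta₀_one_sub]; ring

lemma xi_eq (s : ℂ) (h0 : s ≠ 0) (h1 : s ≠ 1) : xi s = s * (s - 1) * completedRiemannZeta s := by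
  have h1' : (1:ℂ) - s ≠ 0 := sub_ne_zero.2 (Ne.symm h1)
  rw [xi, completedRiemannZeta_eq]
  field_simp
  ring

lemma Lambda_right : ∃ B : ℝ, 0 < B ∧ ∀ s : ℂ, 2 ≤ s.re →
    ‖completedRiemannZeta s‖ ≤ B * Real.Gamma (s.re / 2) := by
  have hsum : Summable (fun n : ℕ => 1 / (n:ℝ)^(2:ℝ)) := Real.summable_one_div_nat_rpow.2 (by norm_num)
  refine ⟨1 + ∑' n : ℕ, 1 / (n:ℝ)^(2:ℝ), by
    have : 0 ≤ ∑' n : ℕ, 1 / (n:ℝ)^(2:ℝ) := tsum_nonneg (fun n : ℕ => by positivity)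
    linarith, ?_⟩
  intro s hs
  rw [completedZeta_eq_tsum_of_one_lt_re (by linarith), norm_mul, norm_mul]
  have h1 : ‖(π:ℂ) ^ (-s / 2)‖ ≤ 1 := by
    rw [Complex.norm_cpow_eq_rpow_re_of_pos Real.pi_pos]
    refine Real.rpow_le_one_of_one_le_of_nonpos (by linarith [Real.pi_gt_three]) ?_
    simp; linarith
  have h2 : ‖Complex.Gamma (s/2)‖ ≤ Real.Gamma (s.re/2) := by
    have := norm_Gamma_le (s/2) (by simp; linarith)
    simpa using this
  have h3 : ‖∑' n : ℕ, 1 / (n:ℂ)^s‖ ≤ ∑' n : ℕ, 1 / (n:ℝ)^(2:ℝ) := by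
    refine tsum_of_norm_bounded hsum.hasSum fun n => ?_
    rcases Nat.eq_zero_or_pos n with rfl | hn
    · have : s ≠ 0 := by rintro rfl; simp at hs; linarith
      simp [this]
    · rw [norm_div, norm_one, Complex.norm_natCast_cpow_of_pos hn]
      have : (1:ℝ) ≤ n := by exact_mod_cast hn
      gcongr
  have hG : 0 ≤ Real.Gamma (s.re/2) := (Real.Gamma_pos_of_pos (by linarith)).le
  calc _ ≤ 1 * Real.Gamma (s.re/2) * ∑' n : ℕ, 1 / (n:ℝ)^(2:ℝ) := by gcongr
    _ ≤ _ := by nlinarith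

lemma xi_growth : ∃ C : ℝ, 0 < C ∧ ∀ s : ℂ, ‖xi s‖ ≤ Real.exp (C * (1 + ‖s‖) ^ (3/2 : ℝ)) := by
  obtain ⟨B, hB, hB'⟩ := Lambda0_strip
  obtain ⟨D, hD, hD'⟩ := Lambda_right
  have key : ∀ s : ℂ, 0 ≤ s.re → ‖xi s‖ ≤ Real.exp ((B + D + 5) * (1 + ‖s‖) ^ (3/2 : ℝ)) := by
    intro s hs
    set t := 1 + ‖s‖ with ht
    have ht1 : 1 ≤ t := by have := norm_nonneg s; linarith
    have hT : t ≤ t ^ (3/2:ℝ) := by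
      conv_lhs => rw [← Real.rpow_one t]
      exact Real.rpow_le_rpow_of_exponent_le ht1 (by norm_num)
    set T := t ^ (3/2:ℝ) with hTdef
    have hss : ‖s * (s-1)‖ ≤ Real.exp (2 * T) := by
      rw [norm_mul]
      have h1 : ‖s‖ ≤ t := by linarith
      have h2 : ‖s - 1‖ ≤ t := by have := norm_sub_le s 1; simp at this; linarith
      have h3 : t ≤ Real.exp T := by have := Real.add_one_le_exp T; linarith
      calc _ ≤ Real.exp T * Real.exp T := by
            gcongr <;> linarith
        _ = _ := by rw [← Real.exp_add]; ring_nf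
    rcases le_total s.re 2 with h2 | h2
    · have h3 := hB' s hs h2
      calc ‖xi s‖ ≤ ‖s * (s-1)‖ * ‖completedRiemannZeta₀ s‖ + 1 := by
            rw [xi]; refine (norm_add_le _ _).trans ?_; rw [norm_mul, norm_one]
        _ ≤ Real.exp (2 * T) * B + 1 := by gcongr
        _ ≤ Real.exp (2*T) * (B + 1) := by
            have := Real.one_le_exp (show 0 ≤ 2 * T by linarith); linarith
        _ ≤ Real.exp (2*T) * Real.exp B := by gcongr; exact Real.add_one_le_exp B
        _ = Real.exp (2*T + B) := by rw [Real.exp_add]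
        _ ≤ _ := by apply Real.exp_le_exp.2; nlinarith
    · have h3 := hD' s h2
      have hne0 : s ≠ 0 := by rintro rfl; simp at h2; linarith
      have hne1 : s ≠ 1 := by rintro rfl; simp at h2
      rw [xi_eq s hne0 hne1, norm_mul]
      have h4 := Gamma_le_rpow (s.re/2) (by linarith)
      have h5 : (1 + s.re/2) ^ (3/2:ℝ) ≤ T := by
        apply Real.rpow_le_rpow (by linarith) _ (by norm_num)
        have := Complex.re_le_norm s
        linarith
      calc _ ≤ Real.exp (2*T) * (D * Real.exp (2 * T)) := by
            gcongr
            refine h3.trans ?_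
            gcongr
            refine h4.trans (Real.exp_le_exp.2 (by linarith))
        _ ≤ Real.exp (2*T) * (Real.exp D * Real.exp (2 * T)) := by
            gcongr; have := Real.add_one_le_exp D; linarith
        _ = Real.exp (4 * T + D) := by rw [← Real.exp_add, ← Real.exp_add]; ring_nf
        _ ≤ _ := by apply Real.exp_le_exp.2; nlinarith
  refine ⟨(B+D+5) * 2 ^ (3/2:ℝ), by positivity, ?_⟩
  intro s
  have hmul : ∀ x : ℝ, 0 ≤ x → (B+D+5) * 2 ^ (3/2:ℝ) * x ^ (3/2:ℝ) = (B+D+5) * (2 * x) ^ (3/2:ℝ) := by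
    intro x hx
    rw [Real.mul_rpow (by norm_num) hx]; ring
  rw [hmul _ (by positivity)]
  rcases le_total 0 s.re with h | h
  · refine (key s h).trans (Real.exp_le_exp.2 ?_)
    have := norm_nonneg s
    gcongr
    linarith
  · rw [← xi_one_sub]
    refine (key (1-s) (by simp; linarith)).trans (Real.exp_le_exp.2 ?_)
    have := norm_nonneg s
    have h3 := norm_sub_le (1:ℂ) s
    rw [norm_one] at h3
    gcongr
    linarith

lemma xi_zero_re (hRH : RiemannHypothesis) (s : ℂ) (h : xi s = 0) : s.re = 1/2 := by
  have z0 : s ≠ 0 := by rintro rfl; simp [xi] at h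
  have z1 : s ≠ 1 := by rintro rfl; simp [xi] at h
  have hz : ∀ s, s ≠ 0 → s ≠ 1 → xi s = 0 → riemannZeta s = 0 := by
    intro s z0 z1 h
    rw [xi_eq s z0 z1] at h
    have : completedRiemannZeta s = 0 := by
      rcases mul_eq_zero.1 h with h | h
      · exact absurd h (mul_ne_zero z0 (sub_ne_zero.2 z1))
      · exact h
    rw [riemannZeta_def_of_ne_zero z0, this, zero_div]
  refine hRH s (hz s z0 z1 h) ?_ z1
  rintro ⟨n, hn⟩
  have h2 := hz (1 - s) (sub_ne_zero.2 z1.symm) (by simpa using z0) (by rw [xi_one_sub, h])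
  refine riemannZeta_ne_zero_of_one_lt_re ?_ h2
  rw [hn]; simp
  positivity

/-- `F s` is the logarithmic derivative of `xi` at real `s`. -/
noncomputable def F (s : ℝ) : ℝ := (logDeriv xi s).re

theorem hadamard_xi (hRH : RiemannHypothesis) :
    ∃ (ι : Type) (_ : Countable ι) (γ m : ι → ℝ), (∀ i, 0 ≤ m i) ∧
      ∀ b : ℝ, 0 < b → HasSum (fun i => m i * (b / (b ^ 2 + γ i ^ 2))) (F (1/2 + b)) := by
  obtain ⟨C, hC, hgr⟩ := xi_growth
  have hd := xi_diff
  obtain ⟨ι, hι, γ, m, hm, hs⟩ := hadamard (fun z => xi (z + 1/2)) (by fun_prop)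
    (fun z => by rw [← xi_one_sub]; congr 1; ring) (C * (3/2)^(3/2:ℝ)) (by positivity) (by
      intro z
      refine (hgr _).trans (Real.exp_le_exp.2 ?_)
      rw [mul_assoc, ← Real.mul_rpow (by norm_num) (by positivity)]
      have := norm_add_le z (1/2)
      have h3 : ‖(1/2:ℂ)‖ = 1/2 := by norm_num
      have := norm_nonneg z
      gcongr
      linarith) (by norm_num [xi]) (by
      intro z hz
      have := xi_zero_re hRH _ hz
      simp at this
      linarith)
  refine ⟨ι, hι, γ, m, hm, fun b hb => ?_⟩
  have := hs b hb
  rw [F]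
  convert this using 2
  rw [logDeriv_apply, logDeriv_apply, deriv_comp_add_const]
  push_cast
  rw [add_comm]

end MT


namespace MT

noncomputable def dig (x : ℝ) : ℝ := (Complex.digamma x).re


lemma cx_ne (x : ℝ) (hx : 0 < x) (m : ℕ) : (x:ℂ) ≠ -m := by
  intro h
  have := congrArg Complex.re h
  simp at this
  have : (0:ℝ) ≤ m := by positivity
  linarith

lemma dig_succ (x : ℝ) (hx : 0 < x) : dig (x + 1) = dig x + 1 / x := by
  unfold dig
  have := Complex.digamma_apply_add_one x (cx_ne x hx)
  push_cast
  rw [this, Complex.add_re]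
  congr 1
  rw [← Complex.ofReal_inv, Complex.ofReal_re, one_div]

lemma dig_one : dig 1 = -Real.eulerMascheroniConstant := by
  unfold dig
  rw [Complex.ofReal_one, Complex.digamma_one]; simp

lemma dig_deriv (x : ℝ) (hx : 0 < x) : HasDerivAt (fun y => Real.log (Real.Gamma y)) (dig x) x := by
  have h1 : HasDerivAt Complex.Gamma (deriv Complex.Gamma x) (x:ℂ) :=
    (Complex.differentiableAt_Gamma _ (cx_ne x hx)).hasDerivAt
  have h2 := h1.real_of_complex
  have h3 : (fun y : ℝ => (Complex.Gamma y).re) = Real.Gamma := rfl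
  rw [h3] at h2
  have h4 := h2.log (Real.Gamma_pos_of_pos hx).ne'
  refine h4.congr_deriv ?_
  rw [dig, Complex.digamma_def, logDeriv_apply, Complex.Gamma_ofReal, Complex.div_ofReal_re]

lemma log_Gamma_succ (x : ℝ) (hx : 0 < x) :
    Real.log (Real.Gamma (x+1)) = Real.log x + Real.log (Real.Gamma x) := by
  rw [Real.Gamma_add_one hx.ne', Real.log_mul hx.ne' (Real.Gamma_pos_of_pos hx).ne']

lemma dig_le (x : ℝ) (hx : 0 < x) : dig x ≤ Real.log x := by
  have := Real.convexOn_log_Gamma.le_slope_of_hasDerivAt (x := x) (y := x+1)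
    (by simpa using hx) (by simp; linarith) (by linarith) (dig_deriv x hx)
  rw [slope_def_field] at this
  simp only [Function.comp] at this
  rw [log_Gamma_succ x hx] at this
  simpa using this

lemma le_dig (x : ℝ) (hx : 0 < x) : Real.log x ≤ dig (x+1) := by
  have := Real.convexOn_log_Gamma.slope_le_of_hasDerivAt (x := x) (y := x+1)
    (by simpa using hx) (by simp; linarith) (by linarith) (dig_deriv (x+1) (by linarith))
  rw [slope_def_field] at this
  simp only [Function.comp] at this
  rw [log_Gamma_succ x hx] at this
  simpa using this

lemma dig_series (x : ℝ) (hx : 0 ≤ x) :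
    HasSum (fun n : ℕ => 1 / ((n:ℝ)+1) - 1 / ((n:ℝ)+1+x)) (dig (x+1) + Real.eulerMascheroniConstant) := by
  have hnn : ∀ n : ℕ, 0 ≤ 1 / ((n:ℝ)+1) - 1 / ((n:ℝ)+1+x) := by
    intro n
    rw [sub_nonneg]
    apply one_div_le_one_div_of_le (by positivity); linarith
  rw [hasSum_iff_tendsto_nat_of_nonneg hnn]
  have hD : ∀ y : ℝ, 0 ≤ y → ∀ N : ℕ, dig (y + 1 + N) = dig (y+1) + ∑ n ∈ range N, 1 / ((n:ℝ)+1+y) := by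
    intro y hy N
    induction N with
    | zero => simp
    | succ N ih =>
      rw [Finset.sum_range_succ, ← add_assoc, ← ih]
      push_cast
      rw [← add_assoc, dig_succ _ (by positivity)]
      congr 2; ring
  have hS : ∀ N : ℕ, ∑ n ∈ range N, (1 / ((n:ℝ)+1) - 1 / ((n:ℝ)+1+x)) =
      (dig (x+1) + Real.eulerMascheroniConstant) - (dig (x+1+N) - dig (0+1+N)) := by
    intro N
    rw [Finset.sum_sub_distrib, hD x hx N, hD 0 le_rfl N, zero_add, dig_one]
    simp only [add_zero]
    ring
  have hlim : Filter.Tendsto (fun N : ℕ => dig (x+1+N) - dig (0+1+N)) Filter.atTop (nhds 0) := by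
    have hl : Filter.Tendsto (fun N : ℕ => Real.log (1 + (x+1) / N)) Filter.atTop (nhds 0) := by
      have h1 : Filter.Tendsto (fun N : ℕ => 1 + (x+1) / (N:ℝ)) Filter.atTop (nhds (1 + 0)) :=
        tendsto_const_nhds.add (tendsto_const_div_atTop_nhds_zero_nat _)
      rw [add_zero] at h1
      have := h1.log one_ne_zero
      simpa using this
    have hl2 : Filter.Tendsto (fun N : ℕ => - Real.log (1 + 1 / (N:ℝ))) Filter.atTop (nhds 0) := by
      have h1 : Filter.Tendsto (fun N : ℕ => 1 + 1 / (N:ℝ)) Filter.atTop (nhds (1 + 0)) :=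
        tendsto_const_nhds.add (tendsto_const_div_atTop_nhds_zero_nat _)
      rw [add_zero] at h1
      have := (h1.log one_ne_zero).neg
      simpa using this
    refine tendsto_of_tendsto_of_tendsto_of_le_of_le' hl2 hl ?_ ?_
    · filter_upwards [Filter.eventually_gt_atTop 0] with N hN
      have hN' : (0:ℝ) < N := by exact_mod_cast hN
      have a1 := le_dig (x + N) (by linarith)
      have a2 := dig_le (0+1+N) (by linarith)
      have e1 : x + N + 1 = x + 1 + (N:ℝ) := by ring
      rw [e1] at a1
      have a3 : Real.log N ≤ Real.log (x + N) := Real.log_le_log hN' (by linarith)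
      have e2 : (1 + 1/(N:ℝ)) = (0+1+N)/N := by field_simp; ring
      rw [e2, Real.log_div (by positivity) hN'.ne']
      linarith
    · filter_upwards [Filter.eventually_gt_atTop 0] with N hN
      have hN' : (0:ℝ) < N := by exact_mod_cast hN
      have a1 := dig_le (x + 1 + N) (by linarith)
      have a2 := le_dig (N) (by linarith)
      have e1 : (N:ℝ) + 1 = 0 + 1 + (N:ℝ) := by ring
      rw [e1] at a2
      have e2 : (1 + (x+1)/(N:ℝ)) = (x+1+N)/N := by field_simp; ring
      rw [e2, Real.log_div (by positivity) hN'.ne']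
      linarith
  simp only [hS]
  have := (tendsto_const_nhds (x := dig (x+1) + Real.eulerMascheroniConstant)).sub hlim
  simpa using this

/-- gamma factor -/
noncomputable def GG (z : ℂ) : ℂ := 2 * ((π:ℂ) ^ (-z / 2) * Complex.Gamma (z / 2 + 1))

lemma xi_GG (z : ℂ) (hz : 0 < z.re) (h1 : z ≠ 1) : xi z = (z - 1) * riemannZeta z * GG z := by
  have h0 : z ≠ 0 := by rintro rfl; simp at hz
  have hG : Complex.Gammaℝ z ≠ 0 := Complex.Gammaℝ_ne_zero_of_re_pos hz
  rw [xi_eq z h0 h1, riemannZeta_def_of_ne_zero h0, GG, Complex.Gamma_add_one _ (by simpa using h0)]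
  rw [Complex.Gammaℝ_def] at hG ⊢
  obtain ⟨ha, hb⟩ := mul_ne_zero_iff.1 hG
  generalize Complex.Gamma (z/2) = A at *
  generalize (π:ℂ) ^ (-z/2) = D at *
  field_simp

lemma GG_ne (z : ℂ) (hz : 0 < z.re) : GG z ≠ 0 := by
  refine mul_ne_zero two_ne_zero (mul_ne_zero ?_ (Complex.Gamma_ne_zero_of_re_pos (by simp; linarith)))
  rw [Complex.cpow_ne_zero_iff]
  left; exact_mod_cast Real.pi_ne_zero

lemma GG_deriv (z : ℂ) (hz : 0 < z.re) :
    HasDerivAt GG (GG z * (- Complex.log π / 2 + Complex.digamma (z/2+1) / 2)) z := by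
  have hg : Complex.Gamma (z/2+1) ≠ 0 := Complex.Gamma_ne_zero_of_re_pos (by simp; linarith)
  have h1 : HasDerivAt Complex.Gamma (deriv Complex.Gamma (z/2+1)) (z/2+1) :=
    (Complex.differentiableAt_Gamma _ (by
      intro m h
      have := congrArg Complex.re h
      simp at this
      have : (0:ℝ) ≤ m := by positivity
      linarith)).hasDerivAt
  have h2 : HasDerivAt (fun z : ℂ => z/2+1) (1/2) z := ((hasDerivAt_id z).div_const 2).add_const 1
  have h3 := h1.comp z h2
  have h4 : HasDerivAt (fun z : ℂ => -z/2) (-1/2) z := ((hasDerivAt_id z).neg.div_const 2)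
  have h5 := h4.const_cpow (c := (π:ℂ)) (Or.inl (by exact_mod_cast Real.pi_ne_zero))
  have h6 := (h5.mul h3).const_mul (2:ℂ)
  refine h6.congr_deriv ?_
  rw [Complex.digamma_def, logDeriv_apply, GG]
  simp only [Function.comp]
  generalize deriv Complex.Gamma (z/2+1) = A at *
  generalize Complex.Gamma (z/2+1) = D at *
  field_simp

lemma F_formula (s : ℝ) (hs : 1 < s) : F s = 1 / (s - 1) + (logDeriv riemannZeta s).re
    - Real.log π / 2 + dig (s/2+1) / 2 := by
  have hre : (0:ℝ) < (s:ℂ).re := by simp; linarith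
  have hs1 : (s:ℂ) ≠ 1 := by
    intro h; have := congrArg Complex.re h; simp at this; linarith
  have hz : riemannZeta s ≠ 0 := riemannZeta_ne_zero_of_one_lt_re (by simpa using hs)
  have hev : xi =ᶠ[nhds (s:ℂ)] fun z => (z - 1) * riemannZeta z * GG z := by
    have o1 : IsOpen {z : ℂ | 0 < z.re} := isOpen_lt continuous_const Complex.continuous_re
    filter_upwards [o1.mem_nhds hre, isOpen_ne.mem_nhds hs1] with z a b
    exact xi_GG z a b
  have hd : HasDerivAt (fun z => (z - 1) * riemannZeta z * GG z)
      ((1 * riemannZeta s + (s - 1) * deriv riemannZeta s) * GG s + (s-1) * riemannZeta s *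
      (GG s * (- Complex.log π / 2 + Complex.digamma (s/2+1) / 2))) (s:ℂ) :=
    ((((hasDerivAt_id (s:ℂ)).sub_const 1).mul (differentiableAt_riemannZeta hs1).hasDerivAt).mul (GG_deriv _ hre))
  have hGG := GG_ne _ hre
  have hs1' := sub_ne_zero.2 hs1
  have : logDeriv xi s = 1 / ((s:ℂ) - 1) + logDeriv riemannZeta s +
      (- Complex.log π / 2 + Complex.digamma (s/2+1) / 2) := by
    rw [logDeriv_apply, hev.deriv_eq, hev.self_of_nhds, hd.deriv, logDeriv_apply]
    field_simp
  rw [F, this]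
  have e1 : (1 / ((s:ℂ) - 1)) = ((1 / (s-1) : ℝ) : ℂ) := by push_cast; rfl
  have e2 : - Complex.log π / 2 = ((- Real.log π / 2 : ℝ) : ℂ) := by
    push_cast [Complex.ofReal_log Real.pi_pos.le]; rfl
  rw [e1, e2]
  simp only [Complex.add_re, Complex.ofReal_re, dig]
  push_cast
  have : ∀ w : ℂ, (w/2).re = w.re/2 := by intro w; simp
  rw [this]; ring

lemma F_one : F 1 = Real.eulerMascheroniConstant / 2 + 1 - Real.log π / 2 - Real.log 2 := by
  have hre : (0:ℝ) < (1:ℂ).re := by simp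
  have hGG := GG_ne _ hre
  have hxd := xi_diff
  have hq : DifferentiableAt ℂ (fun z => xi z / GG z) 1 :=
    (hxd 1).div (GG_deriv 1 hre).differentiableAt hGG
  have hg1 : GG 1 = 1 := by
    rw [GG, Complex.Gamma_add_one _ (by norm_num), Complex.Gamma_one_half_eq]
    have : (-1/2:ℂ) = -(1/2) := by ring
    rw [this, Complex.cpow_neg]
    have : (π:ℂ)^(1/2:ℂ) ≠ 0 := by
      rw [Complex.cpow_ne_zero_iff]
      left; exact_mod_cast Real.pi_ne_zero
    field_simp
  have hx1 : xi 1 = 1 := by simp [xi]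
  have hder : HasDerivAt (fun z => xi z / GG z) Real.eulerMascheroniConstant 1 := by
    rw [hasDerivAt_iff_tendsto_slope]
    refine tendsto_riemannZeta_sub_one_div.congr' ?_
    have o1 : IsOpen {z : ℂ | 0 < z.re} := isOpen_lt continuous_const Complex.continuous_re
    filter_upwards [self_mem_nhdsWithin, nhdsWithin_le_nhds (o1.mem_nhds hre)] with z hz hz2
    have hz' : z ≠ 1 := hz
    have := sub_ne_zero.2 hz'
    rw [slope_def_field, xi_GG z hz2 hz', hx1, hg1]
    have := GG_ne z hz2
    field_simp
  have hmul : HasDerivAt xi (Real.eulerMascheroniConstant * GG 1 + (xi 1 / GG 1) * (GG 1 * (- Complex.log π / 2 + Complex.digamma (1/2+1) / 2))) 1 := by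
    have := hder.mul (GG_deriv 1 hre)
    refine this.congr_of_eventuallyEq ?_
    have o1 : IsOpen {z : ℂ | 0 < z.re} := isOpen_lt continuous_const Complex.continuous_re
    filter_upwards [o1.mem_nhds hre] with z hz
    have := GG_ne z hz
    simp only [Pi.mul_apply]
    field_simp
  rw [F, Complex.ofReal_one, logDeriv_apply, hmul.deriv, hg1, hx1,
    Complex.digamma_apply_add_one _ (by
      have := cx_ne (1/2) (by norm_num); push_cast at this; exact this), Complex.digamma_one_half]
  have e2 : Complex.log π = ((Real.log π : ℝ) : ℂ) := by
    rw [Complex.ofReal_log Real.pi_pos.le]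
  have e3 : Complex.log 2 = ((Real.log 2 : ℝ) : ℂ) := by
    rw [Complex.ofReal_log (by norm_num)]; norm_num
  rw [e2, e3]
  have : ((Real.eulerMascheroniConstant:ℂ) * 1 + 1 / 1 * (1 * (-((Real.log π : ℝ) : ℂ) / 2 + (-2 * ((Real.log 2:ℝ):ℂ) - Real.eulerMascheroniConstant + (1/2)⁻¹)/2))) / 1
    = ((Real.eulerMascheroniConstant + (-Real.log π / 2 + (-2 * Real.log 2 - Real.eulerMascheroniConstant + 2)/2) : ℝ):ℂ) := by push_cast; norm_num
  rw [this, Complex.ofReal_re]; ring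

end MT


namespace MT

lemma moment_unique (q : ℝ → ℝ) (hq : ContinuousOn q (Set.Icc 0 1))
    (hm : ∀ k : ℕ, ∫ y in (0:ℝ)..1, q y * y ^ k = 0) : ∀ y ∈ Set.Icc (0:ℝ) 1, q y = 0 := by
  have hqi : IntervalIntegrable q MeasureTheory.volume 0 1 := by
    apply ContinuousOn.intervalIntegrable; rwa [Set.uIcc_of_le zero_le_one]
  have hpoly : ∀ p : Polynomial ℝ, ∫ y in (0:ℝ)..1, q y * p.eval y = 0 := by
    intro p
    have : ∀ y, q y * p.eval y = ∑ k ∈ range (p.natDegree + 1), p.coeff k * (q y * y ^ k) := by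
      intro y
      rw [Polynomial.eval_eq_sum_range, Finset.mul_sum]
      exact Finset.sum_congr rfl fun _ _ => by ring
    simp only [this]
    rw [intervalIntegral.integral_finsetSum]
    · refine Finset.sum_eq_zero fun k _ => ?_
      rw [intervalIntegral.integral_const_mul, hm, mul_zero]
    · intro k _
      exact (hqi.mul_continuousOn (by fun_prop)).const_mul _
  have hsq : ∫ y in (0:ℝ)..1, q y * q y = 0 := by
    obtain ⟨B, hB⟩ := (isCompact_Icc (a := (0:ℝ)) (b := 1)).exists_bound_of_continuousOn hq
    have hB0 : 0 ≤ B := (norm_nonneg _).trans (hB 0 (by simp))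
    by_contra hne
    obtain ⟨p, hp⟩ := exists_polynomial_near_of_continuousOn 0 1 q hq
      (|∫ y in (0:ℝ)..1, q y * q y| / (B + 1)) (by positivity)
    have h1 : ∫ y in (0:ℝ)..1, q y * q y = ∫ y in (0:ℝ)..1, q y * (q y - p.eval y) := by
      have : ∀ y, q y * (q y - p.eval y) = q y * q y - q y * p.eval y := fun y => by ring
      simp only [this]
      rw [intervalIntegral.integral_sub, hpoly p, sub_zero]
      · exact hqi.mul_continuousOn (by rwa [Set.uIcc_of_le zero_le_one])
      · exact hqi.mul_continuousOn (by fun_prop)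
    have h2 : ‖∫ y in (0:ℝ)..1, q y * (q y - p.eval y)‖ ≤
        B * (|∫ y in (0:ℝ)..1, q y * q y| / (B + 1)) * |(1:ℝ) - 0| := by
      apply intervalIntegral.norm_integral_le_of_norm_le_const
      intro y hy
      rw [Set.uIoc_of_le zero_le_one] at hy
      have hy' : y ∈ Set.Icc (0:ℝ) 1 := ⟨hy.1.le, hy.2⟩
      rw [norm_mul]
      have := hp y hy'
      rw [abs_sub_comm] at this
      exact mul_le_mul (hB y hy') (by rw [Real.norm_eq_abs]; exact this.le) (norm_nonneg _) hB0
    rw [← h1, Real.norm_eq_abs] at h2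
    have h3 : 0 < |∫ y in (0:ℝ)..1, q y * q y| := abs_pos.2 hne
    have h4 : B * (|∫ y in (0:ℝ)..1, q y * q y| / (B + 1)) * |(1:ℝ) - 0| <
        |∫ y in (0:ℝ)..1, q y * q y| := by
      rw [sub_zero, abs_one, mul_one, ← mul_div_assoc, div_lt_iff₀ (by linarith)]
      nlinarith
    linarith
  intro y hy
  by_contra hne
  have hpos : 0 < ∫ y in (0:ℝ)..1, q y * q y := by
    apply intervalIntegral.integral_pos zero_lt_one (hq.mul hq)
    · intro x _; exact mul_self_nonneg _
    · exact ⟨y, hy, mul_self_pos.2 hne⟩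
  linarith

lemma int_log (j : ℕ) : ∫ y in (0:ℝ)..1, (-Real.log y) * y ^ (j+1) = 1 / ((j:ℝ)+2)^2 := by
  have hF : ∀ y : ℝ, y ∈ Set.Ioo (0:ℝ) 1 → HasDerivAt (fun y : ℝ => - (y * Real.log y) * y^(j+1) / (j+2) + y^(j+2) / (j+2)^2)
      ((-Real.log y) * y ^ (j+1)) y := by
    intro y hy
    have hy0 : y ≠ 0 := hy.1.ne'
    have h1 := Real.hasDerivAt_mul_log hy0
    have h2 := ((h1.neg.mul (hasDerivAt_pow (j+1) y)).div_const ((j:ℝ)+2)).add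
      ((hasDerivAt_pow (j+2) y).div_const (((j:ℝ)+2)^2))
    refine h2.congr_deriv ?_
    simp only [Nat.add_sub_cancel, show j + 2 - 1 = j + 1 by omega]
    push_cast
    simp only [Pi.neg_apply]
    field_simp
    ring
  rw [intervalIntegral.integral_eq_sub_of_hasDerivAt_of_le zero_le_one _ hF]
  · simp
  · have : Continuous (fun y : ℝ => (-Real.log y) * y ^ (j+1)) := by
      have : (fun y : ℝ => (-Real.log y) * y ^ (j+1)) = fun y => -(y * Real.log y) * y ^ j := by
        ext y; ring
      rw [this]
      have := Real.continuous_mul_log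
      fun_prop
    exact this.intervalIntegrable _ _
  · have := Real.continuous_mul_log
    fun_prop

lemma int_cos (j : ℕ) (g : ℝ) : ∫ y in (0:ℝ)..1, (Real.sqrt y * Real.cos (g * Real.log y)) * y ^ j =
    ((j:ℝ) + 3/2) / (((j:ℝ)+3/2)^2 + g^2) := by
  set r : ℂ := ((j:ℝ) + 1/2 : ℝ) + (g:ℂ) * Complex.I with hr
  have hre : r.re = j + 1/2 := by simp [hr]
  have h1 := integral_cpow (a := 0) (b := 1) (r := r) (Or.inl (by
    rw [hre]; have : (0:ℝ) ≤ j := by positivity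
    linarith))
  have h2 : ∫ y in (0:ℝ)..1, (Real.sqrt y * Real.cos (g * Real.log y)) * y ^ j =
      (∫ y in (0:ℝ)..1, (y:ℂ)^r).re := by
    have := intervalIntegral.intervalIntegral_eq_integral_uIoc (fun y : ℝ => (y:ℂ)^r) 0 1 MeasureTheory.volume
    have hint : IntervalIntegrable (fun y : ℝ => (y:ℂ)^r) MeasureTheory.volume 0 1 :=
      intervalIntegral.intervalIntegrable_cpow' (by
        rw [hre]; have : (0:ℝ) ≤ j := by positivity
        linarith)
    have h3 := Complex.reCLM.intervalIntegral_comp_comm hint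
    simp only [Complex.reCLM_apply] at h3
    rw [← h3]
    refine intervalIntegral.integral_congr_ae (Filter.Eventually.of_forall fun y hy => ?_)
    rw [Set.uIoc_of_le zero_le_one] at hy
    have hy0 : 0 < y := hy.1
    have e1 : (y:ℂ)^r = ((y ^ j * Real.sqrt y : ℝ):ℂ) * Complex.exp ((g * Real.log y : ℝ) * Complex.I) := by
      rw [Complex.cpow_def_of_ne_zero (by exact_mod_cast hy0.ne'), hr, mul_add, Complex.exp_add,
        ← Complex.ofReal_log hy0.le]
      congr 1
      · rw [← Complex.ofReal_mul, ← Complex.ofReal_exp, ← Real.rpow_def_of_pos hy0,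
          Real.rpow_add hy0, Real.rpow_natCast, Real.sqrt_eq_rpow]
      · congr 1; push_cast; ring
    rw [e1, Complex.re_ofReal_mul, Complex.exp_ofReal_mul_I_re]
    ring
  rw [h2, h1]
  have hr1 : r + 1 ≠ 0 := by
    intro h
    have := congrArg Complex.re h
    simp [hre] at this
    have : (0:ℝ) ≤ j := by positivity
    linarith
  rw [Complex.ofReal_zero, Complex.zero_cpow hr1, Complex.ofReal_one, Complex.one_cpow, sub_zero,
    one_div, Complex.inv_re, Complex.normSq_apply]
  have : (r+1).re = j + 3/2 := by simp [hre]; ring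
  have h3 : (r+1).im = g := by simp [hr]
  rw [this, h3]
  congr 1; ring

lemma int_pow (j : ℕ) : ∫ y in (0:ℝ)..1, y ^ j = 1 / ((j:ℝ)+1) := by
  rw [integral_pow]; simp

lemma int_tent (n j : ℕ) (hn : 1 ≤ n) : ∫ y in (0:ℝ)..1, max 0 (1/(n:ℝ) - y) * y ^ j =
    (1 / (n:ℝ)^(j+2)) * (1 / (((j:ℝ)+1) * ((j:ℝ)+2))) := by
  have hn0 : (0:ℝ) < n := by exact_mod_cast hn
  have hn1 : (1:ℝ) ≤ n := by exact_mod_cast hn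
  have hle : 1/(n:ℝ) ≤ 1 := by rw [div_le_one hn0]; exact hn1
  have hc : Continuous (fun y : ℝ => max 0 (1/(n:ℝ) - y) * y ^ j) := by fun_prop
  rw [← intervalIntegral.integral_add_adjacent_intervals (b := 1/(n:ℝ)) (hc.intervalIntegrable _ _)
    (hc.intervalIntegrable _ _)]
  have h1 : ∫ y in (0:ℝ)..(1/(n:ℝ)), max 0 (1/(n:ℝ) - y) * y ^ j =
      ∫ y in (0:ℝ)..(1/(n:ℝ)), (1/(n:ℝ) * y ^ j - y^(j+1)) := by
    refine intervalIntegral.integral_congr fun y hy => ?_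
    rw [Set.uIcc_of_le (by positivity)] at hy
    have : 0 ≤ 1/(n:ℝ) - y := by linarith [hy.2]
    simp only [max_eq_right this]; ring
  have h2 : ∫ y in (1/(n:ℝ))..1, max 0 (1/(n:ℝ) - y) * y ^ j = ∫ y in (1/(n:ℝ))..1, (0:ℝ) := by
    refine intervalIntegral.integral_congr fun y hy => ?_
    rw [Set.uIcc_of_le hle] at hy
    have : 1/(n:ℝ) - y ≤ 0 := by linarith [hy.1]
    simp only [max_eq_left this]; ring
  rw [h1, h2, intervalIntegral.integral_zero, add_zero, intervalIntegral.integral_sub,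
    intervalIntegral.integral_const_mul, integral_pow, integral_pow]
  · simp only [zero_pow (Nat.succ_ne_zero _), sub_zero, div_pow, one_pow]
    push_cast
    field_simp
    ring
  · exact Continuous.intervalIntegrable (by fun_prop) _ _
  · exact Continuous.intervalIntegrable (by fun_prop) _ _

lemma hasSum_congr_aux {ι : Type} {f g : ι → ℝ} {a b : ℝ} (h : HasSum f a) (hfg : ∀ i, g i = f i)
    (hab : b = a) : HasSum g b := by
  have : g = f := funext hfg
  rw [this, hab]; exact h

structure ZeroData where
  ι : Type
  cnt : Countable ι
  γ : ι → ℝ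
  m : ι → ℝ
  hm : ∀ i, 0 ≤ m i
  hs : ∀ b : ℝ, 0 < b → HasSum (fun i => m i * (b / (b ^ 2 + γ i ^ 2))) (F (1/2 + b))

lemma exists_zeroData (hRH : RiemannHypothesis) : Nonempty ZeroData := by
  obtain ⟨ι, hι, γ, m, hm, hs⟩ := hadamard_xi hRH
  exact ⟨⟨ι, hι, γ, m, hm, hs⟩⟩

noncomputable def ZeroData.a (Z : ZeroData) (i : Z.ι) : ℝ := Z.m i / (1/4 + Z.γ i ^ 2)

lemma ZeroData.a_nonneg (Z : ZeroData) (i : Z.ι) : 0 ≤ Z.a i :=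
  div_nonneg (Z.hm i) (by positivity)

lemma ZeroData.a_sum (Z : ZeroData) : HasSum Z.a (2 * F 1) := by
  have h := (Z.hs (1/2) (by norm_num)).mul_left 2
  rw [show (1/2+1/2:ℝ) = 1 by norm_num] at h
  refine hasSum_congr_aux h (fun i => ?_) rfl
  simp only [ZeroData.a]
  have : (1/4 + Z.γ i ^ 2) ≠ 0 := by positivity
  have : ((1/2)^2 + Z.γ i ^ 2) ≠ 0 := by positivity
  field_simp
  ring

noncomputable def ZeroData.H (Z : ZeroData) (u : ℝ) : ℝ := ∑' i, Z.a i * Real.cos (Z.γ i * u)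

lemma ZeroData.H_term_le (Z : ZeroData) (u : ℝ) (i : Z.ι) : ‖Z.a i * Real.cos (Z.γ i * u)‖ ≤ Z.a i := by
  rw [norm_mul, Real.norm_of_nonneg (Z.a_nonneg i)]
  exact mul_le_of_le_one_right (Z.a_nonneg i) (Real.abs_cos_le_one _)

lemma ZeroData.H_hasSum (Z : ZeroData) (u : ℝ) :
    HasSum (fun i => Z.a i * Real.cos (Z.γ i * u)) (Z.H u) :=
  (Summable.of_norm_bounded Z.a_sum.summable (Z.H_term_le u)).hasSum

lemma ZeroData.H_cont (Z : ZeroData) : Continuous Z.H := by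
  refine continuous_tsum (fun i => by fun_prop) Z.a_sum.summable (fun i u => Z.H_term_le u i)

lemma ZeroData.H_le (Z : ZeroData) (u : ℝ) : |Z.H u| ≤ 2 * F 1 := by
  have := tsum_of_norm_bounded Z.a_sum (Z.H_term_le u)
  exact this

lemma ZeroData.H_neg (Z : ZeroData) (u : ℝ) : Z.H (-u) = Z.H u := by
  simp [ZeroData.H]

lemma ZeroData.H_moment (Z : ZeroData) (j : ℕ) :
    ∫ y in (0:ℝ)..1, (Real.sqrt y * Z.H (Real.log y)) * y ^ j =
      ((2*(j:ℝ)+3) * F 1 - F ((j:ℝ)+2)) / (((j:ℝ)+2) * ((j:ℝ)+1)) := by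
  have hcnt := Z.cnt
  have h1 : HasSum (fun i => ∫ y in (0:ℝ)..1, Z.a i * ((Real.sqrt y * Real.cos (Z.γ i * Real.log y)) * y ^ j))
      (∫ y in (0:ℝ)..1, (Real.sqrt y * Z.H (Real.log y)) * y ^ j) := by
    refine intervalIntegral.hasSum_integral_of_dominated_convergence (fun i _ => Z.a i) ?_ ?_ ?_ ?_ ?_
    · intro i
      apply Measurable.aestronglyMeasurable
      have := Real.measurable_log
      fun_prop
    · intro i
      refine Filter.Eventually.of_forall fun y hy => ?_
      rw [Set.uIoc_of_le zero_le_one] at hy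
      rw [norm_mul, Real.norm_of_nonneg (Z.a_nonneg i)]
      refine mul_le_of_le_one_right (Z.a_nonneg i) ?_
      rw [norm_mul, norm_mul, norm_pow, Real.norm_of_nonneg (Real.sqrt_nonneg _), Real.norm_of_nonneg hy.1.le]
      have a1 : Real.sqrt y ≤ 1 := Real.sqrt_le_one.2 hy.2
      have a2 : y ^ j ≤ 1 := pow_le_one₀ hy.1.le hy.2
      have a3 : ‖Real.cos (Z.γ i * Real.log y)‖ ≤ 1 := Real.abs_cos_le_one _
      refine mul_le_one₀ (mul_le_one₀ a1 (norm_nonneg _) a3) (pow_nonneg hy.1.le _) a2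
    · exact Filter.Eventually.of_forall fun y hy => Z.a_sum.summable
    · exact intervalIntegrable_const
    · refine Filter.Eventually.of_forall fun y hy => ?_
      have := (Z.H_hasSum (Real.log y)).mul_left (Real.sqrt y * y^j)
      refine (hasSum_congr_aux this (fun i => ?_) ?_) <;> ring
  simp only [intervalIntegral.integral_const_mul, int_cos] at h1
  have hb : (0:ℝ) < (j:ℝ) + 3/2 := by positivity
  have h2 : HasSum (fun i => Z.a i * (((j:ℝ) + 3/2) / (((j:ℝ)+3/2)^2 + Z.γ i^2)))
      ((((j:ℝ)+3/2) * (2 * F 1) - F (1/2 + ((j:ℝ)+3/2))) / (((j:ℝ)+2) * ((j:ℝ)+1))) := by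
    have := ((Z.a_sum.mul_left ((j:ℝ)+3/2)).sub (Z.hs _ hb)).div_const (((j:ℝ)+2) * ((j:ℝ)+1))
    refine hasSum_congr_aux this (fun i => ?_) rfl
    simp only [ZeroData.a]
    have e1 : (1/4 + Z.γ i ^ 2) ≠ 0 := by positivity
    have e2 : ((j:ℝ)+3/2)^2 + Z.γ i^2 ≠ 0 := by positivity
    generalize Z.γ i = g at *
    generalize Z.m i = m at *
    field_simp
    ring
  rw [h1.unique h2]
  congr 1
  rw [show 1/2 + ((j:ℝ)+3/2) = j + 2 by ring]; ring

open ArithmeticFunction in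
/-- `V x = ∫_1^x ψ(t)/t² dt`. -/
noncomputable def V (x : ℝ) : ℝ := ∑ n ∈ Finset.Ioc 0 ⌊x⌋₊, vonMangoldt n * (1 / (n:ℝ) - 1 / x)

open ArithmeticFunction in
lemma V_eq_sum (y : ℝ) (hy : 0 < y) (N : ℕ) (hN : 1 / y ≤ N) :
    V (1/y) = ∑ n ∈ range (N+1), vonMangoldt n * max 0 (1/(n:ℝ) - y) := by
  rw [V]
  have hsub : Finset.Ioc 0 ⌊1/y⌋₊ ⊆ range (N+1) := by
    intro n hn
    rw [Finset.mem_Ioc] at hn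
    rw [Finset.mem_range]
    have : ⌊1/y⌋₊ ≤ N := Nat.floor_le_of_le hN
    omega
  rw [← Finset.sum_subset hsub]
  · refine Finset.sum_congr rfl fun n hn => ?_
    rw [Finset.mem_Ioc] at hn
    have hn0 : (0:ℝ) < n := by exact_mod_cast hn.1
    have h1 : (n:ℝ) ≤ 1/y := (Nat.le_floor_iff (by positivity)).1 hn.2
    have : 0 ≤ 1/(n:ℝ) - y := by
      rw [sub_nonneg, le_div_iff₀ hn0]
      rw [le_div_iff₀ hy] at h1; linarith
    rw [max_eq_right this, one_div_one_div]
  · intro n _ hn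
    rcases Nat.eq_zero_or_pos n with rfl | hp
    · simp
    have hn0 : (0:ℝ) < n := by exact_mod_cast hp
    have h1 : ⌊1/y⌋₊ < n := by
      by_contra h; exact hn (Finset.mem_Ioc.2 ⟨hp, not_lt.1 h⟩)
    have h2 : 1/y < n := (Nat.floor_lt (by positivity)).1 h1
    have : 1/(n:ℝ) - y ≤ 0 := by
      rw [sub_nonpos, div_le_iff₀ hn0]
      rw [div_lt_iff₀ hy] at h2; linarith
    rw [max_eq_left this, mul_zero]

open ArithmeticFunction in
lemma V_hasSum (y : ℝ) (hy : 0 < y) :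
    HasSum (fun n : ℕ => vonMangoldt n * max 0 (1/(n:ℝ) - y)) (V (1/y)) := by
  obtain ⟨N, hN⟩ := exists_nat_ge (1/y)
  rw [V_eq_sum y hy N hN]
  refine hasSum_sum_of_ne_finset_zero fun n hn => ?_
  rw [Finset.mem_range, not_lt] at hn
  have h1 : (N:ℝ) + 1 ≤ n := by exact_mod_cast hn
  have hn0 : (0:ℝ) < n := by have : (0:ℝ) ≤ N := by positivity
                             linarith
  have : 1/(n:ℝ) - y ≤ 0 := by
    rw [sub_nonpos, div_le_iff₀ hn0]
    rw [div_le_iff₀ hy] at hN; nlinarith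
  rw [max_eq_left this, mul_zero]

lemma V_cont : ContinuousOn (fun y => V (1/y)) (Set.Ioi 0) := by
  intro y hy
  have hy' : (0:ℝ) < y := hy
  obtain ⟨N, hN⟩ := exists_nat_ge (1/(y/2))
  refine ContinuousAt.continuousWithinAt ?_
  have : (fun y => V (1/y)) =ᶠ[nhds y] fun y => ∑ n ∈ range (N+1), ArithmeticFunction.vonMangoldt n * max 0 (1/(n:ℝ) - y) := by
    filter_upwards [lt_mem_nhds (show y/2 < y by linarith)] with z hz
    refine V_eq_sum z (by linarith) N (le_trans ?_ hN)
    apply one_div_le_one_div_of_le (by linarith) hz.le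
  refine ContinuousAt.congr ?_ this.symm
  fun_prop

lemma V_nonneg (y : ℝ) (hy : 0 < y) : 0 ≤ V (1/y) := (V_hasSum y hy).nonneg fun n =>
  mul_nonneg ArithmeticFunction.vonMangoldt_nonneg (le_max_left _ _)

lemma V_le_psi (x : ℝ) (hx : 0 < x) : V x ≤ Chebyshev.psi x := by
  rw [V, Chebyshev.psi]
  refine Finset.sum_le_sum fun n hn => mul_le_of_le_one_right ArithmeticFunction.vonMangoldt_nonneg ?_
  rw [Finset.mem_Ioc] at hn
  have : (1:ℝ) ≤ n := by exact_mod_cast hn.1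
  have h1 : 1/(n:ℝ) ≤ 1 := by rw [div_le_one (by linarith)]; exact this
  have : 0 ≤ 1/x := by positivity
  linarith

lemma vonMangoldt_hasSum (s : ℕ) (hs : 2 ≤ s) :
    HasSum (fun n : ℕ => ArithmeticFunction.vonMangoldt n * (1 / (n:ℝ)^s)) (-(logDeriv riemannZeta (s:ℝ)).re) := by
  have hs1 : 1 < ((s:ℝ):ℂ).re := by
    rw [Complex.ofReal_re]; exact_mod_cast hs
  have h1 := (ArithmeticFunction.LSeriesSummable_vonMangoldt hs1).hasSum
  have h2 := ArithmeticFunction.LSeries_vonMangoldt_eq_deriv_riemannZeta_div hs1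
  unfold LSeries at h2
  rw [h2] at h1
  have h3 := Complex.hasSum_re h1
  refine hasSum_congr_aux h3 (fun n => ?_) ?_
  · rcases Nat.eq_zero_or_pos n with rfl | hp
    · simp
    rw [LSeries.term_of_ne_zero hp.ne']
    have : (n:ℂ) ^ (((s:ℝ)):ℂ) = (((n:ℝ)^s : ℝ) : ℂ) := by
      push_cast
      exact Complex.cpow_natCast _ _
    rw [this, ← Complex.ofReal_div, Complex.ofReal_re]
    ring
  · rw [logDeriv_apply, neg_div, Complex.neg_re]

lemma V_moment (j : ℕ) (hj : 2 ≤ j) :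
    ∫ y in (0:ℝ)..1, V (1/y) * y ^ j =
      -(logDeriv riemannZeta ((j:ℝ)+2 : ℝ)).re / (((j:ℝ)+1) * ((j:ℝ)+2)) := by
  have h1 : HasSum (fun n : ℕ => ∫ y in (0:ℝ)..1, ArithmeticFunction.vonMangoldt n * (max 0 (1/(n:ℝ) - y) * y ^ j))
      (∫ y in (0:ℝ)..1, V (1/y) * y ^ j) := by
    refine intervalIntegral.hasSum_integral_of_dominated_convergence
      (fun n _ => ArithmeticFunction.vonMangoldt n * (1/(n:ℝ)^2)) ?_ ?_ ?_ ?_ ?_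
    · intro i
      apply Continuous.aestronglyMeasurable; fun_prop
    · intro n
      refine Filter.Eventually.of_forall fun y hy => ?_
      rw [Set.uIoc_of_le zero_le_one] at hy
      rw [norm_mul, Real.norm_of_nonneg ArithmeticFunction.vonMangoldt_nonneg]
      refine mul_le_mul_of_nonneg_left ?_ ArithmeticFunction.vonMangoldt_nonneg
      rcases Nat.eq_zero_or_pos n with rfl | hp
      · have : max 0 (-y) = 0 := max_eq_left (by linarith [hy.1])
        simp [this]
      have hn0 : (0:ℝ) < n := by exact_mod_cast hp
      have hn1 : (1:ℝ) ≤ n := by exact_mod_cast hp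
      rw [norm_mul, norm_pow, Real.norm_of_nonneg (le_max_left _ _), Real.norm_of_nonneg hy.1.le]
      rcases le_total (1/(n:ℝ)) y with h | h
      · rw [max_eq_left (by linarith), zero_mul]; positivity
      · rw [max_eq_right (by linarith)]
        have a1 : 1/(n:ℝ) ≤ 1 := by rw [div_le_one hn0]; exact hn1
        have a2 : y^j ≤ (1/(n:ℝ))^2 := by
          calc y ^ j ≤ y ^ 2 := pow_le_pow_of_le_one hy.1.le hy.2 hj
            _ ≤ _ := by gcongr; exact hy.1.le
        have a3 : 0 ≤ y ^ j := pow_nonneg hy.1.le _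
        calc _ ≤ 1 * y^j := by
              apply mul_le_mul_of_nonneg_right _ a3; linarith [hy.1]
          _ ≤ _ := by rw [one_mul]; simpa using a2
    · exact Filter.Eventually.of_forall fun y hy => (vonMangoldt_hasSum 2 le_rfl).summable
    · exact intervalIntegrable_const
    · refine Filter.Eventually.of_forall fun y hy => ?_
      rw [Set.uIoc_of_le zero_le_one] at hy
      have := (V_hasSum y hy.1).mul_right (y^j)
      exact hasSum_congr_aux this (fun i => by ring) rfl
  have h2 := (vonMangoldt_hasSum (j+2) (by omega)).mul_right (1 / (((j:ℝ)+1) * ((j:ℝ)+2)))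
  have h3 : (fun n : ℕ => ∫ y in (0:ℝ)..1, ArithmeticFunction.vonMangoldt n * (max 0 (1/(n:ℝ) - y) * y ^ j)) =
      fun n => ArithmeticFunction.vonMangoldt n * (1 / (n:ℝ)^(j+2)) * (1 / (((j:ℝ)+1) * ((j:ℝ)+2))) := by
    ext n
    rw [intervalIntegral.integral_const_mul]
    rcases Nat.eq_zero_or_pos n with rfl | hp
    · simp
    rw [int_tent n j hp]; ring
  rw [h3] at h1
  rw [h1.unique h2]
  push_cast
  ring

noncomputable def U (y : ℝ) : ℝ := ∑' n : ℕ, (1 - y ^ (2*n+3)) / ((2*(n:ℝ)+2) * (2*(n:ℝ)+3))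

lemma U_summable : Summable (fun n : ℕ => 1 / ((2*(n:ℝ)+2) * (2*(n:ℝ)+3))) := by
  have h := (summable_nat_add_iff 1).2 (Real.summable_one_div_nat_pow.2 (by norm_num : 1 < 2))
  refine Summable.of_nonneg_of_le (fun n => by positivity) (fun n => ?_) h
  apply one_div_le_one_div_of_le (by positivity)
  push_cast
  nlinarith [(by positivity : (0:ℝ) ≤ n)]

lemma U_term_le (y : ℝ) (hy : y ∈ Set.Icc (0:ℝ) 1) (n : ℕ) :
    ‖(1 - y ^ (2*n+3)) / ((2*(n:ℝ)+2) * (2*(n:ℝ)+3))‖ ≤ 1 / ((2*(n:ℝ)+2) * (2*(n:ℝ)+3)) := by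
  have h1 : y ^ (2*n+3) ≤ 1 := pow_le_one₀ hy.1 hy.2
  have h2 : 0 ≤ y ^ (2*n+3) := pow_nonneg hy.1 _
  rw [norm_div, Real.norm_of_nonneg (by linarith), Real.norm_of_nonneg (by positivity)]
  gcongr
  linarith

lemma U_hasSum (y : ℝ) (hy : y ∈ Set.Icc (0:ℝ) 1) :
    HasSum (fun n : ℕ => (1 - y ^ (2*n+3)) / ((2*(n:ℝ)+2) * (2*(n:ℝ)+3))) (U y) :=
  (Summable.of_norm_bounded U_summable (U_term_le y hy)).hasSum

lemma U_cont : ContinuousOn U (Set.Icc 0 1) :=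
  continuousOn_tsum (fun n => by fun_prop) U_summable (fun n y hy => U_term_le y hy n)

lemma U_moment (j : ℕ) :
    ∫ y in (0:ℝ)..1, U y * y ^ j =
      (dig (((j:ℝ)+2)/2+1) + Real.eulerMascheroniConstant) / 2 / (((j:ℝ)+1) * ((j:ℝ)+2)) := by
  have h1 : HasSum (fun n : ℕ => ∫ y in (0:ℝ)..1, (1 - y ^ (2*n+3)) / ((2*(n:ℝ)+2) * (2*(n:ℝ)+3)) * y ^ j)
      (∫ y in (0:ℝ)..1, U y * y ^ j) := by
    refine intervalIntegral.hasSum_integral_of_dominated_convergence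
      (fun n _ => 1 / ((2*(n:ℝ)+2) * (2*(n:ℝ)+3))) ?_ ?_ ?_ ?_ ?_
    · intro i
      apply Continuous.aestronglyMeasurable; fun_prop
    · intro n
      refine Filter.Eventually.of_forall fun y hy => ?_
      rw [Set.uIoc_of_le zero_le_one] at hy
      rw [norm_mul, norm_pow, Real.norm_of_nonneg hy.1.le]
      exact (mul_le_of_le_one_right (norm_nonneg _) (pow_le_one₀ hy.1.le hy.2)).trans
        (U_term_le y ⟨hy.1.le, hy.2⟩ n)
    · exact Filter.Eventually.of_forall fun y hy => U_summable
    · exact intervalIntegrable_const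
    · refine Filter.Eventually.of_forall fun y hy => ?_
      rw [Set.uIoc_of_le zero_le_one] at hy
      exact (U_hasSum y ⟨hy.1.le, hy.2⟩).mul_right (y^j)
  have h2 := ((dig_series (((j:ℝ)+2)/2) (by positivity)).div_const 2).div_const (((j:ℝ)+1) * ((j:ℝ)+2))
  have h3 : (fun n : ℕ => ∫ y in (0:ℝ)..1, (1 - y ^ (2*n+3)) / ((2*(n:ℝ)+2) * (2*(n:ℝ)+3)) * y ^ j) =
      fun n : ℕ => (1 / ((n:ℝ) + 1) - 1 / ((n:ℝ) + 1 + ((j:ℝ)+2)/2)) / 2 / (((j:ℝ)+1) * ((j:ℝ)+2)) := by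
    ext n
    have : ∀ y : ℝ, (1 - y ^ (2*n+3)) / ((2*(n:ℝ)+2) * (2*(n:ℝ)+3)) * y ^ j =
        (1 / ((2*(n:ℝ)+2) * (2*(n:ℝ)+3))) * (y ^ j - y ^ (2*n+3+j)) := by
      intro y; rw [pow_add]; ring
    simp only [this]
    rw [intervalIntegral.integral_const_mul, intervalIntegral.integral_sub, int_pow, int_pow]
    · push_cast
      field_simp
      ring
    · exact Continuous.intervalIntegrable (by fun_prop) _ _
    · exact Continuous.intervalIntegrable (by fun_prop) _ _
  rw [h3] at h1
  exact h1.unique h2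

lemma cont_mul_bdd (f : ℝ → ℝ) (B : ℝ) (hf : ContinuousOn f (Set.Ioi 0)) (hB : ∀ y ∈ Set.Ioc (0:ℝ) 1, |f y| ≤ B) :
    ContinuousOn (fun y => y * f y) (Set.Icc 0 1) := by
  intro y hy
  rcases hy.1.eq_or_lt with h | h
  · rw [← h]
    unfold ContinuousWithinAt
    beta_reduce
    rw [zero_mul]
    apply squeeze_zero_norm' (a := fun y => |y| * B)
    · filter_upwards [self_mem_nhdsWithin] with z hz
      rw [norm_mul, Real.norm_eq_abs, Real.norm_eq_abs]
      rcases hz.1.eq_or_lt with h | h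
      · simp [← h]
      · gcongr; exact hB z ⟨h, hz.2⟩
    · have : Continuous (fun y : ℝ => |y| * B) := by fun_prop
      have := (this.tendsto 0).mono_left (nhdsWithin_le_nhds (s := Set.Icc (0:ℝ) 1))
      simpa using this
  · exact (continuousAt_id.mul (hf.continuousAt (Ioi_mem_nhds h))).continuousWithinAt

theorem explicit (Z : ZeroData) (y : ℝ) (hy : y ∈ Set.Ioc (0:ℝ) 1) :
    V (1/y) = - Real.log y - (F 1 + 1 + Real.eulerMascheroniConstant / 2 + Real.log π / 2)
      - (F 1 - 1 - Real.eulerMascheroniConstant / 2 - Real.log π / 2) * y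
      + U y + Real.sqrt y * Z.H (Real.log y) := by
  set c1 := F 1 + 1 + Real.eulerMascheroniConstant / 2 + Real.log π / 2 with hc1
  set c0 := F 1 - 1 - Real.eulerMascheroniConstant / 2 - Real.log π / 2 with hc0
  have k1 : ContinuousOn (fun y => y * (y * V (1/y))) (Set.Icc 0 1) := by
    refine cont_mul_bdd _ (Real.log 4 + 4) (continuousOn_id.mul V_cont) ?_
    intro y hy
    rw [abs_of_nonneg (mul_nonneg hy.1.le (V_nonneg y hy.1))]
    have h1 := V_le_psi (1/y) (by have := hy.1; positivity)
    have h2 := Chebyshev.psi_le_const_mul_self (x := 1/y) (by have := hy.1; positivity)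
    calc y * V (1/y) ≤ y * ((Real.log 4 + 4) * (1/y)) := by
          apply mul_le_mul_of_nonneg_left _ hy.1.le; linarith
      _ = _ := by have := hy.1.ne'; field_simp
  have k2 : ContinuousOn (fun y => y * (y * (Real.sqrt y * Z.H (Real.log y)))) (Set.Icc 0 1) := by
    refine cont_mul_bdd _ (2 * F 1) ?_ ?_
    · have := Z.H_cont
      refine continuousOn_id.mul (Real.continuous_sqrt.continuousOn.mul (this.comp_continuousOn ?_))
      exact Real.continuousOn_log.mono (by intro x hx; exact (ne_of_gt hx))
    · intro y hy
      rw [abs_mul, abs_mul, abs_of_nonneg hy.1.le, abs_of_nonneg (Real.sqrt_nonneg _)]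
      have a1 : Real.sqrt y ≤ 1 := Real.sqrt_le_one.2 hy.2
      have a2 := Z.H_le (Real.log y)
      have a3 := abs_nonneg (Z.H (Real.log y))
      have a4 : Real.sqrt y * |Z.H (Real.log y)| ≤ |Z.H (Real.log y)| := mul_le_of_le_one_left a3 a1
      have a5 : y * (Real.sqrt y * |Z.H (Real.log y)|) ≤ Real.sqrt y * |Z.H (Real.log y)| :=
        mul_le_of_le_one_left (by positivity) hy.2
      linarith
  have k3 : ContinuousOn (fun y : ℝ => y * (y * Real.log y)) (Set.Icc 0 1) := by
    have := Real.continuous_mul_log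
    fun_prop
  have k4 : ContinuousOn (fun y : ℝ => y^2 * U y) (Set.Icc 0 1) :=
    (by fun_prop : ContinuousOn (fun y : ℝ => y^2) (Set.Icc 0 1)).mul U_cont
  have k5 : ContinuousOn (fun y : ℝ => c1 * y^2 + c0 * y^3) (Set.Icc 0 1) := by fun_prop
  set q : ℝ → ℝ := fun y => y * (y * V (1/y)) + y * (y * Real.log y) + (c1 * y^2 + c0 * y^3)
    - y^2 * U y - y * (y * (Real.sqrt y * Z.H (Real.log y))) with hq
  have hqc : ContinuousOn q (Set.Icc 0 1) := (((k1.add k3).add k5).sub k4).sub k2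
  have hz := moment_unique q hqc (by
    intro k
    have ii : ∀ f : ℝ → ℝ, ContinuousOn f (Set.Icc 0 1) →
        IntervalIntegrable (fun y => f y * y ^ k) MeasureTheory.volume 0 1 := by
      intro f hf
      apply ContinuousOn.intervalIntegrable
      rw [Set.uIcc_of_le zero_le_one]
      exact hf.mul (by fun_prop)
    have e : ∀ y, q y * y ^ k = (y * (y * V (1/y))) * y^k + (y * (y * Real.log y)) * y^k +
        ((c1 * y^2 + c0 * y^3)) * y^k
        - (y^2 * U y) * y^k - (y * (y * (Real.sqrt y * Z.H (Real.log y)))) * y ^ k := by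
      intro y; simp only [hq]; ring
    simp only [e]
    rw [intervalIntegral.integral_sub ((((ii _ k1).add (ii _ k3)).add (ii _ k5)).sub (ii _ k4)) (ii _ k2),
      intervalIntegral.integral_sub (((ii _ k1).add (ii _ k3)).add (ii _ k5)) (ii _ k4),
      intervalIntegral.integral_add ((ii _ k1).add (ii _ k3)) (ii _ k5),
      intervalIntegral.integral_add (ii _ k1) (ii _ k3)]
    have e1 : ∀ y : ℝ, (y * (y * V (1/y))) * y^k = V (1/y) * y ^ (k+2) := fun y => by ring
    have e2 : ∀ y : ℝ, (y * (y * Real.log y)) * y^k = -((-Real.log y) * y ^ (k+1+1)) := fun y => by ring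
    have e3 : ∀ y : ℝ, ((c1 * y^2 + c0 * y^3)) * y^k = c1 * y ^ (k+2) + c0 * y ^ (k+3) := fun y => by ring
    have e4 : ∀ y : ℝ, (y^2 * U y) * y^k = U y * y ^ (k+2) := fun y => by ring
    have e5 : ∀ y : ℝ, (y * (y * (Real.sqrt y * Z.H (Real.log y)))) * y ^ k =
      (Real.sqrt y * Z.H (Real.log y)) * y ^ (k+2) := fun y => by ring
    simp only [e1, e2, e3, e4, e5]
    rw [V_moment _ (by omega), intervalIntegral.integral_neg, int_log, U_moment, Z.H_moment,
      intervalIntegral.integral_add, intervalIntegral.integral_const_mul,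
      intervalIntegral.integral_const_mul, int_pow, int_pow]
    · push_cast
      have hF := F_formula ((k:ℝ)+2+2) (by have : (0:ℝ) ≤ k := by positivity
                                           linarith)
      push_cast at hF
      rw [hF, hc0, hc1]
      have : (k:ℝ)+2+2-1 ≠ 0 := by have : (0:ℝ) ≤ k := by positivity
                                   intro h; linarith
      have e6 : (k:ℝ)+2+2-1 = k+3 := by ring
      rw [e6]
      generalize (logDeriv riemannZeta ((k:ℂ)+2+2)).re = L
      generalize dig (((k:ℝ)+2+2)/2+1) = D
      field_simp
      ring
    · exact Continuous.intervalIntegrable (by fun_prop) _ _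
    · exact Continuous.intervalIntegrable (by fun_prop) _ _)
  have h := hz y ⟨hy.1.le, hy.2⟩
  have hy2 : y^2 ≠ 0 := pow_ne_zero _ hy.1.ne'
  have : y^2 * (V (1/y) - (- Real.log y - c1 - c0 * y + U y + Real.sqrt y * Z.H (Real.log y))) = 0 := by
    rw [← h, hq]; ring
  rcases mul_eq_zero.1 this with h | h
  · exact absurd h hy2
  · linarith

end MT

namespace MT

lemma explicit' (Z : ZeroData) (x : ℝ) (hx : 1 ≤ x) :
    V x = Real.log x - (Real.eulerMascheroniConstant + 2 - Real.log 2) + Real.log (2*π) / x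
      + U (1/x) + Z.H (Real.log x) / Real.sqrt x := by
  have h0 : 0 < x := by linarith
  have h := explicit Z (1/x) ⟨by positivity, by rw [div_le_one h0]; exact hx⟩
  rw [one_div_one_div] at h
  rw [h, F_one, one_div, Real.log_inv, Z.H_neg, Real.sqrt_inv,
    Real.log_mul (by norm_num) Real.pi_pos.ne']
  ring

/-- Differences of `V`. -/
lemma V_diff (x x' : ℝ) (hx : 0 < x) (h : x ≤ x') :
    Chebyshev.psi x * (1/x - 1/x') ≤ V x' - V x ∧ V x' - V x ≤ Chebyshev.psi x' * (1/x - 1/x') := by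
  have hx' : 0 < x' := by linarith
  have hinv : 1/x' ≤ 1/x := one_div_le_one_div_of_le hx h
  have hsub : Finset.Ioc 0 ⌊x⌋₊ ⊆ Finset.Ioc 0 ⌊x'⌋₊ := Finset.Ioc_subset_Ioc_right (Nat.floor_mono h)
  have e : V x' - V x = Chebyshev.psi x * (1/x - 1/x') +
      ∑ n ∈ Finset.Ioc 0 ⌊x'⌋₊ \ Finset.Ioc 0 ⌊x⌋₊, ArithmeticFunction.vonMangoldt n * (1 / (n:ℝ) - 1 / x') := by
    rw [V, V, Chebyshev.psi, ← Finset.sum_sdiff hsub, Finset.sum_mul, add_sub_assoc,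
      ← Finset.sum_sub_distrib, add_comm]
    congr 1
    refine Finset.sum_congr rfl fun n _ => by ring
  have e2 : Chebyshev.psi x' = (∑ n ∈ Finset.Ioc 0 ⌊x'⌋₊ \ Finset.Ioc 0 ⌊x⌋₊, ArithmeticFunction.vonMangoldt n)
     + Chebyshev.psi x := by
    rw [Chebyshev.psi, Chebyshev.psi, Finset.sum_sdiff hsub]
  have mem : ∀ n ∈ Finset.Ioc 0 ⌊x'⌋₊ \ Finset.Ioc 0 ⌊x⌋₊, 1/x' ≤ 1/(n:ℝ) ∧ 1/(n:ℝ) ≤ 1/x := by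
    intro n hn
    rw [Finset.mem_sdiff, Finset.mem_Ioc, Finset.mem_Ioc] at hn
    have hn0 : (0:ℝ) < n := by exact_mod_cast hn.1.1
    have h1 : (n:ℝ) ≤ x' := (Nat.le_floor_iff hx'.le).1 hn.1.2
    have h2 : x < n := (Nat.floor_lt hx.le).1 (by by_contra hh; exact hn.2 ⟨hn.1.1, not_lt.1 hh⟩)
    exact ⟨one_div_le_one_div_of_le hn0 h1, one_div_le_one_div_of_le hx h2.le⟩
  constructor
  · rw [e]
    have : 0 ≤ ∑ n ∈ Finset.Ioc 0 ⌊x'⌋₊ \ Finset.Ioc 0 ⌊x⌋₊, ArithmeticFunction.vonMangoldt n * (1 / (n:ℝ) - 1 / x') :=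
      Finset.sum_nonneg fun n hn => mul_nonneg ArithmeticFunction.vonMangoldt_nonneg (by linarith [(mem n hn).1])
    linarith
  · rw [e, e2, add_mul, add_comm, Finset.sum_mul]
    refine add_le_add (Finset.sum_le_sum fun n hn => ?_) le_rfl
    exact mul_le_mul_of_nonneg_left (by linarith [(mem n hn).2]) ArithmeticFunction.vonMangoldt_nonneg

lemma U_diff (y y' : ℝ) (h0 : 0 ≤ y') (h : y' ≤ y) (hy : y ≤ 1/2) :
    0 ≤ U y' - U y ∧ U y' - U y ≤ (y - y') * y^2 := by
  have hs := (U_hasSum y' ⟨h0, by linarith⟩).sub (U_hasSum y ⟨by linarith, by linarith⟩)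
  have e : ∀ n : ℕ, (1 - y' ^ (2*n+3)) / ((2*(n:ℝ)+2) * (2*(n:ℝ)+3)) - (1 - y ^ (2*n+3)) / ((2*(n:ℝ)+2) * (2*(n:ℝ)+3))
     = (y ^ (2*n+3) - y' ^ (2*n+3)) / ((2*(n:ℝ)+2) * (2*(n:ℝ)+3)) := by intro n; ring
  simp only [e] at hs
  have hy0 : 0 ≤ y := by linarith
  constructor
  · refine hs.nonneg fun n => div_nonneg ?_ (by positivity)
    have := pow_le_pow_left₀ h0 h (2*n+3)
    linarith
  · have hg := (hasSum_geometric_of_lt_one (r := y^2) (by positivity) (by nlinarith)).mul_left ((y-y') * y^2 / 2)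
    have hle := hasSum_le (fun n => ?_) hs hg
    · refine hle.trans ?_
      have h1 : (1 - y^2)⁻¹ ≤ 2 := by
        rw [inv_le_comm₀ (by nlinarith) (by norm_num)]; nlinarith
      have h2 : 0 ≤ (y-y') * y^2/2 := by have : 0 ≤ y - y' := by linarith
                                         positivity
      nlinarith
    · have h1 : y ^ (2*n+3) - y' ^ (2*n+3) ≤ (y-y') * ((2*(n:ℝ)+3) * y^(2*n+2)) := by
        have := Commute.geom_sum₂_mul (Commute.all y y') (2*n+3)
        have hh : ∑ i ∈ range (2*n+3), y ^ i * y' ^ (2*n+3-1-i) ≤ ∑ i ∈ range (2*n+3), y ^ (2*n+2) := by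
          refine Finset.sum_le_sum fun i hi => ?_
          rw [Finset.mem_range] at hi
          calc y ^ i * y' ^ (2*n+3-1-i) ≤ y^i * y ^ (2*n+3-1-i) := by gcongr
            _ = _ := by rw [← pow_add]; congr 1; omega
        rw [Finset.sum_const, Finset.card_range, nsmul_eq_mul] at hh
        rw [← this, mul_comm]
        push_cast at hh
        apply mul_le_mul_of_nonneg_left hh; linarith
      have e3 : (y ^ 2) ^ n = y ^ (2*n) := by rw [pow_mul]
      rw [div_le_iff₀ (by positivity), e3]
      refine h1.trans ?_
      have hd : 0 ≤ y - y' := by linarith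
      have hp : 0 ≤ (y-y') * y ^ (2*n+2) * (2*(n:ℝ)+3) := by positivity
      have : (y - y') * y ^ 2 / 2 * y ^ (2 * n) * ((2 * ↑n + 2) * (2 * ↑n + 3)) =
        ((y-y') * y ^ (2*n+2) * (2*(n:ℝ)+3)) * (n+1) := by rw [pow_add]; ring
      rw [this]
      have : (0:ℝ) ≤ n := by positivity
      nlinarith

lemma exp_aux (η : ℝ) (h0 : 0 < η) (h1 : η ≤ 1) :
    η ≤ (1 - Real.exp (-η)) * (1 + η/2 + η^2/2) ∧ (1 - η/2) * (Real.exp η - 1) ≤ η ∧ 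
    η ≤ (1 - Real.exp (-η)) * (1 + η) := by
  have k3 : η ≤ (1 - Real.exp (-η)) * (1 + η) := by
    have h := Real.add_one_le_exp η
    have : Real.exp (-η) * Real.exp η = 1 := by rw [← Real.exp_add]; simp
    have := Real.exp_pos (-η)
    nlinarith
  -- e^{-η} ≤ 1 - η + η²/2
  have hE : Real.exp (-η) ≤ 1 - η + η^2/2 := by
    have h := Real.quadratic_le_exp_of_nonneg h0.le
    have h2 : Real.exp (-η) * Real.exp η = 1 := by rw [← Real.exp_add]; simp
    have h3 : 0 < 1 + η + η^2/2 := by positivity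
    have h4 := Real.exp_pos (-η)
    have h5 : Real.exp (-η) * (1 + η + η^2/2) ≤ 1 := by nlinarith
    have h6 : 1 ≤ (1 - η + η^2/2) * (1 + η + η^2/2) := by nlinarith [sq_nonneg (η^2)]
    exact le_of_mul_le_mul_right (h5.trans h6) h3
  refine ⟨?_, ?_, k3⟩
  · have : 0 < 1 + η/2 + η^2/2 := by positivity
    nlinarith [mul_nonneg (sq_nonneg η) h0.le, mul_le_mul_of_nonneg_left h1 (mul_nonneg (sq_nonneg η) h0.le)]
  · -- (1-η/2) e^η ≤ 1 + η/2
    have key : (1 - η/2) * Real.exp η ≤ 1 + η/2 := by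
      have hd : ∀ t ∈ Set.Ici (0:ℝ), HasDerivAt (fun t : ℝ => (1 + t/2) * Real.exp (-t) - (1 - t/2))
          (1/2 * Real.exp (-t) + (1+t/2) * (Real.exp (-t) * (-1)) - (-(1/2))) t := by
        intro t _
        have a1 : HasDerivAt (fun t : ℝ => 1 + t/2) (1/2) t := ((hasDerivAt_id t).div_const 2).const_add 1
        have a2 : HasDerivAt (fun t : ℝ => Real.exp (-t)) (Real.exp (-t) * (-1)) t :=
          (hasDerivAt_neg t).exp
        have a3 : HasDerivAt (fun t : ℝ => 1 - t/2) (-(1/2)) t := ((hasDerivAt_id t).div_const 2).const_sub 1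
        exact (a1.mul a2).sub a3
      have mono : MonotoneOn (fun t : ℝ => (1 + t/2) * Real.exp (-t) - (1 - t/2)) (Set.Ici 0) := by
        refine monotoneOn_of_deriv_nonneg (convex_Ici 0) (fun t ht => (hd t ht).continuousAt.continuousWithinAt)
          (fun t ht => (hd t (interior_subset ht)).differentiableAt.differentiableWithinAt) ?_
        intro t ht
        rw [(hd t (interior_subset ht)).deriv]
        have ht0 : 0 ≤ t := interior_subset ht
        have := Real.add_one_le_exp t
        have h2 : Real.exp (-t) * Real.exp t = 1 := by rw [← Real.exp_add]; simp
        have := Real.exp_pos (-t)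
        nlinarith
      have := mono (Set.mem_Ici.2 le_rfl) (Set.mem_Ici.2 h0.le) h0.le
      simp at this
      have h2 : Real.exp (-η) * Real.exp η = 1 := by rw [← Real.exp_add]; simp
      have h3 := Real.exp_pos η
      have h4 : (1 - η/2) * Real.exp η ≤ ((1 + η/2) * Real.exp (-η)) * Real.exp η := by
        apply mul_le_mul_of_nonneg_right _ h3.le; linarith
      rw [mul_assoc, h2] at h4; linarith
    nlinarith

lemma psi_lower (Z : ZeroData) (x η S : ℝ) (h0 : 0 < η) (h1 : η ≤ 1) (hx : 6 ≤ x)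
    (hS : ∀ u, |Real.exp (-η/2) * Z.H (u + η) - Z.H u| ≤ S) :
    -(x * (η/2 + η^2/2) + Real.log (2*π) + 1 + Real.sqrt x * (S / (1 - Real.exp (-η)))) ≤ Chebyshev.psi x - x := by
  have hx0 : 0 < x := by linarith
  have hsx : 0 < Real.sqrt x := Real.sqrt_pos.2 hx0
  have hE1 : Real.exp (-η) < 1 := by rw [Real.exp_lt_one_iff]; linarith
  have hE0 : 0 < Real.exp (-η) := Real.exp_pos _
  have hd : 0 < 1 - Real.exp (-η) := by linarith
  have hEE : Real.exp (-η) * Real.exp η = 1 := by rw [← Real.exp_add]; simp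
  have hEh : Real.exp (-η/2) * Real.exp (-η/2) = Real.exp (-η) := by rw [← Real.exp_add]; ring_nf
  have hl : 0 < Real.log (2*π) := Real.log_pos (by linarith [Real.pi_gt_three])
  obtain ⟨a1, a2, a3⟩ := exp_aux η h0 h1
  have hS0 : 0 ≤ S := (abs_nonneg _).trans (hS 0)
  have hEh0 := Real.exp_pos (-η/2)
  have hEh1 : Real.exp (-η/2) ≤ 1 := by rw [Real.exp_le_one_iff]; linarith
  · -- lower
    set x' := x * Real.exp (-η) with hx'
    have hE3 : 1/3 ≤ Real.exp (-η) := by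
      have : Real.exp (-1) ≤ Real.exp (-η) := Real.exp_le_exp.2 (by linarith)
      have h3 : Real.exp 1 < 3 := Real.exp_one_lt_three
      have h4 : Real.exp (-1) * Real.exp 1 = 1 := by rw [← Real.exp_add]; simp
      have := Real.exp_pos (-1)
      nlinarith
    have hx'2 : 2 ≤ x' := by nlinarith
    have hx'x : x' ≤ x := by nlinarith
    have h2 := (V_diff x' x (by linarith) hx'x).2
    rw [explicit' Z x (by linarith), explicit' Z x' (by linarith)] at h2
    have hU := (U_diff (1/x') (1/x) (by positivity) (one_div_le_one_div_of_le (by linarith) hx'x)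
      (one_div_le_one_div_of_le (by norm_num) hx'2)).1
    have hlog : Real.log x' = Real.log x - η := by
      rw [hx', Real.log_mul hx0.ne' hE0.ne', Real.log_exp]; ring
    have hsq : Real.sqrt x' = Real.sqrt x * Real.exp (-η/2) := by
      rw [hx', Real.sqrt_mul hx0.le, ← hEh, Real.sqrt_mul_self hEh0.le]
    have hSS := (abs_le.1 (hS (Real.log x - η))).1
    rw [sub_add_cancel] at hSS
    rw [hlog, hsq] at h2
    -- multiply by x e^{-η}
    have h3 := mul_le_mul_of_nonneg_left h2 (show 0 ≤ x' by linarith)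
    have e1 : x' * (Chebyshev.psi x * (1/x' - 1/x)) = Chebyshev.psi x * (1 - Real.exp (-η)) := by
      have : x' ≠ 0 := by linarith
      field_simp
      rw [hx']; ring
    rw [e1] at h3
    set H1 := Z.H (Real.log x)
    set H0 := Z.H (Real.log x - η)
    have e2 : x' * (H1 / Real.sqrt x - H0 / (Real.sqrt x * Real.exp (-η/2))) =
       Real.sqrt x * Real.exp (-η/2) * (Real.exp (-η/2) * H1 - H0) := by
      have : x' = Real.sqrt x * Real.sqrt x * (Real.exp (-η/2) * Real.exp (-η/2)) := by
        rw [hEh, Real.mul_self_sqrt hx0.le]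
      rw [this]; field_simp
    have e3 : x' * (Real.log (2*π)/x - Real.log (2*π)/x') = - (Real.log (2*π) * (1 - Real.exp (-η))) := by
      have : x' ≠ 0 := by linarith
      rw [mul_sub, mul_div_cancel₀ _ this, hx']; field_simp; ring
    have h4 : x' * η - Real.log (2*π) * (1 - Real.exp (-η)) - Real.sqrt x * S ≤ Chebyshev.psi x * (1 - Real.exp (-η)) := by
      have b1 : - (Real.sqrt x * S) ≤ Real.sqrt x * Real.exp (-η/2) * (Real.exp (-η/2) * H1 - H0) := by
        have c1 := mul_le_mul_of_nonneg_left hSS hEh0.le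
        have c2 := mul_le_mul_of_nonneg_right hEh1 hS0
        have : - S ≤ Real.exp (-η/2) * (Real.exp (-η/2) * H1 - H0) := by linarith
        have := mul_le_mul_of_nonneg_left this hsx.le
        linarith
      have b2 : 0 ≤ x' * (U (1/x) - U (1/x')) := mul_nonneg (by linarith) hU
      refine le_trans ((le_of_eq ?_).trans (add_le_add (add_le_add (le_refl (x' * η)) (e3.symm.le)) (add_le_add b2 (b1.trans e2.symm.le)))) (le_trans (le_of_eq ?_) h3)
      · ring
      · ring
    have h5 : x * (1 - η/2) * (1 - Real.exp (-η)) ≤ x' * η := by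
      have : (1 - η/2) * (1 - Real.exp (-η)) ≤ Real.exp (-η) * η := by
        have c1 := mul_le_mul_of_nonneg_left a2 hE0.le
        have c2 : Real.exp (-η) * ((1 - η/2) * (Real.exp η - 1)) = (1-η/2) * (Real.exp (-η) * Real.exp η - Real.exp (-η)) := by ring
        rw [c2, hEE] at c1
        exact c1
      have := mul_le_mul_of_nonneg_left this hx0.le
      rw [hx']; linarith
    have h6 : Real.sqrt x * S = Real.sqrt x * (S / (1 - Real.exp (-η))) * (1 - Real.exp (-η)) := by
      field_simp
    have h7 : (x * (1 - η/2) - Real.log (2*π) - Real.sqrt x * (S / (1 - Real.exp (-η)))) * (1 - Real.exp (-η))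
       ≤ Chebyshev.psi x * (1 - Real.exp (-η)) := by
      rw [sub_mul, sub_mul, ← h6]; linarith
    have h8 := le_of_mul_le_mul_right h7 hd
    have : 0 ≤ x * (η^2/2) := by positivity
    linarith

lemma psi_upper (Z : ZeroData) (x η S : ℝ) (h0 : 0 < η) (h1 : η ≤ 1) (hx : 6 ≤ x)
    (hS : ∀ u, |Real.exp (-η/2) * Z.H (u + η) - Z.H u| ≤ S) :
    Chebyshev.psi x - x ≤ x * (η/2 + η^2/2) + Real.log (2*π) + 1 + Real.sqrt x * (S / (1 - Real.exp (-η))) := by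
  have hx0 : 0 < x := by linarith
  have hsx : 0 < Real.sqrt x := Real.sqrt_pos.2 hx0
  have hE1 : Real.exp (-η) < 1 := by rw [Real.exp_lt_one_iff]; linarith
  have hE0 : 0 < Real.exp (-η) := Real.exp_pos _
  have hd : 0 < 1 - Real.exp (-η) := by linarith
  have hEE : Real.exp (-η) * Real.exp η = 1 := by rw [← Real.exp_add]; simp
  have hEh : Real.exp (-η/2) * Real.exp (-η/2) = Real.exp (-η) := by rw [← Real.exp_add]; ring_nf
  have hl : 0 < Real.log (2*π) := Real.log_pos (by linarith [Real.pi_gt_three])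
  obtain ⟨a1, a2, a3⟩ := exp_aux η h0 h1
  have hS0 : 0 ≤ S := (abs_nonneg _).trans (hS 0)
  have hEh0 := Real.exp_pos (-η/2)
  have hEh1 : Real.exp (-η/2) ≤ 1 := by rw [Real.exp_le_one_iff]; linarith
  · -- upper
    set x' := x * Real.exp η with hx'
    have hE4 : 1 ≤ Real.exp η := Real.one_le_exp h0.le
    have hx'x : x ≤ x' := by nlinarith
    have h2 := (V_diff x x' (by linarith) hx'x).1
    rw [explicit' Z x (by linarith), explicit' Z x' (by linarith)] at h2
    have hU := (U_diff (1/x) (1/x') (by positivity) (one_div_le_one_div_of_le (by linarith) hx'x)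
      (one_div_le_one_div_of_le (by norm_num) (by linarith))).2
    have hinv : 1/x' = 1/x * Real.exp (-η) := by
      rw [hx', Real.exp_neg]; field_simp
    have hlog : Real.log x' = Real.log x + η := by
      rw [hx', Real.log_mul hx0.ne' (by positivity), Real.log_exp]
    have hsq : 1 / Real.sqrt x' = 1/Real.sqrt x * Real.exp (-η/2) := by
      have : Real.exp η = Real.exp (η/2) * Real.exp (η/2) := by rw [← Real.exp_add]; ring_nf
      rw [hx', Real.sqrt_mul hx0.le, this, Real.sqrt_mul_self (Real.exp_pos _).le, neg_div, Real.exp_neg]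
      field_simp
    have hSS := (abs_le.1 (hS (Real.log x))).2
    have d1 : ∀ a, a / Real.sqrt x' = a * (1/Real.sqrt x * Real.exp (-η/2)) := by
      intro a; rw [← hsq]; ring
    have d2 : ∀ a, a / x' = a * (1/x * Real.exp (-η)) := by
      intro a; rw [← hinv]; ring
    rw [hinv] at hU
    rw [hinv, hlog, d1, d2] at h2
    have h3 := mul_le_mul_of_nonneg_left h2 hx0.le
    have e1 : x * (Chebyshev.psi x * (1/x - 1/x * Real.exp (-η))) = Chebyshev.psi x * (1 - Real.exp (-η)) := by
      field_simp
    rw [e1] at h3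
    set H1 := Z.H (Real.log x + η)
    set H0 := Z.H (Real.log x)
    set U1 := U (1/x * Real.exp (-η))
    set U0 := U (1/x)
    have e2 : x * (H1 * (1/Real.sqrt x * Real.exp (-η/2)) - H0 / Real.sqrt x) =
       Real.sqrt x * (Real.exp (-η/2) * H1 - H0) := by
      have : x = Real.sqrt x * Real.sqrt x := by rw [Real.mul_self_sqrt hx0.le]
      nth_rewrite 1 [this]; field_simp
    have e3 : x * (Real.log (2*π) * (1/x * Real.exp (-η)) - Real.log (2*π)/x) = - (Real.log (2*π) * (1 - Real.exp (-η))) := by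
      field_simp; ring
    have e4 : x * (U1 - U0) ≤ 1 * (1 - Real.exp (-η)) := by
      have : x * ((1 / x - 1 / x * Real.exp (-η)) * (1 / x) ^ 2) = (1/x)^2 * (1 - Real.exp (-η)) := by
        field_simp
      have h6 := mul_le_mul_of_nonneg_left hU hx0.le
      rw [this] at h6
      refine h6.trans (mul_le_mul_of_nonneg_right ?_ hd.le)
      have : 1/x ≤ 1 := by rw [div_le_one hx0]; linarith
      exact pow_le_one₀ (by positivity) this
    have h4 : Chebyshev.psi x * (1 - Real.exp (-η)) ≤ x * η + 1 * (1 - Real.exp (-η)) + Real.sqrt x * S := by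
      have b1 : Real.sqrt x * (Real.exp (-η/2) * H1 - H0) ≤ Real.sqrt x * S := by
        apply mul_le_mul_of_nonneg_left hSS hsx.le
      have : -(Real.log (2*π) * (1 - Real.exp (-η))) ≤ 0 := by
        have : 0 ≤ Real.log (2*π) * (1 - Real.exp (-η)) := by positivity
        linarith
      refine h3.trans (le_trans (le_of_eq ?_) ((add_le_add (add_le_add (add_le_add (le_refl (x * η)) (e3.le.trans this)) e4) (e2.le.trans b1)).trans (le_of_eq ?_)))
      · ring
      · ring
    have h6 : Real.sqrt x * S = Real.sqrt x * (S / (1 - Real.exp (-η))) * (1 - Real.exp (-η)) := by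
      field_simp
    have h7 : Chebyshev.psi x * (1 - Real.exp (-η)) ≤ 
      (x * (1 + η/2 + η^2/2) + 1 + Real.sqrt x * (S / (1 - Real.exp (-η)))) * (1 - Real.exp (-η)) := by
      rw [add_mul, add_mul, ← h6]
      have := mul_le_mul_of_nonneg_left a1 hx0.le
      have e7 : x * ((1 - Real.exp (-η)) * (1 + η/2 + η^2/2)) = x * (1 + η/2 + η^2/2) * (1 - Real.exp (-η)) := by ring
      linarith
    have h8 := le_of_mul_le_mul_right h7 hd
    linarith

lemma psi_bound (Z : ZeroData) (x η S : ℝ) (h0 : 0 < η) (h1 : η ≤ 1) (hx : 6 ≤ x)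
    (hS : ∀ u, |Real.exp (-η/2) * Z.H (u + η) - Z.H u| ≤ S) :
    |Chebyshev.psi x - x| ≤ x * (η/2 + η^2/2) + Real.log (2*π) + 1 + Real.sqrt x * (S / (1 - Real.exp (-η))) :=
  abs_le.2 ⟨psi_lower Z x η S h0 h1 hx hS, psi_upper Z x η S h0 h1 hx hS⟩

end MT

namespace MT

lemma log_add_one_bounds (n : ℝ) (hn : 0 < n) :
    Real.log (n+1) - Real.log n ≤ (1/n + 1/(n+1))/2 ∧ 2/(2*n+1) ≤ Real.log (n+1) - Real.log n := by
  have h : Real.log (n+1) - Real.log n = Real.log (1 + 1/n) := by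
    rw [← Real.log_div (by positivity) hn.ne']; congr 1; field_simp
  constructor
  · -- log t ≤ (t - 1/t)/2 for t ≥ 1
    have key : MonotoneOn (fun t : ℝ => (t - t⁻¹)/2 - Real.log t) (Set.Ici 1) := by
      have hd : ∀ t ∈ Set.Ici (1:ℝ), HasDerivAt (fun t : ℝ => (t - t⁻¹)/2 - Real.log t) ((1 - (-(t^2)⁻¹))/2 - t⁻¹) t := by
        intro t ht
        have ht0 : t ≠ 0 := by have : (1:ℝ) ≤ t := ht
                               intro h; linarith
        exact (((hasDerivAt_id t).sub (hasDerivAt_inv ht0)).div_const 2).sub (Real.hasDerivAt_log ht0)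
      refine monotoneOn_of_deriv_nonneg (convex_Ici 1) (fun t ht => (hd t ht).continuousAt.continuousWithinAt)
          (fun t ht => (hd t (interior_subset ht)).differentiableAt.differentiableWithinAt) ?_
      intro t ht
      rw [(hd t (interior_subset ht)).deriv]
      rw [← inv_pow]
      nlinarith [sq_nonneg (1 - t⁻¹)]
    have := key (Set.mem_Ici.2 le_rfl) (Set.mem_Ici.2 (show (1:ℝ) ≤ 1 + 1/n by have : 0 ≤ 1/n := by positivity
                                                                               linarith)) (by have : 0 ≤ 1/n := by positivity
                                                                                              linarith)
    simp only [inv_one, sub_self, zero_div, Real.log_one] at this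
    rw [h]
    have e : (1 + 1/n - (1+1/n)⁻¹)/2 = (1/n + 1/(n+1))/2 := by
      field_simp; ring
    linarith
  · rw [h]
    have := Real.le_log_one_add_of_nonneg (x := 1/n) (by positivity)
    refine le_trans (le_of_eq ?_) this
    field_simp
    ring

lemma gamma_lower (N : ℕ) (hN : 1 ≤ N) : (harmonic N : ℝ) - Real.log N - 1/(2*N) ≤ Real.eulerMascheroniConstant := by
  have hmono : ∀ n : ℕ, N ≤ n → (harmonic N : ℝ) - Real.log N - 1/(2*N) ≤ (harmonic n : ℝ) - Real.log n - 1/(2*n) := by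
    intro n hn
    induction n, hn using Nat.le_induction with
    | base => exact le_rfl
    | succ n hn ih =>
      refine ih.trans ?_
      have hn0 : (0:ℝ) < n := by exact_mod_cast (by omega : 0 < n)
      have := (log_add_one_bounds n hn0).1
      rw [harmonic_succ]
      push_cast
      have e1 : ((n:ℝ)+1)⁻¹ = 1/((n:ℝ)+1) := by rw [one_div]
      have e2 : 1/(2*(n:ℝ)) = (1/n)/2 := by field_simp
      have e3 : 1/(2*((n:ℝ)+1)) = (1/(n+1))/2 := by field_simp
      rw [e1, e2, e3]; linarith
  refine ge_of_tendsto Real.tendsto_harmonic_sub_log ?_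
  filter_upwards [Filter.eventually_ge_atTop N] with n hn
  refine (hmono n hn).trans ?_
  have : 0 ≤ 1/(2*(n:ℝ)) := by positivity
  linarith

lemma gamma_upper (N : ℕ) (hN : 1 ≤ N) : Real.eulerMascheroniConstant ≤ (harmonic N : ℝ) - Real.log (N+1/2) := by
  have hmono : ∀ n : ℕ, N ≤ n → (harmonic n : ℝ) - Real.log (n+1/2) ≤ (harmonic N : ℝ) - Real.log (N+1/2) := by
    intro n hn
    induction n, hn using Nat.le_induction with
    | base => exact le_rfl
    | succ n hn ih =>
      refine le_trans ?_ ih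
      have := (log_add_one_bounds ((n:ℝ)+1/2) (by positivity)).2
      rw [harmonic_succ]
      push_cast
      have e1 : ((n:ℝ)+1)⁻¹ = 2/(2*((n:ℝ)+1/2)+1) := by field_simp; ring
      rw [e1, show (n:ℝ)+1+1/2 = n+1/2+1 by ring]; linarith
  have ht : Filter.Tendsto (fun n : ℕ => (harmonic n : ℝ) - Real.log n - 1/(2*n)) Filter.atTop (nhds (Real.eulerMascheroniConstant - 0)) := by
    refine Real.tendsto_harmonic_sub_log.sub ?_
    have : Filter.Tendsto (fun n : ℕ => (1/2) * (1/(n:ℝ))) Filter.atTop (nhds ((1/2)*0)) :=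
      tendsto_one_div_atTop_nhds_zero_nat.const_mul _
    rw [mul_zero] at this
    refine this.congr fun n => ?_
    rw [one_div_mul_one_div]
  rw [sub_zero] at ht
  refine le_of_tendsto ht ?_
  filter_upwards [Filter.eventually_ge_atTop N, Filter.eventually_ge_atTop 1] with n hn hn1
  refine le_trans ?_ (hmono n hn)
  have hn0 : (0:ℝ) < n := by exact_mod_cast hn1
  have : Real.log (n+1/2) - Real.log n ≤ 1/(2*n) := by
    rw [← Real.log_div (by positivity) hn0.ne']
    refine (Real.log_le_sub_one_of_pos (by positivity)).trans (le_of_eq ?_)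
    field_simp; ring
  linarith

lemma harm64 : 4.7438909 ≤ (harmonic 64 : ℝ) ∧ (harmonic 64 : ℝ) ≤ 4.7438910 := by
  have h : (47438909/10000000 : ℚ) ≤ harmonic 64 ∧ harmonic 64 ≤ 47438910/10000000 := by
    constructor <;> norm_num [harmonic, Finset.sum_range_succ]
  constructor
  · have := h.1
    have : ((47438909/10000000 : ℚ) : ℝ) ≤ (harmonic 64 : ℝ) := by exact_mod_cast this
    push_cast at this; refine le_trans ?_ this; norm_num
  · have := h.2
    have : (harmonic 64 : ℝ) ≤ ((47438910/10000000 : ℚ) : ℝ) := by exact_mod_cast this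
    push_cast at this; refine le_trans this ?_; norm_num

lemma gamma_num : 0.577195 ≤ Real.eulerMascheroniConstant ∧ Real.eulerMascheroniConstant ≤ 0.577227 := by
  have h1 := gamma_lower 64 (by norm_num)
  have h2 := gamma_upper 64 (by norm_num)
  have h3 := harm64
  have l1 := Real.log_two_gt_d9
  have l2 := Real.log_two_lt_d9
  have e : Real.log 64 = 6 * Real.log 2 := by
    rw [show (64:ℝ) = 2^6 by norm_num, Real.log_pow]; norm_num
  push_cast at h1 h2
  have e2 : Real.log (64 + 1/2) = 6 * Real.log 2 + Real.log (1 + 1/128) := by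
    rw [← e, ← Real.log_mul (by norm_num) (by norm_num)]; norm_num
  have e3 := Real.le_log_one_add_of_nonneg (x := 1/128) (by norm_num)
  norm_num at e3
  rw [e2] at h2
  rw [e] at h1
  constructor
  · norm_num at *; linarith
  · norm_num at *; linarith

lemma log_pi_lower : 1.1446 ≤ Real.log π := by
  rw [Real.le_log_iff_exp_le Real.pi_pos]
  have h := Real.exp_bound' (x := 0.1446) (by norm_num) (by norm_num) (n := 6) (by norm_num)
  have h1 := Real.exp_one_lt_d9
  have h2 := Real.pi_gt_d4
  rw [show (1.1446:ℝ) = 1 + 0.1446 by norm_num, Real.exp_add]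
  norm_num [Finset.sum_range_succ, Nat.factorial] at h
  have := Real.exp_pos 1
  have := Real.exp_pos 0.1446
  norm_num at *
  nlinarith

lemma F1_le : 2 * F 1 ≤ 0.0464 := by
  rw [F_one]
  have := gamma_num.2
  have := log_pi_lower
  have := Real.log_two_gt_d9
  norm_num at *
  linarith

lemma F1_nonneg (Z : ZeroData) : 0 ≤ 2 * F 1 := Z.a_sum.nonneg Z.a_nonneg

lemma log_two_pi : 1.8 ≤ Real.log (2*π) ∧ Real.log (2*π) ≤ 2 := by
  constructor
  · rw [Real.log_mul (by norm_num) Real.pi_pos.ne']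
    have := log_pi_lower
    have := Real.log_two_gt_d9
    norm_num at *
    linarith
  · rw [Real.log_le_iff_le_exp (by positivity)]
    have h := Real.exp_one_gt_d9
    have : Real.exp 2 = Real.exp 1 * Real.exp 1 := by rw [← Real.exp_add]; norm_num
    have := Real.pi_lt_d4
    norm_num at *
    nlinarith

lemma psi_reg1 (Z : ZeroData) (x η : ℝ) (h0 : 0 < η) (h1 : η ≤ 1) (hx : 6 ≤ x) :
    |Chebyshev.psi x - x| ≤ x * (η/2 + η^2/2) + 3 + Real.sqrt x * (0.0464 * (2/η+1)) := by
  have hF0 := F1_nonneg Z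
  have hE := Real.exp_pos (-η/2)
  have h := psi_bound Z x η (2 * F 1 * (1 + Real.exp (-η/2))) h0 h1 hx (by
    intro u
    have a1 := Z.H_le (u + η)
    have a2 := Z.H_le u
    calc _ ≤ |Real.exp (-η/2) * Z.H (u + η)| + |Z.H u| := abs_sub _ _
      _ ≤ Real.exp (-η/2) * (2 * F 1) + 2 * F 1 := by
        rw [abs_mul, abs_of_pos hE]; gcongr
      _ = _ := by ring)
  refine h.trans ?_
  have hl := log_two_pi.2
  obtain ⟨-, -, a3⟩ := exp_aux (η/2) (by linarith) (by linarith)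
  rw [← neg_div] at a3
  have hE1 : Real.exp (-η/2) < 1 := by rw [Real.exp_lt_one_iff]; linarith
  have hEh : Real.exp (-η) = Real.exp (-η/2) * Real.exp (-η/2) := by rw [← Real.exp_add]; ring_nf
  have : 2 * F 1 * (1 + Real.exp (-η/2)) / (1 - Real.exp (-η)) ≤ 0.0464 * (2/η+1) := by
    rw [hEh]
    have hd : 0 < 1 - Real.exp (-η/2) := by linarith
    have e : 2 * F 1 * (1 + Real.exp (-η/2)) / (1 - Real.exp (-η/2) * Real.exp (-η/2)) = 2 * F 1 * (1 / (1 - Real.exp (-η/2))) := by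
      rw [show 1 - Real.exp (-η/2) * Real.exp (-η/2) = (1 - Real.exp (-η/2)) * (1 + Real.exp (-η/2)) by ring]
      field_simp
    rw [e]
    apply mul_le_mul F1_le _ (by positivity) (by norm_num)
    rw [div_le_iff₀ hd]
    have : (2/η+1) * (1 - Real.exp (-η/2)) = ((1 - Real.exp (-η/2)) * (1 + η/2)) * (2/η) := by
      field_simp
    rw [this]
    have := mul_le_mul_of_nonneg_right a3 (show 0 ≤ 2/η by positivity)
    refine le_trans (le_of_eq ?_) this
    field_simp
  have := mul_le_mul_of_nonneg_left this (Real.sqrt_nonneg x)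
  linarith

end MT

namespace MT

lemma zeta_logDeriv_nonpos (s : ℝ) (hs : 1 < s) : (logDeriv riemannZeta (s:ℂ)).re ≤ 0 := by
  have hs1 : 1 < ((s:ℝ):ℂ).re := by
    rw [Complex.ofReal_re]; exact hs
  have h1 := (ArithmeticFunction.LSeriesSummable_vonMangoldt hs1).hasSum
  have h2 := ArithmeticFunction.LSeries_vonMangoldt_eq_deriv_riemannZeta_div hs1
  unfold LSeries at h2
  rw [h2] at h1
  have h3 := Complex.hasSum_re h1
  have h4 : 0 ≤ (-deriv riemannZeta (s:ℂ) / riemannZeta (s:ℂ)).re := by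
    refine h3.nonneg fun n => ?_
    rcases Nat.eq_zero_or_pos n with rfl | hp
    · simp
    rw [LSeries.term_of_ne_zero hp.ne']
    have : (n:ℂ) ^ (s:ℂ) = (((n:ℝ)^s : ℝ) : ℂ) := by
      rw [Complex.ofReal_cpow (by positivity)]; simp
    rw [this, ← Complex.ofReal_div, Complex.ofReal_re]
    have := ArithmeticFunction.vonMangoldt_nonneg (n := n)
    positivity
  rw [logDeriv_apply]
  rw [neg_div, Complex.neg_re] at h4
  linarith

lemma F_le (b : ℝ) (hb : 16 ≤ b) : F (1/2 + b) ≤ Real.log b / 2 - 3/4 := by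
  rw [F_formula _ (by linarith)]
  have h1 := zeta_logDeriv_nonpos (1/2+b) (by linarith)
  have h2 := dig_le ((1/2+b)/2+1) (by linarith)
  have h3 : Real.log ((1/2+b)/2+1) ≤ Real.log b - Real.log 2 + 5/(2*b) := by
    have e : (1/2+b)/2+1 = b / 2 * (1 + 5/(2*b)) := by field_simp; ring
    have hp : 0 < 5/(2*b) := by positivity
    rw [e, Real.log_mul (by positivity) (by positivity), Real.log_div (by positivity) (by norm_num)]
    have := Real.log_le_sub_one_of_pos (show 0 < 1 + 5/(2*b) by positivity)
    linarith
  have h4 : 5/(2*b) ≤ 5/32 := by rw [div_le_div_iff₀ (by positivity) (by norm_num)]; linarith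
  have h5 : 1/(1/2+b-1) ≤ 2/31 := by rw [div_le_div_iff₀ (by linarith) (by norm_num)]; linarith
  have h6 := log_two_pi.1
  rw [Real.log_mul (by norm_num) Real.pi_pos.ne'] at h6
  norm_num at *
  linarith

lemma H_diff_term (g u η : ℝ) (h0 : 0 < η) :
    |Real.exp (-η/2) * Real.cos (g * (u + η)) - Real.cos (g * u)| ≤ 2 ∧
    |Real.exp (-η/2) * Real.cos (g * (u + η)) - Real.cos (g * u)| ≤ η * Real.sqrt (1/4 + g^2) := by
  constructor
  · have hE := Real.exp_pos (-η/2)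
    have hE1 : Real.exp (-η/2) ≤ 1 := by rw [Real.exp_le_one_iff]; linarith
    calc _ ≤ |Real.exp (-η/2) * Real.cos (g * (u + η))| + |Real.cos (g * u)| := abs_sub _ _
      _ ≤ 1 * 1 + 1 := by
        rw [abs_mul, abs_of_pos hE]
        gcongr
        · exact Real.abs_cos_le_one _
        · exact Real.abs_cos_le_one _
      _ = 2 := by norm_num
  · have hd : ∀ t ∈ Set.Icc (0:ℝ) η, HasDerivWithinAt (fun t : ℝ => Real.exp (-t/2) * Real.cos (g * (u + t)))
        (Real.exp (-t/2) * (-1/2) * Real.cos (g*(u+t)) + Real.exp (-t/2) * (-Real.sin (g*(u+t)) * g)) (Set.Icc 0 η) t := by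
      intro t _
      have a1 : HasDerivAt (fun t : ℝ => Real.exp (-t/2)) (Real.exp (-t/2) * (-1/2)) t :=
        ((hasDerivAt_neg t).div_const 2).exp
      have a2 : HasDerivAt (fun t : ℝ => Real.cos (g * (u + t))) (-Real.sin (g*(u+t)) * g) t := by
        have : HasDerivAt (fun t : ℝ => g * (u + t)) (g * 1) t := ((hasDerivAt_id t).const_add u).const_mul g
        rw [mul_one] at this
        exact this.cos
      exact (a1.mul a2).hasDerivWithinAt
    have := Convex.norm_image_sub_le_of_norm_hasDerivWithin_le (C := Real.sqrt (1/4+g^2)) hd (fun t ht => ?_)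
      (convex_Icc 0 η) (Set.left_mem_Icc.2 h0.le) (Set.right_mem_Icc.2 h0.le)
    · simp only [sub_zero, neg_zero, zero_div, Real.exp_zero, one_mul, add_zero] at this
      rw [Real.norm_eq_abs, Real.norm_of_nonneg h0.le] at this
      linarith
    · have hE := Real.exp_pos (-t/2)
      have hE1 : Real.exp (-t/2) ≤ 1 := by rw [Real.exp_le_one_iff]; linarith [ht.1]
      rw [show Real.exp (-t/2) * (-1/2) * Real.cos (g*(u+t)) + Real.exp (-t/2) * (-Real.sin (g*(u+t)) * g) =
        Real.exp (-t/2) * (-1/2 * Real.cos (g*(u+t)) + (-Real.sin (g*(u+t)) * g)) by ring, norm_mul,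
        Real.norm_of_nonneg hE.le]
      refine (mul_le_of_le_one_left (norm_nonneg _) hE1).trans ?_
      apply Real.abs_le_sqrt
      have := Real.sin_sq_add_cos_sq (g*(u+t))
      nlinarith [sq_nonneg (1/2 * Real.sin (g*(u+t)) - g * Real.cos (g*(u+t)))]

/-- pointwise comparison -/
lemma scale_aux (r g : ℝ) (hr : 0 < r) (hg : g^2 ≤ r^2) (J : ℕ) (h : r < 16^(J+1)) :
    1/r ≤ 16/r^2 + 17/8 * ∑ k ∈ range (J+1), ((16:ℝ)^(k+1) / (((16:ℝ)^(k+1))^2 + g^2)) := by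
  have hnn : ∀ K : ℕ, 0 ≤ ∑ k ∈ range K, ((16:ℝ)^(k+1) / (((16:ℝ)^(k+1))^2 + g^2)) :=
    fun K => Finset.sum_nonneg fun k _ => by positivity
  induction J with
  | zero =>
    have h1 : 1/r ≤ 16/r^2 := by
      rw [div_le_div_iff₀ hr (by positivity)]; norm_num at h; nlinarith
    have := hnn (0+1)
    linarith
  | succ J ih =>
    by_cases hr2 : r < 16^(J+1)
    · have := ih hr2
      rw [Finset.sum_range_succ]
      have : 0 ≤ ((16:ℝ)^(J+1+1) / (((16:ℝ)^(J+1+1))^2 + g^2)) := by positivity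
      linarith
    · rw [Finset.sum_range_succ, Finset.sum_range_succ]
      have := hnn J
      push Not at hr2
      set b := (16:ℝ)^(J+1) with hb
      have hb0 : 0 < b := by positivity
      have hb2 : (16:ℝ)^(J+1+1) = 16 * b := by rw [hb, pow_succ _ (J+1)]; ring
      rw [hb2] at h ⊢
      have k1 : b/(b^2+r^2) ≤ b/(b^2+g^2) := by gcongr
      have k2 : 16*b/((16*b)^2+r^2) ≤ 16*b/((16*b)^2+g^2) := by gcongr
      have k3 : 8/17 * (1/r) ≤ b/(b^2+r^2) + 16*b/((16*b)^2+r^2) := by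
        rw [div_add_div _ _ (by positivity) (by positivity), mul_one_div, div_div, div_le_div_iff₀ (by positivity) (by positivity)]
        -- 8 (b²+r²)(256b²+r²) ≤ 17 r * (17 b)(16 b² + r²)  
        have e1 : 0 ≤ (r - b) * (16*b - r) := mul_nonneg (by linarith) (by linarith)
        have e2 : 0 ≤ r^2 + 16*b^2 - r * b := by nlinarith [sq_nonneg (r-b)]
        nlinarith [mul_nonneg e1 e2, mul_nonneg e1 (mul_pos hr hb0).le, mul_nonneg e1 (sq_nonneg (r-4*b)), mul_nonneg e1 (sq_nonneg r), mul_nonneg e1 (sq_nonneg b), sq_nonneg (r^2 - 16*b^2), sq_nonneg ((r-4*b)^2)]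
      have : 0 ≤ 16/r^2 := by positivity
      linarith

lemma reg2_S (Z : ZeroData) (J : ℕ) (u : ℝ) :
    |Real.exp (-(32/17/(16:ℝ)^(J+1))/2) * Z.H (u + 32/17/(16:ℝ)^(J+1)) - Z.H u| ≤
      32/17/(16:ℝ)^(J+1) * (16 * (2 * F 1) + 17/8 * ∑ k ∈ range (J+1), F (1/2 + (16:ℝ)^(k+1))) := by
  set b := (16:ℝ)^(J+1) with hb
  have hb0 : 0 < b := by positivity
  set η := 32/17/b with hη
  have h0 : 0 < η := by positivity
  have h1 := ((Z.H_hasSum (u+η)).mul_left (Real.exp (-η/2))).sub (Z.H_hasSum u)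
  have h2 : HasSum (fun i => η * (16 * Z.a i + 17/8 * ∑ k ∈ range (J+1), Z.m i * ((16:ℝ)^(k+1) / (((16:ℝ)^(k+1))^2 + Z.γ i^2))))
      (η * (16 * (2 * F 1) + 17/8 * ∑ k ∈ range (J+1), F (1/2 + (16:ℝ)^(k+1)))) := by
    refine ((Z.a_sum.mul_left 16).add (HasSum.mul_left (17/8) ?_)).mul_left η
    exact hasSum_sum fun k _ => Z.hs _ (by positivity)
  have := tsum_of_norm_bounded h2 (f := fun i => Real.exp (-η/2) * (Z.a i * Real.cos (Z.γ i * (u+η))) - Z.a i * Real.cos (Z.γ i * u)) ?_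
  · rw [h1.tsum_eq] at this
    exact this
  · intro i
    rw [show Real.exp (-η/2) * (Z.a i * Real.cos (Z.γ i * (u+η))) - Z.a i * Real.cos (Z.γ i * u) =
      Z.a i * (Real.exp (-η/2) * Real.cos (Z.γ i * (u+η)) - Real.cos (Z.γ i * u)) by ring, norm_mul,
      Real.norm_of_nonneg (Z.a_nonneg i), Real.norm_eq_abs, ← Finset.mul_sum]
    obtain ⟨t1, t2⟩ := H_diff_term (Z.γ i) u η h0
    set g := Z.γ i
    set r := Real.sqrt (1/4+g^2) with hr
    have hr0 : 0 < r := Real.sqrt_pos.2 (by positivity)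
    have hr2 : r^2 = 1/4 + g^2 := Real.sq_sqrt (by positivity)
    have hgr : g^2 ≤ r^2 := by rw [hr2]; linarith
    have hm := Z.hm i
    have ha : Z.a i = Z.m i / r^2 := by rw [hr2]; rfl
    rw [ha]
    have hfac : ∀ T : ℝ, η * (16 * (Z.m i / r^2) + 17/8 * (Z.m i * T)) = Z.m i * (η * (16/r^2 + 17/8 * T)) := by
      intro T; ring
    rw [hfac, div_mul_eq_mul_div, mul_div_assoc]
    refine mul_le_mul_of_nonneg_left ?_ hm
    by_cases hlt : r < b
    · have := scale_aux r g hr0 hgr J hlt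
      refine le_trans ?_ (mul_le_mul_of_nonneg_left this h0.le)
      rw [div_le_iff₀ (by positivity)]
      refine t2.trans (le_of_eq ?_)
      field_simp
    · push Not at hlt
      rw [Finset.sum_range_succ]
      have n1 : 0 ≤ ∑ k ∈ range J, ((16:ℝ)^(k+1) / (((16:ℝ)^(k+1))^2 + g^2)) :=
        Finset.sum_nonneg fun k _ => by positivity
      have n2 : 0 ≤ 16/r^2 := by positivity
      rw [← hb]
      have n3 : 2/r^2 ≤ η * (17/8 * (b/(b^2+g^2))) := by
        have : η * (17/8 * (b/(b^2+g^2))) = 4/(b^2+g^2) := by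
          rw [hη]; field_simp; norm_num
        rw [this, div_le_div_iff₀ (by positivity) (by positivity)]
        have : b^2 ≤ r^2 := by gcongr
        linarith
      have n4 : |Real.exp (-η/2) * Real.cos (g * (u+η)) - Real.cos (g * u)| / r^2 ≤ 2/r^2 := by gcongr
      refine (n4.trans n3).trans (mul_le_mul_of_nonneg_left ?_ h0.le)
      linarith

lemma sumF_le (J : ℕ) : ∑ k ∈ range (J+1), F (1/2 + (16:ℝ)^(k+1)) ≤
    ((J:ℝ)+1) * ((J:ℝ)+2) * Real.log 2 - 3/4 * ((J:ℝ)+1) := by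
  have hl : Real.log 16 = 4 * Real.log 2 := by
    rw [show (16:ℝ) = 2^4 by norm_num, Real.log_pow]; norm_num
  have hk : ∀ k : ℕ, F (1/2 + (16:ℝ)^(k+1)) ≤ 2 * ((k:ℝ)+1) * Real.log 2 - 3/4 := by
    intro k
    refine (F_le _ (le_self_pow₀ (by norm_num) (by omega))).trans ?_
    rw [Real.log_pow, hl]; push_cast; linarith
  induction J with
  | zero => have := hk 0; simp at this ⊢; linarith
  | succ J ih =>
    rw [Finset.sum_range_succ]
    have := hk (J+1)
    push_cast at *
    linarith

lemma M_aux (ℓ κ t j : ℝ) (k1 : 0.6931471 < κ) (k2 : κ < 0.6931472) (hx : 15 ≤ ℓ)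
    (htκ : t * (8*κ) = ℓ + 4*κ) (hj0 : 1 ≤ j) (hjt : j ≤ t) :
    j * (j+1) * κ - 3/4*j ≤ (0.180338 * ℓ + 0.5) * (0.125*ℓ + 0.289722) := by
  norm_num at k1 k2
  have q1 : j * (j+1) * κ - 3/4*j ≤ t * (t+1) * κ - 3/4 * t := by
    have h1 : 0 ≤ (t - j) * ((t + j + 1) * κ - 3/4) := by
      apply mul_nonneg (by linarith)
      have : 3 * κ ≤ (t+j+1) * κ := mul_le_mul_of_nonneg_right (by linarith) (by linarith)
      linarith
    linarith
  have q2 : t * (t+1) * κ - 3/4 * t = t * (ℓ/8 + 3/2*κ - 3/4) := by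
    have : t * κ = ℓ/8 + κ/2 := by linarith
    linear_combination (t) * this
  have q3 : t ≤ 0.180338 * ℓ + 0.5 := by
    have h1 : t * (8*κ) ≤ (0.180338 * ℓ + 0.5) * (8*κ) := by
      rw [htκ]; norm_num; nlinarith
    exact le_of_mul_le_mul_right h1 (by linarith)
  have q4 : t * (ℓ/8 + 3/2*κ - 3/4) ≤ (0.180338 * ℓ + 0.5) * (0.125*ℓ + 0.289722) := by
    apply mul_le_mul q3
    · norm_num; linarith
    · linarith
    · norm_num; linarith
  linarith

lemma exp_75 : (1700:ℝ) ≤ Real.exp 7.5 := by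
  have h2 : Real.exp 7.5 = (Real.exp 1)^7 * Real.exp 0.5 := by
    rw [← Real.exp_nat_mul, ← Real.exp_add]; norm_num
  have h3 : (1.625:ℝ) ≤ Real.exp 0.5 := by
    have := Real.quadratic_le_exp_of_nonneg (x := 0.5) (by norm_num)
    refine le_trans ?_ this; norm_num
  have h4 : (2.718:ℝ)^7 ≤ (Real.exp 1)^7 := by
    gcongr; have := Real.exp_one_gt_d9; norm_num at *; linarith
  have h5 : (2.718:ℝ)^7 * 1.625 ≤ (Real.exp 1)^7 * Real.exp 0.5 := by gcongr
  rw [h2]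
  refine le_trans ?_ h5
  norm_num

lemma psi_reg2 (Z : ZeroData) (x : ℝ) (hx0 : 0 < x) (hx : 15 ≤ Real.log x) :
    |Chebyshev.psi x - x| ≤ Real.sqrt x * (0.0485 * (Real.log x)^2 + 0.247 * Real.log x + 4.9) := by
  set ℓ := Real.log x with hℓ
  set κ := Real.log 2 with hκ
  have k1 : 0.6931471 < κ := by have := Real.log_two_gt_d9; norm_num at *; linarith
  have k2 : κ < 0.6931472 := by have := Real.log_two_lt_d9; norm_num at *; linarith
  have hl : Real.log 16 = 4 * κ := by
    rw [show (16:ℝ) = 2^4 by norm_num, Real.log_pow, ← hκ]; norm_num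
  set t := ℓ/(8*κ) + 1/2 with ht
  have hκ0 : 0 < κ := by linarith
  have htκ : t * (8*κ) = ℓ + 4*κ := by rw [ht]; field_simp; ring
  have ht1 : 1 ≤ t := by
    have : (1:ℝ) * (8*κ) ≤ t * (8*κ) := by rw [htκ]; linarith
    exact le_of_mul_le_mul_right this (by linarith)
  obtain ⟨J, hJ⟩ : ∃ J : ℕ, ⌊t⌋₊ = J + 1 := ⟨⌊t⌋₊ - 1, by have := (Nat.one_le_floor_iff t).2 ht1; omega⟩
  have hJ1 : (J:ℝ)+1 ≤ t := by
    have := Nat.floor_le (show 0 ≤ t by linarith); rw [hJ] at this; push_cast at this; exact this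
  have hJ2 : t < (J:ℝ)+2 := by
    have := Nat.lt_floor_add_one t; rw [hJ] at this; push_cast at this; linarith
  set b := (16:ℝ)^(J+1) with hb
  have hb0 : 0 < b := by positivity
  set s := Real.sqrt x with hs
  have hs0 : 0 < s := Real.sqrt_pos.2 hx0
  have hss : s * s = x := Real.mul_self_sqrt hx0.le
  have hls : Real.log s = ℓ/2 := by rw [hs, Real.log_sqrt hx0.le]
  have hsb : s ≤ 4 * b := by
    rw [← Real.log_le_log_iff hs0 (by positivity), hls, Real.log_mul (by norm_num) hb0.ne', hb, Real.log_pow, hl,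
      show (4:ℝ) = 2^2 by norm_num, Real.log_pow]
    push_cast
    have := mul_lt_mul_of_pos_right hJ2 (show 0 < 8*κ by linarith)
    rw [htκ] at this
    rw [← hκ]
    linarith
  have hsbig : 1700 ≤ s := by
    have : s = Real.exp (ℓ/2) := by rw [← hls, Real.exp_log hs0]
    rw [this]
    exact exp_75.trans (Real.exp_le_exp.2 (by norm_num; linarith))
  set η := 32/17/b with hη
  have h0 : 0 < η := by positivity
  have hηs : η * s ≤ 128/17 := by
    rw [hη, div_mul_eq_mul_div, div_le_iff₀ hb0]; nlinarith
  have hη1 : η ≤ 0.00443 := by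
    have : η * 1700 ≤ 128/17 := (mul_le_mul_of_nonneg_left hsbig h0.le).trans hηs
    norm_num at this ⊢; linarith
  set M := 16 * (2 * F 1) + 17/8 * ∑ k ∈ range (J+1), F (1/2 + (16:ℝ)^(k+1)) with hM
  have hb1 := psi_bound Z x η (η * M) h0 (by norm_num at hη1; linarith) (by nlinarith) (fun u => reg2_S Z J u)
  have hM0 : 0 ≤ M := by
    have := (abs_nonneg _).trans (reg2_S Z J 0)
    exact le_of_mul_le_mul_left (by rw [mul_zero]; exact this) h0
  obtain ⟨-, -, a3⟩ := exp_aux η h0 (by norm_num at hη1; linarith)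
  have hd : 0 < 1 - Real.exp (-η) := by
    have : Real.exp (-η) < 1 := by rw [Real.exp_lt_one_iff]; linarith
    linarith
  have hfr : η * M / (1 - Real.exp (-η)) ≤ (1 + η) * M := by
    rw [div_le_iff₀ hd]
    have := mul_le_mul_of_nonneg_right a3 hM0
    linarith
  have hMle : M ≤ 0.047905 * ℓ^2 + 0.24386 * ℓ + 1.0505 := by
    have hF := F1_le
    have hS := sumF_le J
    rw [← hκ] at hS
    set j := (J:ℝ)+1 with hj
    have hj2 : (J:ℝ)+2 = j + 1 := by rw [hj]; ring
    rw [hj2] at hS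
    have hj0 : 1 ≤ j := by rw [hj]; have : (0:ℝ) ≤ J := by positivity
                           linarith
    have q5 := hS.trans (M_aux ℓ κ t j k1 k2 hx htκ hj0 hJ1)
    have hl2 : 0 ≤ ℓ^2 := sq_nonneg _
    rw [hM]
    norm_num at hF q5 ⊢
    linarith
  have hX : x * (η/2 + η^2/2) ≤ s * 3.782 := by
    rw [← hss]
    have e : s * s * (η/2+η^2/2) = s * ((η*s)/2 * (1 + η)) := by ring
    rw [e]
    apply mul_le_mul_of_nonneg_left _ hs0.le
    have : η * s/2 * (1+η) ≤ 128/17/2 * (1+0.00443) := by gcongr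
    refine this.trans (by norm_num)
  have hlog := log_two_pi.2
  have h3 : Real.log (2*π) + 1 ≤ s * 0.002 := by norm_num; linarith
  have hfin : η * M / (1 - Real.exp (-η)) ≤ 1.00443 * (0.047905 * ℓ^2 + 0.24386 * ℓ + 1.0505) := by
    refine hfr.trans (mul_le_mul ?_ hMle hM0 (by norm_num))
    norm_num at hη1 ⊢; linarith
  have h5 := mul_le_mul_of_nonneg_left hfin hs0.le
  have hgoal : s * 3.782 + s * 0.002 + s * (1.00443 * (0.047905 * ℓ^2 + 0.24386 * ℓ + 1.0505)) ≤
      s * (0.0485 * ℓ^2 + 0.247 * ℓ + 4.9) := by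
    rw [← mul_add, ← mul_add]
    apply mul_le_mul_of_nonneg_left _ hs0.le
    have hl2 : 0 ≤ ℓ^2 := sq_nonneg _
    norm_num
    linarith
  linarith

end MT

namespace MT

noncomputable def A (x : ℝ) : ℝ := ∑ n ∈ Finset.Ioc 0 ⌊x⌋₊, ArithmeticFunction.vonMangoldt n * (1 / ((n:ℝ) * Real.log n))
noncomputable def gg (x : ℝ) : ℝ := 1 / Real.log x + 1 / (Real.log x)^2
noncomputable def c1 : ℝ := Real.eulerMascheroniConstant + 2 - Real.log 2 - U 0
noncomputable def rr (x : ℝ) : ℝ := V x - Real.log x + c1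
noncomputable def rho (x : ℝ) : ℝ := 0.0464 / Real.sqrt x + 2 / x
noncomputable def DD (x : ℝ) : ℝ := A x - Real.log (Real.log x) - (Chebyshev.psi x - x) / (x * Real.log x) - rr x * gg x

lemma rr_le (Z : ZeroData) (x : ℝ) (hx : 2 ≤ x) : |rr x| ≤ rho x := by
  have hx0 : 0 < x := by linarith
  rw [rr, explicit' Z x (by linarith), c1]
  have hU := U_diff (1/x) 0 le_rfl (by positivity) (one_div_le_one_div_of_le (by norm_num) hx)
  have hs : 0 < Real.sqrt x := Real.sqrt_pos.2 hx0
  have hH := (Z.H_le (Real.log x)).trans F1_le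
  have hH2 : |Z.H (Real.log x) / Real.sqrt x| ≤ 0.0464 / Real.sqrt x := by
    rw [abs_div, abs_of_pos hs]; gcongr
  have hl := log_two_pi
  have h1 : Real.log (2*π)/x ≤ 2/x := by gcongr; exact hl.2
  have h2 : 0 ≤ Real.log (2*π)/x := div_nonneg (by norm_num at hl; linarith) hx0.le
  have h3 : (1/x - 0) * (1/x)^2 ≤ 2/x := by
    have : (1/x)^2 ≤ 1 := pow_le_one₀ (by positivity) (by rw [div_le_one hx0]; linarith)
    have h5 : 0 < 1/x := by positivity
    have h6 : 2/x = 2 * (1/x) := by ring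
    rw [h6]; nlinarith
  rw [rho]
  obtain ⟨h7, h8⟩ := abs_le.1 hH2
  rw [abs_le]
  constructor <;> linarith [hU.1, hU.2]

lemma rho_anti (x y : ℝ) (hx : 0 < x) (h : x ≤ y) : rho y ≤ rho x := by
  unfold rho
  have : 0 < Real.sqrt x := Real.sqrt_pos.2 hx
  have : Real.sqrt x ≤ Real.sqrt y := Real.sqrt_le_sqrt h
  gcongr

lemma rho_pos (x : ℝ) (hx : 0 < x) : 0 < rho x := by
  unfold rho
  have : 0 < Real.sqrt x := Real.sqrt_pos.2 hx
  positivity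

lemma V_contOn : ContinuousOn V (Set.Ioi 0) := by
  have h : ContinuousOn (fun x : ℝ => 1/x) (Set.Ioi 0) := by
    refine ContinuousOn.div continuousOn_const continuousOn_id (fun x hx => ne_of_gt hx)
  have := V_cont.comp h (fun x hx => by have : (0:ℝ) < x := hx
                                        exact Set.mem_Ioi.2 (by positivity))
  refine this.congr fun x hx => ?_
  simp

lemma log_pos2 {x : ℝ} (hx : 2 ≤ x) : 0 < Real.log x := Real.log_pos (by linarith)


lemma xlogx_mono {a b : ℝ} (ha : 2 ≤ a) (h : a ≤ b) : a * Real.log a ≤ b * Real.log b :=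
  mul_le_mul h (Real.log_le_log (by linarith) h) (log_pos2 ha).le (by linarith)

lemma Apsi_key (N : ℕ) (t : ℝ) (ht : 2 ≤ t) (htN : t < N) :
    A t - Chebyshev.psi t / (t * Real.log t) = ∑ n ∈ Finset.Ioc 0 N, ArithmeticFunction.vonMangoldt n * max 0 (1 / ((n:ℝ) * Real.log n) - 1/(t * Real.log t)) := by
  have hsub : Finset.Ioc 0 ⌊t⌋₊ ⊆ Finset.Ioc 0 N := by
    intro n hn
    rw [Finset.mem_Ioc] at hn ⊢
    refine ⟨hn.1, ?_⟩
    have := (Nat.le_floor_iff (by linarith)).1 hn.2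
    exact_mod_cast this.trans htN.le
  have htl : 0 < t * Real.log t := mul_pos (by linarith) (log_pos2 ht)
  rw [← Finset.sum_subset hsub, A, Chebyshev.psi, Finset.sum_div, ← Finset.sum_sub_distrib]
  · refine Finset.sum_congr rfl fun n hn => ?_
    rw [Finset.mem_Ioc] at hn
    rcases Nat.lt_or_ge n 2 with h | h
    · have : n = 1 := by omega
      subst this; simp
    · have h2 : (2:ℝ) ≤ n := by exact_mod_cast h
      have h3 := (Nat.le_floor_iff (by linarith)).1 hn.2
      have h4 := xlogx_mono h2 h3
      have h5 : 0 < (n:ℝ) * Real.log n := mul_pos (by linarith) (log_pos2 h2)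
      rw [max_eq_right (sub_nonneg.2 (one_div_le_one_div_of_le h5 h4))]
      ring
  · intro n hn hn2
    rw [Finset.mem_Ioc] at hn hn2
    have h1 : ⌊t⌋₊ < n := by
      by_contra h; exact hn2 ⟨hn.1, by omega⟩
    have h3 : t < n := (Nat.floor_lt (by linarith)).1 h1
    rw [max_eq_left, mul_zero]
    have := one_div_le_one_div_of_le htl (xlogx_mono ht h3.le)
    linarith

lemma Apsi_cont : ContinuousOn (fun x => A x - Chebyshev.psi x / (x * Real.log x)) (Set.Ici 2) := by
  intro x hx
  have hx2 : (2:ℝ) ≤ x := hx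
  obtain ⟨N, hN⟩ := exists_nat_gt x
  have hl : ContinuousAt (fun x : ℝ => 1/(x * Real.log x)) x := by
    refine continuousAt_const.div (continuousAt_id.mul (Real.continuousAt_log (by linarith))) ?_
    exact mul_ne_zero (by linarith) (log_pos2 hx2).ne'
  have hc : ContinuousAt (fun x : ℝ => ∑ n ∈ Finset.Ioc 0 N, ArithmeticFunction.vonMangoldt n * max 0 (1 / ((n:ℝ) * Real.log n) - 1/(x * Real.log x))) x := by
    fun_prop
  refine hc.continuousWithinAt.congr_of_eventuallyEq ?_ (Apsi_key N x hx2 hN)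
  filter_upwards [self_mem_nhdsWithin, nhdsWithin_le_nhds (gt_mem_nhds hN)] with t ht htN
  exact Apsi_key N t ht htN

lemma log_contOn2 : ContinuousOn Real.log (Set.Ici 2) :=
  Real.continuousOn_log.mono (by intro t ht; have : (2:ℝ) ≤ t := ht
                                 simp; linarith)

lemma gg_contOn : ContinuousOn gg (Set.Ici 2) := by
  have := log_contOn2
  unfold gg
  refine (continuousOn_const.div this ?_).add (continuousOn_const.div (this.pow 2) ?_)
  · intro t ht; exact (log_pos2 ht).ne'
  · intro t ht; exact pow_ne_zero 2 (log_pos2 ht).ne'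

lemma rr_contOn : ContinuousOn rr (Set.Ici 2) := by
  unfold rr
  exact ((V_contOn.mono (by intro t ht; have : (2:ℝ) ≤ t := ht
                            simp; linarith)).sub log_contOn2).add continuousOn_const

lemma DD_contOn : ContinuousOn DD (Set.Ici 2) := by
  have h1 : ContinuousOn (fun x => (A x - Chebyshev.psi x / (x * Real.log x)) - Real.log (Real.log x) + 1 / Real.log x - rr x * gg x) (Set.Ici 2) := by
    refine ((Apsi_cont.sub ?_).add ?_).sub (rr_contOn.mul gg_contOn)
    · exact log_contOn2.log (fun t ht => (log_pos2 ht).ne')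
    · exact continuousOn_const.div log_contOn2 (fun t ht => (log_pos2 ht).ne')
  refine h1.congr fun t ht => ?_
  have h2 : (2:ℝ) ≤ t := ht
  have h3 := log_pos2 h2
  rw [DD]
  have : t ≠ 0 := by linarith
  field_simp
  ring

noncomputable def gg' (x : ℝ) : ℝ := -(1/(x*(Real.log x)^2) + 2/(x*(Real.log x)^3))

lemma gg_deriv (x : ℝ) (hx : 2 ≤ x) : HasDerivAt gg (gg' x) x := by
  have hL := log_pos2 hx
  have hl := Real.hasDerivAt_log (show x ≠ 0 by linarith)
  have h := (hl.inv hL.ne').add ((hl.pow 2).inv (pow_ne_zero 2 hL.ne'))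
  have e : gg = (Real.log)⁻¹ + (Real.log ^ 2)⁻¹ := by
    funext t; simp [gg]
  rw [e]
  refine h.congr_deriv ?_
  unfold gg'
  have : x ≠ 0 := by linarith
  simp only [Pi.pow_apply]
  field_simp
  push_cast
  ring

lemma DD_deriv (x : ℝ) (hx : 2 ≤ x) : HasDerivWithinAt DD (- rr x * gg' x) (Set.Ici x) x := by
  set a := A x with ha
  set p := Chebyshev.psi x with hp
  set v := ∑ n ∈ Finset.Ioc 0 ⌊x⌋₊, ArithmeticFunction.vonMangoldt n * (1/(n:ℝ)) with hv
  have hVv : ∀ s, ⌊s⌋₊ = ⌊x⌋₊ → V s = v - p / s := by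
    intro s hs
    rw [V, hv, hp, Chebyshev.psi, hs, Finset.sum_div, ← Finset.sum_sub_distrib]
    refine Finset.sum_congr rfl fun n _ => ?_
    ring
  have hL := log_pos2 hx
  have hx0 : x ≠ 0 := by linarith
  have hl := Real.hasDerivAt_log hx0
  have d1 : HasDerivAt (fun s => a - Real.log (Real.log s) - (p - s) / (s * Real.log s) - (v - p/s - Real.log s + c1) * gg s)
      (- rr x * gg' x) x := by
    have hll := hl.log hL.ne'
    have hid := hasDerivAt_id x
    have h1 := ((hid.const_sub p).div (hid.mul hl) (by simp only [id, Pi.mul_apply]; positivity))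
    have h2 := ((((hasDerivAt_const x p).div hid hx0).const_sub v).sub hl).add_const c1
    have h3 := ((hll.const_sub a).sub h1).sub (h2.mul (gg_deriv x hx))
    refine (h3.congr_deriv ?_)
    rw [rr, hVv x rfl, gg']
    simp only [id, Pi.mul_apply, gg, Pi.div_apply, Pi.sub_apply]
    field_simp
    ring
  refine d1.hasDerivWithinAt.congr_of_eventuallyEq ?_ ?_
  · have hlt : x < (⌊x⌋₊ + 1 : ℝ) := Nat.lt_floor_add_one x
    filter_upwards [self_mem_nhdsWithin, nhdsWithin_le_nhds (gt_mem_nhds hlt)] with s hs hs2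
    have hs' : x ≤ s := hs
    have hf : ⌊s⌋₊ = ⌊x⌋₊ := by
      rw [Nat.floor_eq_iff (by linarith)]
      exact ⟨(Nat.floor_le (by linarith)).trans hs', hs2⟩
    rw [DD, rr, hVv s hf, ha, hp, A, A, Chebyshev.psi, Chebyshev.psi, hf]
  · rw [DD, rr, hVv x rfl]

lemma gg'_nonpos (x : ℝ) (hx : 2 ≤ x) : gg' x ≤ 0 := by
  have hL := log_pos2 hx
  rw [gg']
  have : 0 < x := by linarith
  have : 0 ≤ (1/(x*(Real.log x)^2) + 2/(x*(Real.log x)^3)) := by positivity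
  linarith

lemma DD_diff (Z : ZeroData) (x y : ℝ) (hx : 2 ≤ x) (hxy : x ≤ y) :
    |DD y - DD x| ≤ rho x * (gg x - gg y) := by
  have h := image_norm_le_of_norm_deriv_right_le_deriv_boundary' (f := fun t => DD t - DD x) (f' := fun t => - rr t * gg' t)
    (a := x) (b := y) (B := fun t => rho x * (gg x - gg t)) (B' := fun t => rho x * (- gg' t))
    ((DD_contOn.mono (by intro t ht; exact hx.trans ht.1)).sub continuousOn_const)
    (fun t ht => (DD_deriv t (hx.trans ht.1)).sub_const _)
    (by simp)
    ((continuousOn_const.mul (continuousOn_const.sub (gg_contOn.mono (by intro t ht; exact hx.trans ht.1)))))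
    (fun t ht => ((((gg_deriv t (hx.trans ht.1)).const_sub _).const_mul _).hasDerivWithinAt))
    (fun t ht => by
      have h2 := hx.trans ht.1
      have h3 := gg'_nonpos t h2
      rw [Real.norm_eq_abs, abs_mul, abs_neg, abs_of_nonpos h3]
      exact mul_le_mul_of_nonneg_right ((rr_le Z t h2).trans (rho_anti x t (by linarith) ht.1)) (by linarith))
    (Set.right_mem_Icc.2 hxy)
  simpa using h

end MT

namespace MT
open Filter Topology


lemma gg_exp (t : ℝ) : gg (Real.exp t) = 1/t + 1/t^2 := by rw [gg, Real.log_exp]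

lemma two_le_exp (K : ℕ) : (2:ℝ) ≤ Real.exp ((K:ℝ)+1) := by
  have := Real.add_one_le_exp ((K:ℝ)+1)
  have h2 : (0:ℝ) ≤ K := by positivity
  linarith

lemma gg_pos {x : ℝ} (hx : 2 ≤ x) : 0 < gg x := by
  have := log_pos2 hx
  rw [gg]; positivity

lemma inv_tends : Tendsto (fun K : ℕ => 1/((K:ℝ)+1)) atTop (𝓝 0) := tendsto_one_div_add_atTop_nhds_zero_nat

lemma gg_tends : Tendsto (fun K : ℕ => gg (Real.exp ((K:ℝ)+1))) atTop (𝓝 0) := by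
  simp_rw [gg_exp]
  have := inv_tends.add (inv_tends.pow 2)
  simpa using this

lemma DD_lim (Z : ZeroData) : ∃ c, Tendsto (fun K : ℕ => DD (Real.exp ((K:ℝ)+1))) atTop (𝓝 c) ∧
    ∀ x, 2 ≤ x → |c - DD x| ≤ rho x * gg x := by
  have hd : ∀ x y, 2 ≤ x → x ≤ y → |DD y - DD x| ≤ rho x * gg x := by
    intro x y hx hy
    refine (DD_diff Z x y hx hy).trans ?_
    have := gg_pos (hx.trans hy)
    exact mul_le_mul_of_nonneg_left (by linarith) (rho_pos x (by linarith)).le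
  have hcs : CauchySeq (fun K : ℕ => DD (Real.exp ((K:ℝ)+1))) := by
    refine cauchySeq_of_le_tendsto_0' (fun K : ℕ => rho 2 * gg (Real.exp ((K:ℝ)+1))) ?_ ?_
    · intro n m h
      rw [dist_comm, Real.dist_eq]
      refine (hd _ _ (two_le_exp n) ?_).trans ?_
      · gcongr
      · exact mul_le_mul_of_nonneg_right (rho_anti 2 _ (by norm_num) (two_le_exp n)) (gg_pos (two_le_exp n)).le
    · simpa using gg_tends.const_mul (rho 2)
  obtain ⟨c, hc⟩ := cauchySeq_tendsto_of_complete hcs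
  refine ⟨c, hc, fun x hx => ?_⟩
  have h1 : Tendsto (fun K : ℕ => |DD (Real.exp ((K:ℝ)+1)) - DD x|) atTop (𝓝 |c - DD x|) :=
    (hc.sub_const _).abs
  refine le_of_tendsto h1 ?_
  obtain ⟨N, hN⟩ := exists_nat_gt x
  filter_upwards [eventually_ge_atTop N] with K hK
  refine hd x _ hx ?_
  have := Real.add_one_le_exp ((K:ℝ)+1)
  have h2 : (N:ℝ) ≤ K := by exact_mod_cast hK
  linarith

lemma A_lim (Z : ZeroData) (c : ℝ) (hc : Tendsto (fun K : ℕ => DD (Real.exp ((K:ℝ)+1))) atTop (𝓝 c)) :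
    Tendsto (fun K : ℕ => A (Real.exp ((K:ℝ)+1)) - Real.log ((K:ℝ)+1)) atTop (𝓝 c) := by
  have h1 : Tendsto (fun K : ℕ => (Chebyshev.psi (Real.exp ((K:ℝ)+1)) - Real.exp ((K:ℝ)+1)) / (Real.exp ((K:ℝ)+1) * ((K:ℝ)+1))) atTop (𝓝 0) := by
    refine squeeze_zero_norm (a := fun K : ℕ => (Real.log 4 + 5) * (1/((K:ℝ)+1))) ?_ (by simpa using inv_tends.const_mul (Real.log 4 + 5))
    intro K
    set x := Real.exp ((K:ℝ)+1) with hx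
    have hx0 : 0 < x := Real.exp_pos _
    have hK : (0:ℝ) < (K:ℝ)+1 := by positivity
    have a1 := Chebyshev.psi_le_const_mul_self (x := x) hx0.le
    have a2 := Chebyshev.psi_nonneg x
    have a3 : 0 ≤ Real.log 4 := Real.log_nonneg (by norm_num)
    have a5 : 0 ≤ Real.log 4 * x := by positivity
    have a4 : |Chebyshev.psi x - x| ≤ (Real.log 4 + 5) * x := by
      rw [abs_le]; constructor <;> linarith
    rw [Real.norm_eq_abs, abs_div, abs_of_pos (by positivity : 0 < x * ((K:ℝ)+1)), div_le_iff₀ (by positivity)]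
    refine a4.trans (le_of_eq ?_)
    field_simp
  have h2 : Tendsto (fun K : ℕ => rr (Real.exp ((K:ℝ)+1)) * gg (Real.exp ((K:ℝ)+1))) atTop (𝓝 0) := by
    refine squeeze_zero_norm (a := fun K : ℕ => rho 2 * gg (Real.exp ((K:ℝ)+1))) ?_ (by simpa using gg_tends.const_mul (rho 2))
    intro K
    have h := two_le_exp K
    rw [Real.norm_eq_abs, abs_mul, abs_of_pos (gg_pos h)]
    exact mul_le_mul_of_nonneg_right ((rr_le Z _ h).trans (rho_anti 2 _ (by norm_num) h)) (gg_pos h).le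
  have h3 := (hc.add h1).add h2
  rw [add_zero, add_zero] at h3
  refine h3.congr fun K => ?_
  rw [DD, Real.log_exp]; ring

/-- coefficients -/
noncomputable def aa (n : ℕ) : ℝ := ArithmeticFunction.vonMangoldt n * (1 / ((n:ℝ) * Real.log n))

lemma aa_nonneg (n : ℕ) : 0 ≤ aa n := by
  unfold aa
  have := ArithmeticFunction.vonMangoldt_nonneg (n := n)
  have := Real.log_natCast_nonneg n
  positivity

lemma aa_zero : aa 0 = 0 := by simp [aa]
lemma aa_one : aa 1 = 0 := by simp [aa]

lemma aa_le (n : ℕ) : aa n ≤ 1/n := by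
  rcases Nat.lt_or_ge n 2 with h | h
  · interval_cases n
    · simp [aa]
    · simp [aa]
  have h2 : (2:ℝ) ≤ n := by exact_mod_cast h
  have hl := log_pos2 h2
  rw [aa, mul_one_div, div_le_div_iff₀ (by positivity) (by positivity)]
  have := ArithmeticFunction.vonMangoldt_le_log (n := n)
  nlinarith

noncomputable def TT (ε : ℝ) : ℝ := ∑' n : ℕ, aa n * Real.exp (-ε * Real.log n)

lemma term_eq (ε : ℝ) (n : ℕ) : aa n * Real.exp (-ε * Real.log n) = ArithmeticFunction.vonMangoldt n / ((n:ℝ)^(1+ε) * Real.log n) := by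
  rcases Nat.eq_zero_or_pos n with rfl | h
  · simp [aa]
  have h2 : (0:ℝ) < n := by exact_mod_cast h
  rw [aa, Real.rpow_def_of_pos h2, show Real.log n * (1+ε) = Real.log n + ε * Real.log n by ring, Real.exp_add, Real.exp_log h2,
    show -ε * Real.log n = -(ε * Real.log n) by ring, Real.exp_neg]
  have := Real.exp_pos (ε * Real.log n)
  field_simp

lemma TT_summable (ε : ℝ) (hε : 0 < ε) : Summable (fun n : ℕ => aa n * Real.exp (-ε * Real.log n)) := by
  refine Summable.of_nonneg_of_le (fun n => mul_nonneg (aa_nonneg n) (Real.exp_pos _).le) (fun n => ?_)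
    (Real.summable_one_div_nat_rpow.2 (show 1 < 1 + ε by linarith))
  rcases Nat.eq_zero_or_pos n with rfl | h
  · simp [aa_zero]; positivity
  have h2 : (0:ℝ) < n := by exact_mod_cast h
  rw [Real.rpow_def_of_pos h2, show Real.log n * (1+ε) = Real.log n + ε * Real.log n by ring, Real.exp_add, Real.exp_log h2,
    show -ε * Real.log n = -(ε * Real.log n) by ring, Real.exp_neg, ← div_eq_mul_inv, ← div_div]
  exact div_le_div_of_nonneg_right (aa_le n) (Real.exp_pos _).le

lemma TT_lim : Tendsto (fun ε => TT ε + Real.log ε) (𝓝[>] 0) (𝓝 0) := by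
  have h := (Asymptotics.isLittleO_one_iff ℝ).1 log_riemannZeta_add_log_sub_isLittleO_ofReal
  have ht : Tendsto (fun ε : ℝ => 1 + ε) (𝓝[>] 0) (𝓝[>] 1) := by
    refine tendsto_nhdsWithin_iff.2 ⟨?_, ?_⟩
    · have : Tendsto (fun ε : ℝ => 1 + ε) (𝓝 0) (𝓝 (1+0)) := (continuous_const.add continuous_id).tendsto 0
      rw [add_zero] at this
      exact this.mono_left nhdsWithin_le_nhds
    · filter_upwards [self_mem_nhdsWithin] with ε hε
      have : (0:ℝ) < ε := hε
      simpa using this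
  refine (h.comp ht).congr' ?_
  filter_upwards [self_mem_nhdsWithin] with ε hε
  have hε' : (0:ℝ) < ε := hε
  have h3 := log_riemannZeta_eq (s := 1+ε) (by linarith)
  simp only [Function.comp]
  rw [h3, TT]
  congr 1
  · exact tsum_congr fun n => (term_eq ε n).symm
  · congr 1; ring

end MT

namespace MT
open Filter Topology


noncomputable def kk (n : ℕ) : ℕ := ⌈Real.log n⌉₊

noncomputable def hh (j : ℕ) : ℝ := ∑' n : (kk ⁻¹' {j} : Set ℕ), aa n

lemma hh_zero : hh 0 = 0 := by
  unfold hh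
  refine (tsum_congr fun n => ?_).trans tsum_zero
  obtain ⟨n, hn⟩ := n
  have h1 : kk n = 0 := hn
  rw [kk, Nat.ceil_eq_zero] at h1
  rcases Nat.lt_or_ge n 2 with h | h
  · interval_cases n
    · exact aa_zero
    · exact aa_one
  · have h2 : (2:ℝ) ≤ n := by exact_mod_cast h
    linarith [log_pos2 h2]

lemma hh_succ (j : ℕ) : hh (j+1) = A (Real.exp ((j:ℝ)+1)) - A (Real.exp j) := by
  unfold hh
  rw [_root_.tsum_subtype]
  have hle : ⌊Real.exp (j:ℝ)⌋₊ ≤ ⌊Real.exp ((j:ℝ)+1)⌋₊ := Nat.floor_mono (Real.exp_le_exp.2 (by linarith))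
  have hmem : ∀ n : ℕ, n ∈ kk ⁻¹' {j+1} ↔ n ∈ Finset.Ioc ⌊Real.exp (j:ℝ)⌋₊ ⌊Real.exp ((j:ℝ)+1)⌋₊ := by
    intro n
    rw [Finset.mem_Ioc, Nat.floor_lt (Real.exp_pos _).le, Nat.le_floor_iff (Real.exp_pos _).le]
    rw [Set.mem_preimage, Set.mem_singleton_iff, kk, Nat.ceil_eq_iff (by omega)]
    rcases Nat.eq_zero_or_pos n with rfl | h
    · simp
      constructor
      · intro h; have : (0:ℝ) ≤ j := by positivity
        linarith
      · intro h; exact absurd h.1 (not_lt.2 (Real.exp_pos _).le)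
    have h2 : (0:ℝ) < n := by exact_mod_cast h
    rw [Real.log_le_iff_le_exp h2]
    simp only [Nat.add_sub_cancel]
    rw [Real.lt_log_iff_exp_lt h2]
    push_cast
    rfl
  rw [tsum_eq_sum (s := Finset.Ioc ⌊Real.exp (j:ℝ)⌋₊ ⌊Real.exp ((j:ℝ)+1)⌋₊)]
  · rw [A, A, ← Finset.sum_Ioc_consecutive _ (Nat.zero_le _) hle, add_sub_cancel_left]
    refine Finset.sum_congr rfl fun n hn => ?_
    rw [Set.indicator_of_mem ((hmem n).2 hn), aa]
  · intro n hn
    rw [Set.indicator_of_notMem (fun h => hn ((hmem n).1 h))]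

lemma kk_bound (ε : ℝ) (hε : 0 < ε) (n : ℕ) :
    Real.exp (-ε * Real.log n) * Real.exp (-ε) ≤ (Real.exp (-ε))^(kk n) ∧
    (Real.exp (-ε))^(kk n) ≤ Real.exp (-ε * Real.log n) := by
  have h0 := Real.log_natCast_nonneg n
  have h1 := Nat.le_ceil (Real.log n)
  have h2 := Nat.ceil_lt_add_one h0
  rw [← Real.exp_nat_mul, ← Real.exp_add, Real.exp_le_exp, Real.exp_le_exp, kk]
  constructor <;> nlinarith

lemma WW_summable (ε : ℝ) (hε : 0 < ε) : Summable (fun n : ℕ => aa n * (Real.exp (-ε))^(kk n)) :=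
  Summable.of_nonneg_of_le (fun n => mul_nonneg (aa_nonneg n) (by positivity))
    (fun n => mul_le_mul_of_nonneg_left (kk_bound ε hε n).2 (aa_nonneg n)) (TT_summable ε hε)

lemma WW_hasSum (ε : ℝ) (hε : 0 < ε) :
    HasSum (fun j : ℕ => hh j * (Real.exp (-ε))^j) (∑' n : ℕ, aa n * (Real.exp (-ε))^(kk n)) := by
  have h := (WW_summable ε hε).hasSum.tsum_fiberwise kk
  refine hasSum_congr_aux h (fun j => ?_) rfl
  rw [hh, ← tsum_mul_right]
  refine tsum_congr fun n => ?_
  have : kk n = j := n.2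
  rw [this]

lemma WW_bound (ε : ℝ) (hε : 0 < ε) :
    |(∑' n : ℕ, aa n * (Real.exp (-ε))^(kk n)) - TT ε| ≤ ε * TT ε := by
  have hT := TT_summable ε hε
  have hW := WW_summable ε hε
  have h1 : (∑' n : ℕ, aa n * (Real.exp (-ε))^(kk n)) ≤ TT ε :=
    hW.tsum_le_tsum (fun n => mul_le_mul_of_nonneg_left (kk_bound ε hε n).2 (aa_nonneg n)) hT
  have h2 : TT ε * Real.exp (-ε) ≤ ∑' n : ℕ, aa n * (Real.exp (-ε))^(kk n) := by
    rw [TT, ← tsum_mul_right]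
    refine (hT.mul_right _).tsum_le_tsum (fun n => ?_) hW
    rw [mul_assoc]
    exact mul_le_mul_of_nonneg_left (kk_bound ε hε n).1 (aa_nonneg n)
  have h3 : 0 ≤ TT ε := tsum_nonneg fun n => mul_nonneg (aa_nonneg n) (Real.exp_pos _).le
  have h4 := Real.add_one_le_exp (-ε)
  have h5 : TT ε * (-ε+1) ≤ TT ε * Real.exp (-ε) := mul_le_mul_of_nonneg_left h4 h3
  have h6 : 0 ≤ ε * TT ε := by positivity
  rw [abs_le]
  constructor <;> linarith

noncomputable def ff (j : ℕ) : ℝ := hh j - 1/(j:ℝ)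

lemma ff_hasSum (ε : ℝ) (hε : 0 < ε) :
    HasSum (fun j : ℕ => ff j * (Real.exp (-ε))^j) ((∑' n : ℕ, aa n * (Real.exp (-ε))^(kk n)) + Real.log (1 - Real.exp (-ε))) := by
  have hx : |Real.exp (-ε)| < 1 := by
    rw [abs_of_pos (Real.exp_pos _), Real.exp_lt_one_iff]; linarith
  have h1 := Real.hasSum_pow_div_log_of_abs_lt_one hx
  have h2 : HasSum (fun n : ℕ => (Real.exp (-ε))^n / (n:ℝ)) (-Real.log (1 - Real.exp (-ε))) := by
    rw [← hasSum_nat_add_iff' 1]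
    simpa using h1
  have h3 := (WW_hasSum ε hε).sub h2
  refine hasSum_congr_aux h3 (fun j => ?_) ?_
  · rw [ff]; ring
  · ring

lemma ff_partial (K : ℕ) : ∑ j ∈ range (K+1), ff j = A (Real.exp K) - (harmonic K : ℚ) := by
  induction K with
  | zero => simp [ff, hh_zero, A]
  | succ K ih =>
    rw [Finset.sum_range_succ, ih, ff, hh_succ, harmonic_succ]
    push_cast
    rw [one_div]
    ring

lemma ff_lim (c : ℝ) (hc : Tendsto (fun K : ℕ => A (Real.exp ((K:ℝ)+1)) - Real.log ((K:ℝ)+1)) atTop (𝓝 c)) :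
    Tendsto (fun K => ∑ j ∈ range K, ff j) atTop (𝓝 (c - Real.eulerMascheroniConstant)) := by
  rw [← tendsto_add_atTop_iff_nat 2]
  have h := (tendsto_add_atTop_iff_nat 1).2 Real.tendsto_harmonic_sub_log
  refine (hc.sub h).congr fun K => ?_
  rw [ff_partial (K+1)]
  push_cast
  ring

lemma exp_neg_tends : Tendsto (fun ε : ℝ => Real.exp (-ε)) (𝓝[>] 0) (𝓝[<] 1) := by
  refine tendsto_nhdsWithin_iff.2 ⟨?_, ?_⟩
  · have : Tendsto (fun ε : ℝ => Real.exp (-ε)) (𝓝 0) (𝓝 (Real.exp (-0))) := by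
      apply Continuous.tendsto; fun_prop
    rw [neg_zero, Real.exp_zero] at this
    exact this.mono_left nhdsWithin_le_nhds
  · filter_upwards [self_mem_nhdsWithin] with ε hε
    have : (0:ℝ) < ε := hε
    simpa using this

lemma eps_log : Tendsto (fun ε : ℝ => ε * Real.log ε) (𝓝[>] 0) (𝓝 0) := by
  have := (Real.continuous_mul_log.tendsto 0).mono_left (nhdsWithin_le_nhds (s := Set.Ioi 0))
  simpa using this

lemma eps_id : Tendsto (fun ε : ℝ => ε) (𝓝[>] 0) (𝓝 0) := tendsto_id.mono_left nhdsWithin_le_nhds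

lemma log_one_sub_exp : Tendsto (fun ε : ℝ => Real.log (1 - Real.exp (-ε)) - Real.log ε) (𝓝[>] 0) (𝓝 0) := by
  have hlow : Tendsto (fun ε : ℝ => -ε) (𝓝[>] 0) (𝓝 0) := by simpa using eps_id.neg
  refine tendsto_of_tendsto_of_tendsto_of_le_of_le' hlow tendsto_const_nhds ?_ ?_
  · filter_upwards [self_mem_nhdsWithin] with ε hε
    have h0 : (0:ℝ) < ε := hε
    have h1 := Real.add_one_le_exp ε
    have h2 : ε * Real.exp (-ε) ≤ 1 - Real.exp (-ε) := by
      have : Real.exp ε * Real.exp (-ε) = 1 := by rw [← Real.exp_add]; simp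
      nlinarith [Real.exp_pos (-ε)]
    have h3 := Real.log_le_log (mul_pos h0 (Real.exp_pos _)) h2
    rw [Real.log_mul h0.ne' (Real.exp_pos _).ne', Real.log_exp] at h3
    linarith
  · filter_upwards [self_mem_nhdsWithin] with ε hε
    have h0 : (0:ℝ) < ε := hε
    have h1 := Real.add_one_le_exp (-ε)
    have h2 : Real.exp (-ε) < 1 := by rw [Real.exp_lt_one_iff]; linarith
    have := Real.log_le_log (show 0 < 1 - Real.exp (-ε) by linarith) (show 1 - Real.exp (-ε) ≤ ε by linarith)
    linarith

lemma c_eq (c : ℝ) (hc : Tendsto (fun K : ℕ => A (Real.exp ((K:ℝ)+1)) - Real.log ((K:ℝ)+1)) atTop (𝓝 c)) :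
    c = Real.eulerMascheroniConstant := by
  have h1 := (Real.tendsto_tsum_powerSeries_nhdsWithin_lt (ff_lim c hc)).comp exp_neg_tends
  have h2 : Tendsto (fun ε : ℝ => ε * TT ε) (𝓝[>] 0) (𝓝 0) := by
    have := (eps_id.mul TT_lim).sub eps_log
    simp only [mul_zero, sub_zero] at this
    refine this.congr fun ε => ?_
    ring
  have h3 : Tendsto (fun ε : ℝ => (∑' n : ℕ, aa n * (Real.exp (-ε))^(kk n)) - TT ε) (𝓝[>] 0) (𝓝 0) := by
    refine squeeze_zero_norm' ?_ h2
    filter_upwards [self_mem_nhdsWithin] with ε hε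
    exact WW_bound ε hε
  have h4 := (h3.add TT_lim).add log_one_sub_exp
  simp only [add_zero] at h4
  have h5 : Tendsto (fun ε : ℝ => (∑' n : ℕ, aa n * (Real.exp (-ε))^(kk n)) - TT ε + (TT ε + Real.log ε) + (Real.log (1 - Real.exp (-ε)) - Real.log ε)) (𝓝[>] 0) (𝓝 (c - Real.eulerMascheroniConstant)) := by
    refine h1.congr' ?_
    filter_upwards [self_mem_nhdsWithin] with ε hε
    simp only [Function.comp]
    rw [(ff_hasSum ε hε).tsum_eq]
    ring
  have := tendsto_nhds_unique h4 h5
  linarith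

lemma A_bound (Z : ZeroData) (x : ℝ) (hx : 2 ≤ x) :
    |A x - Real.log (Real.log x) - Real.eulerMascheroniConstant| ≤ |Chebyshev.psi x - x| / (x * Real.log x) + 2 * rho x * gg x := by
  obtain ⟨c, hc, hb⟩ := DD_lim Z
  have e := c_eq c (A_lim Z c hc)
  rw [← e]
  have h1 := hb x hx
  have h2 := rr_le Z x hx
  have hL := log_pos2 hx
  have hg := gg_pos hx
  have h3 : |rr x * gg x| ≤ rho x * gg x := by
    rw [abs_mul, abs_of_pos hg]; exact mul_le_mul_of_nonneg_right h2 hg.le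
  have h4 : |Chebyshev.psi x - x| / (x * Real.log x) = |(Chebyshev.psi x - x) / (x * Real.log x)| := by
    have : 0 < x * Real.log x := mul_pos (by linarith) hL
    rw [abs_div, abs_of_pos this]
  rw [h4]
  have e2 : A x - Real.log (Real.log x) - c = (Chebyshev.psi x - x) / (x * Real.log x) + rr x * gg x - (c - DD x) := by
    rw [DD]; ring
  rw [e2]
  refine (abs_sub _ _).trans ?_
  refine (add_le_add (abs_add_le _ _) le_rfl).trans ?_
  linarith

end MT

namespace MT

lemma A_eq (x : ℝ) : A x = ∑ p ∈ (Finset.range (⌊x⌋₊ + 1)).filter Nat.Prime,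
    ∑ k ∈ Finset.Ioc 0 (Nat.log p ⌊x⌋₊), 1 / ((k:ℝ) * (p:ℝ)^k) := by
  set N := ⌊x⌋₊ with hN
  rw [Finset.sum_sigma', A, ← hN]
  symm
  have hsub : (Finset.Ioc 0 N).filter IsPrimePow ⊆ Finset.Ioc 0 N := Finset.filter_subset _ _
  rw [← Finset.sum_subset hsub]
  · refine Finset.sum_bij (fun a _ => a.1 ^ a.2) ?_ ?_ ?_ ?_
    · rintro ⟨p, k⟩ h
      simp only [Finset.mem_sigma, Finset.mem_filter, Finset.mem_range, Finset.mem_Ioc] at h ⊢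
      obtain ⟨⟨h1, h2⟩, h3, h4⟩ := h
      refine ⟨⟨pow_pos h2.pos _, ?_⟩, h2.isPrimePow.pow h3.ne'⟩
      have hN0 : N ≠ 0 := by
        rintro h; rw [h] at h4; simp at h4; omega
      exact Nat.pow_le_of_le_log hN0 h4
    · rintro ⟨p, k⟩ h ⟨q, l⟩ h' e
      simp only [Finset.mem_sigma, Finset.mem_filter, Finset.mem_range, Finset.mem_Ioc] at h h'
      obtain ⟨k, rfl⟩ := Nat.exists_eq_succ_of_ne_zero h.2.1.ne'
      obtain ⟨l, rfl⟩ := Nat.exists_eq_succ_of_ne_zero h'.2.1.ne'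
      obtain ⟨e1, e2⟩ := Nat.Prime.pow_inj h.1.2 h'.1.2 e
      subst e1; subst e2; rfl
    · intro n hn
      simp only [Finset.mem_filter, Finset.mem_Ioc] at hn
      obtain ⟨⟨h0, h1⟩, h2⟩ := hn
      rw [isPrimePow_nat_iff] at h2
      obtain ⟨p, k, hp, hk, rfl⟩ := h2
      refine ⟨⟨p, k⟩, ?_, rfl⟩
      simp only [Finset.mem_sigma, Finset.mem_filter, Finset.mem_range, Finset.mem_Ioc]
      refine ⟨⟨?_, hp⟩, hk, Nat.le_log_of_pow_le hp.one_lt h1⟩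
      have := Nat.le_self_pow hk.ne' p
      omega
    · rintro ⟨p, k⟩ h
      simp only [Finset.mem_sigma, Finset.mem_filter, Finset.mem_range, Finset.mem_Ioc] at h
      obtain ⟨⟨h1, h2⟩, h3, h4⟩ := h
      rw [ArithmeticFunction.vonMangoldt_apply_pow h3.ne', ArithmeticFunction.vonMangoldt_apply_prime h2]
      push_cast
      rw [Real.log_pow]
      have hl := log_pos2 (x := (p:ℝ)) (by exact_mod_cast h2.two_le)
      have hp : (0:ℝ) < p := by exact_mod_cast h2.pos
      have hk : (0:ℝ) < k := by exact_mod_cast h3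
      field_simp
  · intro n hn hn2
    rw [ArithmeticFunction.vonMangoldt_eq_zero_iff.2, zero_mul]
    intro h
    exact hn2 (Finset.mem_filter.2 ⟨hn, h⟩)

lemma odd_sum_aux (J M : ℕ) (h : J ≤ M) : ∑ j ∈ Finset.Ioc J M, 1 / ((2*(j:ℝ)+1) * (2*(j:ℝ))) ≤
    0.5 * (1 / (2*(J:ℝ)+1.5) - 1/(2*(M:ℝ)+1.5)) := by
  induction M, h using Nat.le_induction with
  | base => simp
  | succ M hM ih =>
    rw [Finset.sum_Ioc_succ_top (by omega)]
    have hM0 : (0:ℝ) ≤ M := by positivity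
    have : 1 / ((2*((M+1:ℕ):ℝ)+1) * (2*((M+1:ℕ):ℝ))) ≤ 0.5 * (1 / (2*(M:ℝ)+1.5) - 1/(2*((M+1:ℕ):ℝ)+1.5)) := by
      push_cast
      rw [div_sub_div _ _ (by positivity) (by positivity), mul_div_assoc', div_le_div_iff₀ (by positivity) (by positivity)]
      nlinarith
    linarith

lemma odd_sum (S : Finset ℕ) (m : ℕ) (hm : 1 ≤ m) (h : ∀ n ∈ S, Odd n ∧ m < n) :
    ∑ n ∈ S, 1 / ((n:ℝ) * ((n:ℝ)-1)) ≤ 0.5 / ((m:ℝ) - 0.5) := by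
  set J := (m-1)/2 with hJ
  set M := J + S.sup id with hM
  have hsub : S ⊆ (Finset.Ioc J M).image (fun j => 2*j+1) := by
    intro n hn
    obtain ⟨⟨j, hj⟩, h2⟩ := h n hn
    rw [Finset.mem_image]
    refine ⟨j, ?_, hj.symm⟩
    have : n ≤ S.sup id := Finset.le_sup (f := id) hn
    rw [Finset.mem_Ioc]; omega
  have h1 := Finset.sum_le_sum_of_subset_of_nonneg (f := fun n : ℕ => 1 / ((n:ℝ) * ((n:ℝ)-1))) hsub (by
    intro n hn _
    rw [Finset.mem_image] at hn
    obtain ⟨j, _, rfl⟩ := hn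
    push_cast
    have : (0:ℝ) ≤ j := by positivity
    have : (0:ℝ) ≤ 2*(j:ℝ)+1-1 := by linarith
    positivity)
  refine h1.trans ?_
  rw [Finset.sum_image (by intro a _ b _ hab; simp only at hab; omega)]
  have h2 := odd_sum_aux J M (by omega)
  have h3 : ∑ j ∈ Finset.Ioc J M, 1 / (((2*j+1:ℕ):ℝ) * (((2*j+1:ℕ):ℝ)-1)) = ∑ j ∈ Finset.Ioc J M, 1 / ((2*(j:ℝ)+1) * (2*(j:ℝ))) := by
    refine Finset.sum_congr rfl fun j _ => ?_
    push_cast; ring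
  rw [h3]
  refine h2.trans ?_
  have hm' : (1:ℝ) ≤ m := by exact_mod_cast hm
  have hJm : (m:ℝ) ≤ 2*(J:ℝ)+2 := by
    have : m ≤ 2*J+2 := by omega
    exact_mod_cast this
  have h4 : 1 / (2*(J:ℝ)+1.5) ≤ 1/((m:ℝ)-0.5) := one_div_le_one_div_of_le (by linarith) (by linarith)
  have h5 : 0 ≤ 1/(2*(M:ℝ)+1.5) := by positivity
  have h6 : 0.5/((m:ℝ)-0.5) = 0.5 * (1/((m:ℝ)-0.5)) := by ring
  rw [h6]; linarith

/-- tail bound -/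
lemma tail_bound (p K : ℕ) (hp : 2 ≤ p) :
    0 ≤ -Real.log (1 - 1/(p:ℝ)) - ∑ k ∈ Finset.Ioc 0 K, 1 / ((k:ℝ) * (p:ℝ)^k) ∧
    -Real.log (1 - 1/(p:ℝ)) - ∑ k ∈ Finset.Ioc 0 K, 1 / ((k:ℝ) * (p:ℝ)^k) ≤ 1 / (((K:ℝ)+1) * (p:ℝ)^K * ((p:ℝ)-1)) := by
  have hp' : (2:ℝ) ≤ p := by exact_mod_cast hp
  set q : ℝ := 1/(p:ℝ) with hq
  have hq0 : 0 < q := by positivity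
  have hq1 : q < 1 := by rw [hq, div_lt_one (by linarith)]; linarith
  have h := Real.hasSum_pow_div_log_of_abs_lt_one (x := q) (by rw [abs_of_pos hq0]; exact hq1)
  have e : ∑ k ∈ Finset.Ioc 0 K, 1 / ((k:ℝ) * (p:ℝ)^k) = ∑ i ∈ range K, q^(i+1)/((i:ℝ)+1) := by
    clear h
    induction K with
    | zero => simp
    | succ K ih =>
      rw [Finset.sum_Ioc_succ_top (by omega), ih, Finset.sum_range_succ, hq]
      congr 1
      push_cast
      rw [one_div_pow, div_div, mul_comm]
  have h1 := (hasSum_nat_add_iff' K).2 h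
  rw [← e] at h1
  refine ⟨h1.nonneg fun n => by positivity, ?_⟩
  have h2 := (hasSum_geometric_of_lt_one hq0.le hq1).mul_left (q^(K+1)/((K:ℝ)+1))
  have h3 := hasSum_le (fun n => ?_) h1 h2
  · refine h3.trans (le_of_eq ?_)
    have h5 : (p:ℝ) - 1 ≠ 0 := by linarith
    have h6 : (1 - q)⁻¹ = (p:ℝ) / ((p:ℝ)-1) := by
      rw [hq, one_sub_div (by linarith), inv_div]
    rw [h6, hq, one_div_pow, pow_succ]
    field_simp
  · rw [show n + K + 1 = (K+1)+n by ring, pow_add, div_mul_eq_mul_div]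
    have : (0:ℝ) ≤ n := by positivity
    push_cast
    gcongr
    linarith

lemma PA_bound (x z : ℝ) (hz : 10 ≤ z) (hzx : z^3 = x) :
    0 ≤ (∑ p ∈ (Finset.range (⌊x⌋₊ + 1)).filter Nat.Prime, (-Real.log (1 - 1/(p:ℝ)))) - A x ∧
    (∑ p ∈ (Finset.range (⌊x⌋₊ + 1)).filter Nat.Prime, (-Real.log (1 - 1/(p:ℝ)))) - A x ≤
      0.25 / (Real.sqrt x - 1.5) + 1/(6*z*(z-1.5)) + z/(2*x) := by
  set S := (Finset.range (⌊x⌋₊ + 1)).filter Nat.Prime with hS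
  have hx1000 : 1000 ≤ x := by
    rw [← hzx]
    calc (1000:ℝ) = 10^3 := by norm_num
      _ ≤ z^3 := pow_le_pow_left₀ (by norm_num) hz 3
  have hx0 : 0 < x := by linarith
  rw [A_eq, ← hS, ← Finset.sum_sub_distrib]
  refine ⟨Finset.sum_nonneg fun p hp => (tail_bound p _ (Finset.mem_filter.1 hp).2.two_le).1, ?_⟩
  set y := Real.sqrt x with hy
  have hyy : y * y = x := Real.mul_self_sqrt hx0.le
  have hy30 : 30 ≤ y := Real.le_sqrt_of_sq_le (by linarith)
  have key : ∀ p ∈ S, -Real.log (1 - 1/(p:ℝ)) - ∑ k ∈ Finset.Ioc 0 (Nat.log p ⌊x⌋₊), 1 / ((k:ℝ) * (p:ℝ)^k) ≤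
      (if y < p then 1/2 * (1/((p:ℝ)*((p:ℝ)-1))) else 0) + (if z < p then 1/(3*z) * (1/((p:ℝ)*((p:ℝ)-1))) else 0)
        + (if (p:ℝ) ≤ z then 1/(2*x) else 0) := by
    intro p hp
    rw [hS, Finset.mem_filter, Finset.mem_range] at hp
    obtain ⟨hpN, hpp⟩ := hp
    refine (tail_bound p _ hpp.two_le).2.trans ?_
    have hp2 : (2:ℝ) ≤ p := by exact_mod_cast hpp.two_le
    have hN0 : ⌊x⌋₊ ≠ 0 := by have := hpp.pos; omega
    set K := Nat.log p ⌊x⌋₊ with hK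
    have hlt : x < (p:ℝ)^(K+1) := by
      have h1 : ⌊x⌋₊ < p^(K+1) := Nat.lt_pow_succ_log_self hpp.one_lt _
      have h2 := (Nat.floor_lt hx0.le).1 h1
      exact_mod_cast h2
    have hKj : ∀ j : ℕ, (p:ℝ)^j ≤ x → j ≤ K := by
      intro j hj
      refine Nat.le_log_of_pow_le hpp.one_lt ?_
      refine (Nat.le_floor_iff hx0.le).2 ?_
      exact_mod_cast hj
    have hpx : (p:ℝ) ≤ x := by
      have : p ≤ ⌊x⌋₊ := by omega
      exact (Nat.le_floor_iff hx0.le).1 this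
    have hp1 : 0 < (p:ℝ) - 1 := by linarith
    have hi1 : 0 ≤ (if y < p then 1/2 * (1/((p:ℝ)*((p:ℝ)-1))) else 0) := by split_ifs <;> positivity
    have hi2 : 0 ≤ (if z < p then 1/(3*z) * (1/((p:ℝ)*((p:ℝ)-1))) else 0) := by split_ifs <;> positivity
    have hi3 : 0 ≤ (if (p:ℝ) ≤ z then 1/(2*x) else 0) := by split_ifs <;> positivity
    by_cases c1 : y < p
    · have hK1 := hKj 1 (by simpa using hpx)
      have hK1' : (1:ℝ) ≤ K := by exact_mod_cast hK1
      have : 1 / (((K:ℝ)+1) * (p:ℝ)^K * ((p:ℝ)-1)) ≤ 1/2 * (1/((p:ℝ)*((p:ℝ)-1))) := by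
        rw [one_div_mul_one_div, ← mul_assoc]
        apply one_div_le_one_div_of_le (by positivity)
        have h1 : (p:ℝ) ≤ (p:ℝ)^K := le_self_pow₀ (by linarith) (by omega)
        have h2 : (2:ℝ) ≤ (K:ℝ)+1 := by linarith
        gcongr
      rw [if_pos c1] at hi1 ⊢
      linarith
    · push Not at c1
      have hpy : (p:ℝ)^2 ≤ x := by rw [← hyy, sq]; exact mul_self_le_mul_self (by linarith) c1
      have hK2 := hKj 2 hpy
      have hK2' : (2:ℝ) ≤ K := by exact_mod_cast hK2
      by_cases c2 : z < p
      · have : 1 / (((K:ℝ)+1) * (p:ℝ)^K * ((p:ℝ)-1)) ≤ 1/(3*z) * (1/((p:ℝ)*((p:ℝ)-1))) := by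
          rw [one_div_mul_one_div]
          apply one_div_le_one_div_of_le (by positivity)
          have h1 : (p:ℝ)^2 ≤ (p:ℝ)^K := pow_le_pow_right₀ (by linarith) hK2
          have h2 : (3:ℝ) ≤ (K:ℝ)+1 := by linarith
          have h3 : 3 * z * ((p:ℝ)*((p:ℝ)-1)) ≤ 3 * p * ((p:ℝ)*((p:ℝ)-1)) := by gcongr
          have h4 : 3 * (p:ℝ)^2 * ((p:ℝ)-1) ≤ ((K:ℝ)+1) * (p:ℝ)^K * ((p:ℝ)-1) := by gcongr
          refine h3.trans (le_trans (le_of_eq (by ring)) h4)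
        rw [if_pos c2] at hi2 ⊢
        linarith
      · push Not at c2
        have hpz : (p:ℝ)^3 ≤ x := by rw [← hzx]; gcongr
        have hK3 := hKj 3 hpz
        have hK3' : (3:ℝ) ≤ K := by exact_mod_cast hK3
        have : 1 / (((K:ℝ)+1) * (p:ℝ)^K * ((p:ℝ)-1)) ≤ 1/(2*x) := by
          apply one_div_le_one_div_of_le (by positivity)
          have h2 : (4:ℝ) ≤ (K:ℝ)+1 := by linarith
          have h3 : (p:ℝ)/2 ≤ (p:ℝ)-1 := by linarith
          have h4 : 4 * (p:ℝ)^K * ((p:ℝ)/2) ≤ ((K:ℝ)+1) * (p:ℝ)^K * ((p:ℝ)-1) := by gcongr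
          rw [pow_succ] at hlt
          linarith
        rw [if_pos c2] at hi3 ⊢
        linarith
  refine (Finset.sum_le_sum key).trans ?_
  rw [Finset.sum_add_distrib, Finset.sum_add_distrib, ← Finset.sum_filter, ← Finset.sum_filter, ← Finset.sum_filter,
    ← Finset.mul_sum, ← Finset.mul_sum, Finset.sum_const, nsmul_eq_mul]
  have hodd : ∀ w : ℝ, 10 ≤ w → ∑ p ∈ S.filter (fun p : ℕ => w < p), 1/((p:ℝ)*((p:ℝ)-1)) ≤ 0.5/(w-1.5) := by
    intro w hw
    have h1 := odd_sum (S.filter (fun p : ℕ => w < p)) ⌊w⌋₊ (Nat.le_floor (by push_cast; linarith)) (by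
      intro n hn
      rw [Finset.mem_filter, hS, Finset.mem_filter] at hn
      have h2 : ⌊w⌋₊ < n := (Nat.floor_lt (by linarith)).2 hn.2
      refine ⟨hn.1.2.odd_of_ne_two ?_, h2⟩
      rintro rfl
      have := hn.2
      push_cast at this
      linarith)
    refine h1.trans ?_
    have h3 : w < (⌊w⌋₊:ℝ) + 1 := Nat.lt_floor_add_one w
    apply div_le_div_of_nonneg_left (by norm_num) (by linarith) (by linarith)
  have h1 := hodd y (by linarith)
  have h2 := hodd z hz
  have h3 : ((S.filter (fun p : ℕ => (p:ℝ) ≤ z)).card : ℝ) ≤ z := by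
    have hsub : S.filter (fun p : ℕ => (p:ℝ) ≤ z) ⊆ Finset.Ioc 0 ⌊z⌋₊ := by
      intro p hp
      rw [Finset.mem_filter, hS, Finset.mem_filter] at hp
      rw [Finset.mem_Ioc]
      exact ⟨hp.1.2.pos, (Nat.le_floor_iff (by linarith)).2 hp.2⟩
    have h4 := Finset.card_le_card hsub
    rw [Nat.card_Ioc, Nat.sub_zero] at h4
    have h5 : (⌊z⌋₊:ℝ) ≤ z := Nat.floor_le (by linarith)
    have h6 : ((S.filter (fun p : ℕ => (p:ℝ) ≤ z)).card : ℝ) ≤ (⌊z⌋₊:ℝ) := by exact_mod_cast h4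
    linarith
  have k1 : 1/2 * (∑ p ∈ S.filter (fun p : ℕ => y < p), 1/((p:ℝ)*((p:ℝ)-1))) ≤ 0.25/(y-1.5) := by
    have : 0.25/(y-1.5) = 1/2 * (0.5/(y-1.5)) := by ring
    rw [this]; linarith
  have k2 : 1/(3*z) * (∑ p ∈ S.filter (fun p : ℕ => z < p), 1/((p:ℝ)*((p:ℝ)-1))) ≤ 1/(6*z*(z-1.5)) := by
    have : 1/(6*z*(z-1.5)) = 1/(3*z) * (0.5/(z-1.5)) := by
      have : z - 1.5 ≠ 0 := by linarith
      field_simp; norm_num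
    rw [this]
    exact mul_le_mul_of_nonneg_left h2 (by positivity)
  have k3 : ((S.filter (fun p : ℕ => (p:ℝ) ≤ z)).card : ℝ) * (1/(2*x)) ≤ z/(2*x) := by
    rw [mul_one_div]
    gcongr
  linarith

end MT

namespace MT


noncomputable def SP (x : ℝ) : ℝ := ∑ p ∈ (Finset.range (⌊x⌋₊ + 1)).filter Nat.Prime, (-Real.log (1 - 1/(p:ℝ)))
noncomputable def QQ (x : ℝ) : ℝ := ∏ p ∈ (Finset.range (⌊x⌋₊ + 1)).filter Nat.Prime, (1 - 1/(p:ℝ))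

lemma QQ_eq (x : ℝ) : QQ x = Real.exp (-SP x) := by
  rw [QQ, SP, Finset.sum_neg_distrib, neg_neg, Real.exp_sum]
  refine Finset.prod_congr rfl fun p hp => ?_
  have h2 : (2:ℝ) ≤ p := by exact_mod_cast (Finset.mem_filter.1 hp).2.two_le
  rw [Real.exp_log]
  have : 1/(p:ℝ) ≤ 1/2 := one_div_le_one_div_of_le (by norm_num) h2
  linarith

lemma PA_norm_aux (s z : ℝ) (hs : 0 < s) (hz : 0 < z) (h : z^3 = s^2) (a b c : ℝ) (ha : 1.5 < a) (has : a ≤ s) (hb : 15.8 ≤ b) (hbz : b ≤ z)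
    (hc : 1 ≤ c^2 * b) (hc0 : 0 < c) :
    (0.25 / (s - 1.5) + 1/(6*z*(z-1.5)) + z/(2*s^2)) * s ≤ 0.25 * a/(a-1.5) + 0.6842 * c := by
  have hu : z / s ≤ c := by
    refine abs_le_of_sq_le_sq' ?_ hc0.le |>.2
    rw [div_pow, ← h]
    rw [div_le_iff₀ (by positivity)]
    have : c^2 * b * z^2 ≤ c^2 * z * z^2 := by gcongr
    have h2 : 1 * z^2 ≤ c^2 * b * z^2 := by gcongr
    linarith
  have e1 : 0.25/(s-1.5) * s ≤ 0.25 * a/(a-1.5) := by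
    rw [div_mul_eq_mul_div, div_le_div_iff₀ (by linarith) (by linarith)]
    nlinarith
  have e2 : 1/(6*z*(z-1.5)) * s ≤ 1/5.43 * (z/s) := by
    rw [div_mul_eq_mul_div, one_mul, div_mul_div_comm, one_mul, div_le_div_iff₀ (by nlinarith) (by positivity)]
    have : s * (5.43 * s) = 5.43 * z^3 := by rw [h]; ring
    rw [this]
    have h3 : 0 ≤ z^2 * (0.57 * z - 9) := mul_nonneg (by positivity) (by linarith)
    linarith
  have e3 : z/(2*s^2) * s = 1/2 * (z/s) := by field_simp
  have : (0.25 / (s - 1.5) + 1/(6*z*(z-1.5)) + z/(2*s^2)) * s = 0.25/(s-1.5) * s + 1/(6*z*(z-1.5)) * s + z/(2*s^2) * s := by ring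
  rw [this, e3]
  have h4 : (1/5.43 + 1/2 : ℝ) ≤ 0.6842 := by norm_num
  have h5 : (1/5.43 + 1/2 : ℝ) * (z/s) ≤ 0.6842 * (z/s) := mul_le_mul_of_nonneg_right h4 (by positivity)
  linarith

lemma cbrt_exists (x : ℝ) (hx : 0 < x) : ∃ z, 0 < z ∧ z^3 = x := by
  refine ⟨x^(1/3:ℝ), by positivity, ?_⟩
  rw [← Real.rpow_natCast, ← Real.rpow_mul hx.le]; norm_num

lemma PA_norm1 (x : ℝ) (hx : 4000 ≤ x) : 0 ≤ SP x - A x ∧ (SP x - A x) * Real.sqrt x ≤ 0.4286 := by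
  obtain ⟨z, hz0, hz⟩ := cbrt_exists x (by linarith)
  have hz1 : 15.8 ≤ z := by
    by_contra h
    push Not at h
    have : z^3 ≤ 15.8^3 := pow_le_pow_left₀ hz0.le h.le 3
    norm_num at this; linarith
  have hs1 : 63.2 ≤ Real.sqrt x := Real.le_sqrt_of_sq_le (by norm_num; linarith)
  have hs0 : 0 < Real.sqrt x := by linarith
  have hsq : Real.sqrt x ^ 2 = x := Real.sq_sqrt (by linarith)
  obtain ⟨h1, h2⟩ := PA_bound x z (by linarith) hz
  refine ⟨h1, ?_⟩
  have h3 := PA_norm_aux (Real.sqrt x) z hs0 hz0 (by rw [hz, hsq]) 63.2 15.8 0.2516 (by norm_num) hs1 le_rfl hz1 (by norm_num) (by norm_num)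
  rw [hsq] at h3
  have h4 := mul_le_mul_of_nonneg_right h2 hs0.le
  have h5 : (0.25 * 63.2/(63.2-1.5) + 0.6842 * 0.2516 : ℝ) ≤ 0.4286 := by norm_num
  exact h4.trans (h3.trans h5)

lemma sqrt_15 (x : ℝ) (hx0 : 0 < x) (hx : 15 ≤ Real.log x) : 1700 ≤ Real.sqrt x := by
  have : Real.exp 7.5 ≤ Real.sqrt x := by
    apply Real.le_sqrt_of_sq_le
    rw [← Real.exp_nat_mul]
    rw [Real.le_log_iff_exp_le hx0] at hx
    norm_num; exact hx
  linarith [exp_75]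

lemma PA_norm2 (x : ℝ) (hx0 : 0 < x) (hx : 15 ≤ Real.log x) : 0 ≤ SP x - A x ∧ (SP x - A x) * Real.sqrt x ≤ 0.3082 := by
  obtain ⟨z, hz0, hz⟩ := cbrt_exists x hx0
  have hs1 := sqrt_15 x hx0 hx
  have hs0 : 0 < Real.sqrt x := by linarith
  have hsq : Real.sqrt x ^ 2 = x := Real.sq_sqrt (by linarith)
  have hx2 : 2890000 ≤ x := by nlinarith
  have hz1 : 140 ≤ z := by
    by_contra h
    push Not at h
    have : z^3 ≤ 140^3 := pow_le_pow_left₀ hz0.le h.le 3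
    norm_num at this; linarith
  obtain ⟨h1, h2⟩ := PA_bound x z (by linarith) hz
  refine ⟨h1, ?_⟩
  have h3 := PA_norm_aux (Real.sqrt x) z hs0 hz0 (by rw [hz, hsq]) 1700 140 0.0846 (by norm_num) hs1 (by norm_num) hz1 (by norm_num) (by norm_num)
  rw [hsq] at h3
  have h4 := mul_le_mul_of_nonneg_right h2 hs0.le
  have h5 : (0.25 * 1700/(1700-1.5) + 0.6842 * 0.0846 : ℝ) ≤ 0.3082 := by norm_num
  exact h4.trans (h3.trans h5)

lemma final_step (E B : ℝ) (hB : 0 ≤ B) (h : |E| ≤ B - B^2/2) : |Real.exp (-E) - 1| ≤ B := by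
  have hl := Real.le_log_one_add_of_nonneg hB
  have h1 : B - B^2/2 ≤ 2*B/(B+2) := by
    rw [le_div_iff₀ (by linarith)]; nlinarith [pow_nonneg hB 3]
  have h2 : |E| ≤ Real.log (1+B) := by linarith
  rw [abs_le] at h2 ⊢
  have h3 : Real.exp (-E) ≤ 1 + B := by
    rw [← Real.le_log_iff_exp_le (by linarith)]; linarith
  have h4 : Real.exp E ≤ 1 + B := by
    rw [← Real.le_log_iff_exp_le (by linarith)]; linarith
  refine ⟨?_, by linarith⟩
  have h5 : Real.exp E * Real.exp (-E) = 1 := by rw [← Real.exp_add]; simp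
  have h6 := Real.exp_pos (-E)
  nlinarith

lemma large_reduce (Z : ZeroData) (x P D : ℝ) (hx : 4000 ≤ x) (hP : |Chebyshev.psi x - x| ≤ Real.sqrt x * P)
    (hD0 : 0 ≤ SP x - A x) (hD : (SP x - A x) * Real.sqrt x ≤ D)
    (hmain : P + (0.0928 + 4/Real.sqrt x) * (1 + 1/Real.log x) + D * Real.log x + 0.0072 * ((Real.log x)^3 / Real.sqrt x)
      ≤ 0.11936 * (Real.log x)^2) :
    |Real.exp Real.eulerMascheroniConstant * Real.log x * QQ x - 1| ≤ 3 * Real.log x / (8 * π * Real.sqrt x) := by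
  have hx0 : 0 < x := by linarith
  set s := Real.sqrt x with hs
  have hs0 : 0 < s := Real.sqrt_pos.2 hx0
  have hsq : s * s = x := Real.mul_self_sqrt hx0.le
  set L := Real.log x with hL
  have hL0 : 0 < L := log_pos2 (by linarith)
  set c := 3 / (8*π) with hc
  have hpi := Real.pi_pos
  have hc1 : 0.11936 ≤ c := by
    rw [hc, le_div_iff₀ (by positivity)]
    have := Real.pi_lt_d4
    linarith
  have hc2 : c ≤ 0.12 := by
    rw [hc, div_le_iff₀ (by positivity)]
    have := Real.pi_gt_d4
    linarith
  have hBeq : 3 * L / (8 * π * s) = c * L / s := by rw [hc]; field_simp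
  rw [hBeq]
  have e : Real.exp Real.eulerMascheroniConstant * L * QQ x = Real.exp (-(SP x - Real.log L - Real.eulerMascheroniConstant)) := by
    rw [QQ_eq, show -(SP x - Real.log L - Real.eulerMascheroniConstant) = Real.eulerMascheroniConstant + Real.log L + (-SP x) by ring, Real.exp_add, Real.exp_add, Real.exp_log hL0]
  rw [e]
  apply final_step _ _ (by positivity)
  have hA := A_bound Z x (by linarith)
  have h1 : |SP x - Real.log L - Real.eulerMascheroniConstant| ≤ |Chebyshev.psi x - x| / (x * L) + 2 * rho x * gg x + (SP x - A x) := by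
    have : SP x - Real.log L - Real.eulerMascheroniConstant = (A x - Real.log (Real.log x) - Real.eulerMascheroniConstant) + (SP x - A x) := by rw [hL]; ring
    rw [this]
    refine (abs_add_le _ _).trans ?_
    rw [abs_of_nonneg hD0]
    linarith
  refine h1.trans ?_
  have hsL : 0 < s * L := by positivity
  rw [← mul_le_mul_iff_left₀ hsL]
  have t1 : |Chebyshev.psi x - x| / (x * L) * (s * L) ≤ P := by
    rw [div_mul_eq_mul_div, div_le_iff₀ (by positivity)]
    have h5 := mul_le_mul_of_nonneg_right hP hsL.le
    refine h5.trans (le_of_eq ?_)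
    rw [← hsq]; ring
  have t2 : 2 * rho x * gg x * (s * L) = (0.0928 + 4/s) * (1 + 1/L) := by
    rw [rho, gg, ← hs, ← hL, ← hsq]
    field_simp
    ring
  have t3 : (SP x - A x) * (s * L) ≤ D * L := by
    rw [← mul_assoc]; exact mul_le_mul_of_nonneg_right hD hL0.le
  have t4 : (c * L / s - (c*L/s)^2/2) * (s * L) = c * L^2 - c^2/2 * (L^3 / s) := by
    field_simp
  rw [t4]
  have t5 : 0.11936 * L^2 ≤ c * L^2 := mul_le_mul_of_nonneg_right hc1 (by positivity)
  have t6 : c^2/2 * (L^3/s) ≤ 0.0072 * (L^3/s) := by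
    apply mul_le_mul_of_nonneg_right _ (by positivity)
    nlinarith
  have : (|Chebyshev.psi x - x| / (x * L) + 2 * rho x * gg x + (SP x - A x)) * (s * L) =
    |Chebyshev.psi x - x| / (x * L) * (s * L) + 2 * rho x * gg x * (s * L) + (SP x - A x) * (s * L) := by ring
  rw [this, t2]
  linarith

lemma L3s (x : ℝ) (hx : 4000 ≤ x) : (Real.log x)^3 / Real.sqrt x ≤ 48 := by
  have hx0 : 0 < x := by linarith
  have hL0 : 0 < Real.log x := log_pos2 (by linarith)
  have h := Real.pow_div_factorial_le_exp (x := Real.log x / 2) (by positivity) 3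
  have h2 : Real.exp (Real.log x / 2) = Real.sqrt x := by
    rw [Real.exp_half, Real.exp_log hx0]
  rw [h2] at h
  have hs0 : 0 < Real.sqrt x := Real.sqrt_pos.2 hx0
  rw [div_le_iff₀ hs0]
  have : ((3:ℕ).factorial : ℝ) = 6 := by norm_num [Nat.factorial]
  rw [this] at h
  have e : (Real.log x/2)^3/6 = (Real.log x)^3/48 := by ring
  rw [e] at h
  linarith

lemma large2 (Z : ZeroData) (x : ℝ) (hx : 4000 ≤ x) (hL : 15 ≤ Real.log x) :
    |Real.exp Real.eulerMascheroniConstant * Real.log x * QQ x - 1| ≤ 3 * Real.log x / (8 * π * Real.sqrt x) := by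
  have hx0 : 0 < x := by linarith
  obtain ⟨h1, h2⟩ := PA_norm2 x hx0 hL
  refine large_reduce Z x _ _ hx (psi_reg2 Z x hx0 hL) h1 h2 ?_
  have h3 := L3s x hx
  have h4 := sqrt_15 x hx0 hL
  have h5 : 4 / Real.sqrt x ≤ 0.0024 := by rw [div_le_iff₀ (by linarith)]; linarith
  have h6 : 1 / Real.log x ≤ 0.067 := by rw [div_le_iff₀ (by linarith)]; linarith
  have h7 : (0.0928 + 4/Real.sqrt x) * (1 + 1/Real.log x) ≤ 0.0952 * 1.067 := by
    apply mul_le_mul (by linarith) (by linarith) _ (by norm_num)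
    have : 0 < Real.log x := by linarith
    positivity
  nlinarith

lemma log4000 (x : ℝ) (hx : 4000 ≤ x) : 8.29 ≤ Real.log x := by
  have h1 : Real.log 4000 ≤ Real.log x := Real.log_le_log (by norm_num) hx
  have h2 : Real.log 4000 = 12 * Real.log 2 - Real.log 1.024 := by
    rw [show (12:ℝ) * Real.log 2 = Real.log (2^12) by rw [Real.log_pow]; norm_num, ← Real.log_div (by norm_num) (by norm_num)]
    norm_num
  have h3 := Real.log_le_sub_one_of_pos (show (0:ℝ) < 1.024 by norm_num)
  have h4 := Real.log_two_gt_d9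
  norm_num at h3 h4 ⊢
  linarith

lemma exp_chord (a b t : ℝ) (hab : a < b) (h1 : a ≤ t) (h2 : t ≤ b) :
    Real.exp t * (b - a) ≤ (b-t) * Real.exp a + (t-a) * Real.exp b := by
  have hba : 0 < b - a := by linarith
  have h := convexOn_exp.2 (Set.mem_univ a) (Set.mem_univ b)
    (show 0 ≤ (b-t)/(b-a) from div_nonneg (by linarith) hba.le) (show 0 ≤ (t-a)/(b-a) from div_nonneg (by linarith) hba.le) (by field_simp; ring)
  have e : ((b-t)/(b-a)) • a + ((t-a)/(b-a)) • b = t := by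
    simp only [smul_eq_mul]; field_simp; ring
  rw [e] at h
  simp only [smul_eq_mul] at h
  have h3 := mul_le_mul_of_nonneg_right h hba.le
  refine h3.trans (le_of_eq ?_)
  field_simp

lemma exp_vals : Real.exp 2 ≤ 7.3891 ∧ Real.exp 3 ≤ 20.0856 ∧ Real.exp 3.75 ≤ 42.53 := by
  have h := Real.exp_one_lt_d9.le
  have h0 := Real.exp_pos 1
  refine ⟨?_, ?_, ?_⟩
  · rw [show (2:ℝ) = (2:ℕ) * 1 by norm_num, Real.exp_nat_mul]
    exact (pow_le_pow_left₀ h0.le h 2).trans (by norm_num)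
  · rw [show (3:ℝ) = (3:ℕ) * 1 by norm_num, Real.exp_nat_mul]
    exact (pow_le_pow_left₀ h0.le h 3).trans (by norm_num)
  · by_contra hc
    push Not at hc
    have h1 : (42.53:ℝ)^4 ≤ Real.exp 3.75 ^ 4 := pow_le_pow_left₀ (by norm_num) hc.le 4
    rw [← Real.exp_nat_mul, show ((4:ℕ):ℝ) * 3.75 = (15:ℕ) * 1 by norm_num, Real.exp_nat_mul] at h1
    have h2 := (pow_le_pow_left₀ h0.le h 15)
    have h3 := h1.trans h2
    norm_num at h3

lemma quad1 (L v : ℝ) (h1 : 8.29 ≤ L) (h2 : L ≤ 12) (hv : v * 1 ≤ (3 - L/4) * 7.3891 + (L/4-2) * 20.0856) :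
    0.43082 * v + 0.4286 * L + 0.71 ≤ 0.11936 * L^2 := by
  nlinarith

lemma quad2 (L v : ℝ) (h1 : 12 ≤ L) (h2 : L ≤ 15) (hv : v * 0.75 ≤ (3.75 - L/4) * 20.0856 + (L/4-3) * 42.53) :
    0.43082 * v + 0.4286 * L + 0.71 ≤ 0.11936 * L^2 := by
  nlinarith

lemma v_bound (L : ℝ) (h1 : 8.29 ≤ L) (h2 : L ≤ 15) :
    0.43082 * Real.exp (L/4) + 0.4286 * L + 0.71 ≤ 0.11936 * L^2 := by
  obtain ⟨e2, e3, e4⟩ := exp_vals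
  rcases le_total L 12 with h | h
  · refine quad1 L _ h1 h ?_
    have h5 := exp_chord 2 3 (L/4) (by norm_num) (by linarith) (by linarith)
    have h6 := mul_le_mul_of_nonneg_left e2 (show 0 ≤ 3 - L/4 by linarith)
    have h7 := mul_le_mul_of_nonneg_left e3 (show 0 ≤ L/4-2 by linarith)
    linarith
  · refine quad2 L _ h h2 ?_
    have h5 := exp_chord 3 3.75 (L/4) (by norm_num) (by linarith) (by linarith)
    have h6 := mul_le_mul_of_nonneg_left e3 (show 0 ≤ 3.75 - L/4 by linarith)
    have h7 := mul_le_mul_of_nonneg_left e4 (show 0 ≤ L/4-3 by linarith)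
    linarith

lemma large1 (Z : ZeroData) (x : ℝ) (hx : 4000 ≤ x) (hL : Real.log x ≤ 15) :
    |Real.exp Real.eulerMascheroniConstant * Real.log x * QQ x - 1| ≤ 3 * Real.log x / (8 * π * Real.sqrt x) := by
  have hx0 : 0 < x := by linarith
  obtain ⟨h1, h2⟩ := PA_norm1 x hx
  have hL1 := log4000 x hx
  have hvb := v_bound _ hL1 hL
  set v := Real.exp (Real.log x / 4) with hv
  have hv0 : 0 < v := Real.exp_pos _
  have hv2 : v^2 = Real.sqrt x := by
    rw [hv, ← Real.exp_nat_mul, show ((2:ℕ):ℝ) * (Real.log x/4) = Real.log x / 2 by push_cast; ring, Real.exp_half, Real.exp_log hx0]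
  have hs1 : 63.2 ≤ Real.sqrt x := Real.le_sqrt_of_sq_le (by norm_num; linarith)
  have hv1 : 1 ≤ v := Real.one_le_exp (by linarith)
  have hsq : Real.sqrt x ^ 2 = x := Real.sq_sqrt hx0.le
  have hreg := psi_reg1 Z x (0.43/v) (by positivity) (by rw [div_le_one hv0]; linarith) (by linarith)
  have hreg2 : |Chebyshev.psi x - x| ≤ Real.sqrt x * (0.43082 * v + 0.13885 + 3/Real.sqrt x) := by
    refine hreg.trans ?_
    rw [← hsq, ← hv2]
    have e1 : Real.sqrt ((v^2)^2) = v^2 := Real.sqrt_sq (by positivity)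
    rw [e1]
    have e2 : 2/(0.43/v) = v * (2/0.43) := by field_simp
    have e3 : (v^2)^2 * (0.43/v/2 + (0.43/v)^2/2) = v^2 * (0.215*v + 0.09245) := by
      field_simp; ring
    have e4 : v^2 * (0.43082 * v + 0.13885 + 3/v^2) = v^2 * (0.43082 * v + 0.13885) + 3 := by
      field_simp
    rw [e2, e3, e4]
    have h5 : (2/0.43:ℝ) ≤ 4.6512 := by norm_num
    have h6 := mul_le_mul_of_nonneg_left h5 hv0.le
    have h7 : 0.0464 * (v * (2/0.43) + 1) ≤ 0.21582 * v + 0.0464 := by linarith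
    have h8 := mul_le_mul_of_nonneg_left h7 (show 0 ≤ v^2 by positivity)
    have : 0 ≤ v^2 * v := by positivity
    linarith
  refine large_reduce Z x _ _ hx hreg2 h1 h2 ?_
  have h3 := L3s x hx
  have h4 : 1 / Real.sqrt x ≤ 0.015824 := by rw [div_le_iff₀ (by linarith)]; linarith
  have h4' : 3 / Real.sqrt x = 3 * (1/Real.sqrt x) := by ring
  have h5 : 4 / Real.sqrt x = 4 * (1/Real.sqrt x) := by ring
  have h6 : 1 / Real.log x ≤ 0.12063 := by rw [div_le_iff₀ (by linarith)]; linarith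
  have h7 : (0.0928 + 4/Real.sqrt x) * (1 + 1/Real.log x) ≤ 0.1561 * 1.12063 := by
    apply mul_le_mul (by rw [h5]; linarith) (by linarith) _ (by norm_num)
    have : 0 < Real.log x := by linarith
    positivity
  rw [h4']
  linarith

theorem large (Z : ZeroData) (x : ℝ) (hx : 4000 ≤ x) :
    |Real.exp Real.eulerMascheroniConstant * Real.log x * QQ x - 1| ≤ 3 * Real.log x / (8 * π * Real.sqrt x) := by
  rcases le_total (Real.log x) 15 with h | h
  · exact large1 Z x hx h
  · exact large2 Z x hx h

end MT

namespace MT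

def force (n : ℕ) (f : ℕ → Bool) : Bool :=
  match n with
  | 0 => f 0
  | k+1 => f (k+1)

lemma force_eq (n : ℕ) (f : ℕ → Bool) : force n f = f n := by cases n <;> rfl

def P61 : ℕ := 117288381359406970983270

def isP (n : ℕ) : Bool := cond (Nat.ble 121 n) (Nat.beq (Nat.gcd n 117288381359406970983270) 1) (Nat.beq (Nat.gcd n 210) 1)

def loop : ℕ → ℕ → ℕ → ℕ → ℕ → ℕ → Bool
  | 0, _, _, _, _, _ => true
  | k+1, n, ql, qh, ll, lh =>
    force (lh + (1000000000000*(2*n+1))/(2*n*(n+1)) + 1) fun lh' =>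
    force (1000000000000*1000000000000 - ql*ll) fun d =>
    cond (Nat.ble (qh*lh') (1000000000000*1000000000000)) 
    (cond (Nat.ble (d*d*n*10000000000) (11936*11936*(ll*ll)*(1000000000000*1000000000000)))
    (cond (Nat.ble (25*lh') (2000*ql))
    (force (n+1) fun n' =>
     force (ll + (2*1000000000000)/(2*n+1)) fun ll' =>
     cond (isP n')
       (force (ql*n/n') fun ql' => force (qh*n/n'+1) fun qh' => loop k n' ql' qh' ll' lh')
       (loop k n' ql qh ll' lh')) false) false) false

set_option maxRecDepth 100000 in
lemma loop_true : loop 3976 24 291355000000 291367000000 3178050000000 3178060000000 = true := by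
  decide +kernel

end MT

namespace MT

lemma prime_of_gcd (P B : ℕ) (hB : ∀ d, d < B → 2 ≤ d → Nat.gcd d P ≠ 1) (n : ℕ) (h2 : 2 ≤ n)
    (hn : n < B * B) (hg : Nat.gcd n P = 1) : n.Prime := by
  by_contra hp
  have h1 : n.minFac ^ 2 ≤ n := Nat.minFac_sq_le_self (by omega) hp
  have h3 : n.minFac < B := by
    by_contra h; push Not at h; nlinarith
  refine hB _ h3 (Nat.minFac_prime (by omega)).two_le ?_
  exact Nat.Coprime.coprime_dvd_left (Nat.minFac_dvd n) hg

lemma isP_iff (n : ℕ) (h1 : 24 ≤ n) (h2 : n < 4489) : isP n = true ↔ n.Prime := by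
  unfold isP
  by_cases h : 121 ≤ n
  · have hb : Nat.ble 121 n = true := by rw [Nat.ble_eq]; exact h
    rw [hb, cond_true, Nat.beq_eq]
    constructor
    · exact fun hg => prime_of_gcd _ 67 (by decide +kernel) n (by omega) (by omega) hg
    · intro hp
      refine (Nat.Prime.coprime_iff_not_dvd hp).2 ?_
      have : (117288381359406970983270:ℕ) = 2*3*5*7*11*13*17*19*23*29*31*37*41*43*47*53*59*61 := by norm_num
      rw [this]
      simp only [hp.dvd_mul]
      have key : ∀ q, 0 < q → q < 121 → ¬ n ∣ q := fun q h0 hq hd => by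
        have := Nat.le_of_dvd h0 hd; omega
      simp [key]
  · have hb : Nat.ble 121 n = false := by
      rw [← Bool.not_eq_true, Nat.ble_eq]; exact h
    rw [hb, cond_false, Nat.beq_eq]
    constructor
    · exact fun hg => prime_of_gcd _ 11 (by decide +kernel) n (by omega) (by omega) hg
    · intro hp
      refine (Nat.Prime.coprime_iff_not_dvd hp).2 ?_
      have : (210:ℕ) = 2*3*5*7 := by norm_num
      rw [this]
      simp only [hp.dvd_mul]
      have key : ∀ q, 0 < q → q < 24 → ¬ n ∣ q := fun q h0 hq hd => by
        have := Nat.le_of_dvd h0 hd; omega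
      simp [key]

noncomputable def KK (n : ℕ) : ℝ :=
  Real.exp Real.eulerMascheroniConstant * ∏ p ∈ (Finset.range (n+1)).filter Nat.Prime, (1 - 1/(p:ℝ))

lemma KK_prime (n : ℕ) (hp : (n+1).Prime) : KK (n+1) = KK n * ((n:ℝ)/(n+1)) := by
  unfold KK
  rw [Finset.range_add_one (n := n+1), Finset.filter_insert, if_pos hp, Finset.prod_insert (by simp)]
  have : (1:ℝ) - 1/((n+1:ℕ):ℝ) = (n:ℝ)/(n+1) := by
    have : (n:ℝ)+1 ≠ 0 := by positivity
    push_cast; field_simp; ring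
  rw [this]; ring

lemma KK_comp (n : ℕ) (hp : ¬ (n+1).Prime) : KK (n+1) = KK n := by
  unfold KK
  rw [Finset.range_add_one (n := n+1), Finset.filter_insert, if_neg hp]

lemma piece_lo (κ a x c : ℝ) (ha : 1 ≤ a) (hax : a ≤ x) (hc : 0 ≤ c)
    (h1 : c * Real.log a / √a ≤ 2 * κ) (h2 : 1 ≤ κ * Real.log a + c * Real.log a / √a) :
    1 ≤ κ * Real.log x + c * Real.log x / √x := by
  have hx : 0 < x := by linarith
  have ha0 : 0 < a := by linarith
  have hla : 0 ≤ Real.log a := Real.log_nonneg ha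
  obtain ⟨u, hu⟩ : ∃ u, u = Real.log x - Real.log a := ⟨_, rfl⟩
  have hu0 : 0 ≤ u := by have := Real.log_le_log ha0 hax; linarith
  have hsa : 0 < √a := Real.sqrt_pos.2 ha0
  have hsx : √x = √a * Real.exp (u/2) := by
    rw [← Real.exp_log (Real.sqrt_pos.2 hx), ← Real.exp_log hsa, ← Real.exp_add,
      Real.log_sqrt hx.le, Real.log_sqrt ha0.le, hu]
    congr 1; ring
  have e : c * Real.log x / √x = c / √a * (Real.log a + u) * Real.exp (-(u/2)) := by
    rw [hsx, Real.exp_neg, show Real.log x = Real.log a + u by linarith]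
    field_simp
  have h3 : 1 - u/2 ≤ Real.exp (-(u/2)) := by have := Real.add_one_le_exp (-(u/2)); linarith
  have hca : 0 ≤ c / √a := by positivity
  have h4 : c / √a * Real.log a * (1 - u/2) ≤ c / √a * (Real.log a + u) * Real.exp (-(u/2)) := by
    calc _ ≤ c / √a * Real.log a * Real.exp (-(u/2)) := by gcongr
      _ ≤ _ := by gcongr; linarith
  rw [e, show Real.log x = Real.log a + u by linarith]
  have e2 : c * Real.log a / √a = c / √a * Real.log a := by ring
  rw [e2] at h1 h2
  nlinarith

lemma finish (κ x b : ℝ) (hx : 1 ≤ x) (hxb : x ≤ b) (hκ : 0 ≤ κ) (h1 : κ * Real.log b ≤ 1)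
    (h2 : 1 ≤ κ * Real.log x + 0.11936 * Real.log x / √x) :
    |κ * Real.log x - 1| ≤ 3 * Real.log x / (8 * π * √x) := by
  have hl : 0 ≤ Real.log x := Real.log_nonneg hx
  have h3 : κ * Real.log x ≤ 1 := le_trans (by gcongr) h1
  have hs : 0 < √x := Real.sqrt_pos.2 (by linarith)
  have h4 : 0.11936 * Real.log x / √x ≤ 3 * Real.log x / (8 * π * √x) := by
    have hp := Real.pi_lt_d4
    have hp0 := Real.pi_pos
    rw [div_le_div_iff₀ hs (by positivity)]
    have : 0.11936 * (8 * π) ≤ 3 := by norm_num at *; linarith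
    have h5 := mul_le_mul_of_nonneg_right this (mul_nonneg hl hs.le)
    linarith
  rw [abs_le]; constructor <;> linarith

def Good (n : ℕ) : Prop := ∀ x : ℝ, (n:ℝ) ≤ x → x < n + 1 →
    |KK n * Real.log x - 1| ≤ 3 * Real.log x / (8 * π * √x)

def Inv (n ql qh ll lh : ℕ) : Prop :=
  (ql:ℝ) ≤ KK n * 1000000000000 ∧ KK n * 1000000000000 ≤ qh ∧
  (ll:ℝ) ≤ Real.log n * 1000000000000 ∧ Real.log n * 1000000000000 ≤ lh

lemma natsub (A B d : ℕ) (h : d = A - B) : (A:ℝ) ≤ d + B := by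
  have : A ≤ d + B := by omega
  exact_mod_cast this

lemma good_of (n ql qh ll lh lh' : ℕ) (hn : 24 ≤ n) (hI : Inv n ql qh ll lh)
    (hl' : Real.log (n+1) * 1000000000000 ≤ lh')
    (c1 : qh*lh' ≤ 1000000000000*1000000000000)
    (c2 : (1000000000000*1000000000000 - ql*ll)*(1000000000000*1000000000000 - ql*ll)*n*10000000000 ≤ 11936*11936*(ll*ll)*(1000000000000*1000000000000))
    (c3 : 25*lh' ≤ 2000*ql) : Good n := by
  intro x hx1 hx2
  obtain ⟨i1, i2, i3, i4⟩ := hI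
  have hnR : (24:ℝ) ≤ n := by exact_mod_cast hn
  have hκ : 0 ≤ KK n := by
    have : (0:ℝ) ≤ ql := by positivity
    nlinarith
  have hL : 0 ≤ Real.log n := Real.log_nonneg (by linarith)
  have hL1 : Real.log n ≤ Real.log (n+1) := Real.log_le_log (by linarith) (by linarith)
  have hs : 0 < √(n:ℝ) := Real.sqrt_pos.2 (by linarith)
  have hs48 : 4.8 ≤ √(n:ℝ) := by apply Real.le_sqrt_of_sq_le; norm_num; linarith
  have c1' : (qh:ℝ)*lh' ≤ 1000000000000*1000000000000 := by exact_mod_cast c1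
  have c3' : 25*(lh':ℝ) ≤ 2000*ql := by exact_mod_cast c3
  refine finish (KK n) x (n+1) (by linarith) hx2.le hκ ?_ ?_
  · have := mul_le_mul i2 hl' (by have := hL.trans hL1; positivity) (by positivity)
    nlinarith
  · refine piece_lo (KK n) n x _ (by linarith) hx1 (by norm_num) ?_ ?_
    · rw [div_le_iff₀ hs]
      have h5 : 0.025 * Real.log n ≤ 2 * KK n := by
        norm_num; linarith
      have : 2 * KK n * 4.8 ≤ 2 * KK n * √(n:ℝ) := by gcongr
      norm_num at *; linarith
    · obtain ⟨d, hd⟩ : ∃ d, d = 1000000000000*1000000000000 - ql*ll := ⟨_, rfl⟩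
      rw [← hd] at c2
      have hd' : (1000000000000*1000000000000:ℝ) - ql*ll ≤ d := by
        have := natsub _ _ _ hd
        push_cast at this
        norm_num at this ⊢
        linarith
      have c2' : (d:ℝ)*d*n*10000000000 ≤ 11936*11936*(ll*ll)*(1000000000000*1000000000000) := by
        exact_mod_cast c2
      have hsq : √(n:ℝ)*√(n:ℝ) = n := Real.mul_self_sqrt (by linarith)
      have c4 : (d:ℝ) * √(n:ℝ) * 100000 ≤ 11936 * ll * 1000000000000 := by
        refine le_of_sq_le_sq ?_ (by positivity)
        · have : ((d:ℝ) * √(n:ℝ) * 100000)^2 = d*d*(√(n:ℝ)*√(n:ℝ))*10000000000 := by ring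
          rw [this, hsq]
          refine c2'.trans (le_of_eq ?_); ring
      have h6 : (ql:ℝ)*ll ≤ KK n * Real.log n * (1000000000000*1000000000000) := by
        have := mul_le_mul i1 i3 (by positivity) (by positivity)
        linarith
      have h7 : (d:ℝ) ≤ 0.11936 * Real.log n / √(n:ℝ) * (1000000000000*1000000000000) := by
        rw [div_mul_eq_mul_div, le_div_iff₀ hs]
        norm_num at *; linarith
      linarith

lemma log_step (n ll lh : ℕ) (hn : 1 ≤ n) (h1 : (ll:ℝ) ≤ Real.log n * 1000000000000)
    (h2 : Real.log n * 1000000000000 ≤ lh) :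
    ((ll + (2*1000000000000)/(2*n+1) : ℕ):ℝ) ≤ Real.log (n+1) * 1000000000000 ∧
    Real.log (n+1) * 1000000000000 ≤ ((lh + (1000000000000*(2*n+1))/(2*n*(n+1)) + 1 : ℕ):ℝ) := by
  have hn' : (0:ℝ) < n := by exact_mod_cast hn
  obtain ⟨b1, b2⟩ := log_add_one_bounds n hn'
  constructor
  · have := Nat.cast_div_le (α := ℝ) (m := 2*1000000000000) (n := 2*n+1)
    push_cast at this ⊢
    have e : (2000000000000:ℝ)/(2*n+1) = 2/(2*n+1) * 1000000000000 := by ring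
    rw [e] at this
    linarith
  · have h : ((1000000000000*(2*n+1) : ℕ):ℝ) / ((2*n*(n+1):ℕ):ℝ) < ((1000000000000*(2*n+1)/(2*n*(n+1)) : ℕ):ℝ) + 1 := by
      rw [← Nat.floor_div_eq_div (K := ℝ)]; exact Nat.lt_floor_add_one _
    have e : ((1000000000000*(2*n+1) : ℕ):ℝ) / ((2*n*(n+1):ℕ):ℝ) = (1/(n:ℝ) + 1/(n+1))/2 * 1000000000000 := by
      push_cast; field_simp; ring
    rw [e] at h
    rw [Nat.cast_add, Nat.cast_add, Nat.cast_one]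
    linarith

lemma q_step (n q : ℕ) (κ : ℝ)  :
    ((q:ℝ) ≤ κ * 1000000000000 → ((q*n/(n+1) : ℕ):ℝ) ≤ κ * ((n:ℝ)/(n+1)) * 1000000000000) ∧
    (κ * 1000000000000 ≤ q → κ * ((n:ℝ)/(n+1)) * 1000000000000 ≤ ((q*n/(n+1)+1 : ℕ):ℝ)) := by
  have e : ((q*n:ℕ):ℝ)/((n+1:ℕ):ℝ) = q * ((n:ℝ)/(n+1)) := by push_cast; ring
  have hr : (0:ℝ) ≤ (n:ℝ)/(n+1) := by positivity
  constructor
  · intro h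
    have := Nat.cast_div_le (α := ℝ) (m := q*n) (n := n+1)
    rw [e] at this
    nlinarith
  · intro h
    have h3 : ((q*n : ℕ):ℝ) / ((n+1:ℕ):ℝ) < ((q*n/(n+1) : ℕ):ℝ) + 1 := by
      rw [← Nat.floor_div_eq_div (K := ℝ)]; exact Nat.lt_floor_add_one _
    rw [e] at h3
    rw [Nat.cast_add, Nat.cast_one]
    nlinarith

lemma loop_sound : ∀ (k n ql qh ll lh : ℕ), 24 ≤ n → n + k ≤ 4000 → Inv n ql qh ll lh →
    loop k n ql qh ll lh = true → ∀ m, n ≤ m → m < n + k → Good m := by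
  intro k
  induction k with
  | zero => intro n _ _ _ _ _ _ _ _ m h1 h2; omega
  | succ k ih =>
    intro n ql qh ll lh hn hk hI hl m hm1 hm2
    rw [loop] at hl
    simp only [force_eq] at hl
    obtain ⟨l1, l2⟩ := log_step n ll lh (by omega) hI.2.2.1 hI.2.2.2
    generalize (lh + (1000000000000*(2*n+1))/(2*n*(n+1)) + 1) = lh' at hl l2
    generalize (ll + (2*1000000000000)/(2*n+1)) = ll' at hl l1
    rw [Bool.cond_eq_ite] at hl
    split_ifs at hl with c1
    rw [Bool.cond_eq_ite] at hl
    split_ifs at hl with c2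
    rw [Bool.cond_eq_ite] at hl
    split_ifs at hl with c3
    rw [Nat.ble_eq] at c1 c2 c3
    rcases Nat.eq_or_lt_of_le hm1 with h | h
    · rw [← h]; exact good_of n ql qh ll lh lh' hn hI l2 c1 c2 c3
    · rw [Bool.cond_eq_ite] at hl
      have hip := isP_iff (n+1) (by omega) (by omega)
      split_ifs at hl with c4
      · have hp := hip.1 c4
        refine ih (n+1) _ _ _ _ (by omega) (by omega) ?_ hl m (by omega) (by omega)
        refine ⟨?_, ?_, ?_, ?_⟩
        · rw [KK_prime n hp]; exact (q_step n ql _).1 hI.1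
        · rw [KK_prime n hp]; exact (q_step n qh _).2 hI.2.1
        · push_cast; exact l1
        · push_cast; exact l2
      · have hp : ¬ (n+1).Prime := fun h => c4 (hip.2 h)
        refine ih (n+1) _ _ _ _ (by omega) (by omega) ?_ hl m (by omega) (by omega)
        refine ⟨?_, ?_, ?_, ?_⟩
        · rw [KK_comp n hp]; exact hI.1
        · rw [KK_comp n hp]; exact hI.2.1
        · push_cast; exact l1
        · push_cast; exact l2

lemma KK23 : 0.291355 ≤ KK 23 ∧ KK 23 ≤ 0.291367 := by
  have hQ : ∏ p ∈ (Finset.range (23+1)).filter Nat.Prime, (1 - 1/(p:ℝ)) = 110592/676039 := by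
    have : (Finset.range (23+1)).filter Nat.Prime = {2,3,5,7,11,13,17,19,23} := by decide +kernel
    rw [this]
    norm_num
  obtain ⟨g1, g2⟩ := gamma_num
  have e1 : Real.exp 0.577195 ≤ Real.exp Real.eulerMascheroniConstant := Real.exp_le_exp.2 g1
  have e2 : Real.exp Real.eulerMascheroniConstant ≤ Real.exp 0.577227 := Real.exp_le_exp.2 g2
  have f1 := Real.sum_le_exp_of_nonneg (x := 0.577195) (by norm_num) 9
  have f2 := Real.exp_bound' (x := 0.577227) (by norm_num) (by norm_num) (n := 9) (by norm_num)
  norm_num [Finset.sum_range_succ, Nat.factorial] at f1 f2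
  unfold KK
  rw [hQ]
  norm_num at f1 f2 ⊢
  rw [show (0.577195:ℝ) = 115439/200000 by norm_num] at e1
  rw [show (0.577227:ℝ) = 577227/1000000 by norm_num] at e2
  constructor <;> linarith

lemma log24 : 3.178050 ≤ Real.log 24 ∧ Real.log 24 ≤ 3.178060 := by
  have h : Real.log 24 = 3 * Real.log 2 + Real.log 3 := by
    rw [show (24:ℝ) = 2^3*3 by norm_num, Real.log_mul (by norm_num) (by norm_num), Real.log_pow]
    norm_num
  have := Real.log_two_gt_d9
  have := Real.log_two_lt_d9
  have := Real.log_three_gt_d9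
  have := Real.log_three_lt_d9
  rw [h]; norm_num at *; constructor <;> linarith

lemma first_piece (x : ℝ) (h1 : 23.8 ≤ x) (h2 : x < 24) :
    |KK 23 * Real.log x - 1| ≤ 3 * Real.log x / (8 * π * √x) := by
  obtain ⟨k1, k2⟩ := KK23
  obtain ⟨l1, l2⟩ := log24
  have hκ : 0 ≤ KK 23 := le_trans (by norm_num) k1
  have h238 : 3.16964 ≤ Real.log 23.8 := by
    have h : Real.log 24 = Real.log 23.8 + Real.log (24/23.8) := by
      rw [← Real.log_mul (by norm_num) (by norm_num)]; norm_num
    have := Real.log_le_sub_one_of_pos (x := 24/23.8) (by norm_num)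
    norm_num at *; linarith
  have h238' : Real.log 23.8 ≤ 3.178060 := le_trans (Real.log_le_log (by norm_num) (by norm_num)) l2
  have s1 : 4.8 ≤ √(23.8:ℝ) := by apply Real.le_sqrt_of_sq_le; norm_num
  have s2 : √(23.8:ℝ) ≤ 4.8786 := by rw [Real.sqrt_le_left (by norm_num)]; norm_num
  have hs : 0 < √(23.8:ℝ) := by linarith
  refine finish (KK 23) x 24 (by norm_num at *; linarith) h2.le hκ ?_ ?_
  · calc KK 23 * Real.log 24 ≤ 0.291367 * 3.178060 := by gcongr
      _ ≤ 1 := by norm_num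
  · refine piece_lo (KK 23) 23.8 x _ (by norm_num) h1 (by norm_num) ?_ ?_
    · rw [div_le_iff₀ hs]
      have : 2 * 0.291355 * 4.8 ≤ 2 * KK 23 * √(23.8:ℝ) := by gcongr
      norm_num at *; linarith
    · have a1 : 0.291355 * 3.16964 ≤ KK 23 * Real.log 23.8 := by gcongr
      have a2 : 0.11936 * 3.16964 / 4.8786 ≤ 0.11936 * Real.log 23.8 / √(23.8:ℝ) := by gcongr
      norm_num at *; linarith

lemma small (x : ℝ) (h1 : 23.8 ≤ x) (h2 : x < 4000) :
    |KK ⌊x⌋₊ * Real.log x - 1| ≤ 3 * Real.log x / (8 * π * √x) := by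
  have hx0 : 0 ≤ x := le_trans (by norm_num) h1
  have f1 := Nat.floor_le hx0
  have f2 := Nat.lt_floor_add_one x
  rcases lt_or_ge x 24 with h | h
  · have : ⌊x⌋₊ = 23 := by
      rw [Nat.floor_eq_iff hx0]; constructor <;> norm_num at * <;> linarith
    rw [this]; exact first_piece x h1 h
  · have h3 : 24 ≤ ⌊x⌋₊ := Nat.le_floor (by exact_mod_cast h)
    have h4 : ⌊x⌋₊ < 4000 := (Nat.floor_lt hx0).2 (by exact_mod_cast h2)
    refine loop_sound 3976 24 _ _ _ _ le_rfl (by norm_num) ?_ loop_true ⌊x⌋₊ h3 (by omega) x f1 f2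
    have hk : KK 24 = KK 23 := KK_comp 23 (by norm_num)
    obtain ⟨k1, k2⟩ := KK23
    obtain ⟨l1, l2⟩ := log24
    rw [← hk] at k1 k2
    refine ⟨?_, ?_, ?_, ?_⟩ <;> norm_num at * <;> linarith

end MT

theorem mertens_third_RH (hRH : RiemannHypothesis) :
    ∀ x : ℝ, 23.8 ≤ x →
      |Real.exp Real.eulerMascheroniConstant * Real.log x *
          (∏ p ∈ (Finset.range (⌊x⌋₊ + 1)).filter Nat.Prime, (1 - 1 / (p : ℝ))) - 1|
        ≤ 3 * Real.log x / (8 * π * Real.sqrt x) := by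
  intro x hx
  obtain ⟨Z⟩ := MT.exists_zeroData hRH
  rcases lt_or_ge x 4000 with h | h
  · have := MT.small x hx h
    rw [MT.KK, mul_right_comm] at this
    exact this
  · exact MT.large Z x h
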